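/- (Hadwiger's theorem) Let n ≥ 1. Every continuous, translation invariant, real-valued valuation μ on ℝⁿ that is invariant under all rotations g ∈ SO(n) (i.e. μ(gK) = μ(K) for all g ∈ SO(n) and all K) can be written in exactly one way as μ = Σ_{k=0}^{n} c_k μ_k with real coefficients c_0, ..., c_n, where μ_0, ..., μ_n are the intrinsic volumes. In particular the space of such valuations has dimension n + 1. -/

import Mathlib

open MeasureTheory Metric Set
open scoped Pointwise ENNReal

noncomputable section

/-- Euclidean `n`-space. -/
abbrev En (n : ℕ) := EuclideanSpace ℝ (Fin n)

instance matrixMeasurableSpace (n : ℕ) : MeasurableSpace (Matrix (Fin n) (Fin n) ℝ) :=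
  inferInstanceAs (MeasurableSpace ((Fin n) → (Fin n) → ℝ))

/-- The special orthogonal group `SO(n)`, as the subgroup of the (real) unitary group
consisting of matrices of determinant one. -/
def SO (n : ℕ) : Subgroup (Matrix.unitaryGroup (Fin n) ℝ) where
  carrier := {g | Matrix.det (g : Matrix (Fin n) (Fin n) ℝ) = 1}
  one_mem' := by simp
  mul_mem' := by
    intro a b ha hb
    simp only [Set.mem_setOf_eq] at *
    rw [MulMemClass.coe_mul, Matrix.det_mul, ha, hb, mul_one]
  inv_mem' := by
    intro a ha
    simp only [Set.mem_setOf_eq] at *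
    have h : ((a⁻¹ * a : Matrix.unitaryGroup (Fin n) ℝ) : Matrix (Fin n) (Fin n) ℝ) = 1 := by
      rw [inv_mul_cancel]; rfl
    have h2 := congrArg Matrix.det h
    rw [MulMemClass.coe_mul, Matrix.det_mul, ha, mul_one, Matrix.det_one] at h2
    exact h2

/-- The linear action of an element of `SO(n)` on `ℝⁿ`. -/
def soAct {n : ℕ} (g : SO n) : En n →ₗ[ℝ] En n :=
  Matrix.toEuclideanLin ((g : Matrix.unitaryGroup (Fin n) ℝ) : Matrix (Fin n) (Fin n) ℝ)

variable {V : Type*} [NormedAddCommGroup V] [NormedSpace ℝ V]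

/-- `μ` is a valuation: additivity on unions of convex bodies whose union is again convex. -/
def IsValuation (μ : ConvexBody V → ℝ) : Prop :=
  ∀ K L M N : ConvexBody V,
    (M : Set V) = (K : Set V) ∪ (L : Set V) → (N : Set V) = (K : Set V) ∩ (L : Set V) →
      μ M + μ N = μ K + μ L

/-- `μ` is translation invariant. -/
def IsTranslationInvariant (μ : ConvexBody V → ℝ) : Prop :=
  ∀ (x : V) (K L : ConvexBody V), (L : Set V) = x +ᵥ (K : Set V) → μ L = μ K

/-- `μ` is homogeneous of degree `k`. -/
def IsHomogeneousVal (k : ℕ) (μ : ConvexBody V → ℝ) : Prop :=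
  ∀ (t : ℝ), 0 ≤ t → ∀ K L : ConvexBody V,
    (L : Set V) = t • (K : Set V) → μ L = t ^ k * μ K

/-- `μ` is an even valuation. -/
def IsEvenVal (μ : ConvexBody V → ℝ) : Prop :=
  ∀ K L : ConvexBody V, (L : Set V) = -(K : Set V) → μ L = μ K

/-- `μ` is invariant under the action of `SO(n)`. -/
def IsSOInvariant (n : ℕ) (μ : ConvexBody (En n) → ℝ) : Prop :=
  ∀ (g : SO n) (K L : ConvexBody (En n)),
    (L : Set (En n)) = (soAct g) '' (K : Set (En n)) → μ L = μ K

/-- `ω k`, the volume of the `k`-dimensional Euclidean unit ball. -/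
def ballVol (k : ℕ) : ℝ := (volume (Metric.closedBall (0 : EuclideanSpace ℝ (Fin k)) 1)).toReal

/-- The flag coefficient `[m, j] = C(m,j) ω_m / (ω_j ω_{m-j})`. -/
def flagCoeff (m j : ℕ) : ℝ := (m.choose j : ℝ) * ballVol m / (ballVol j * ballVol (m - j))

/-- A family `μ_0, …, μ_n` satisfies the Steiner formula
`vol_n(K + tB) = ∑_{k=0}^n μ_{n-k}(K) ω_k t^k`;
this characterizes the intrinsic volumes. -/
def SteinerFamily (n : ℕ) (μ : Fin (n+1) → ConvexBody (En n) → ℝ) : Prop :=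
  ∀ (K : ConvexBody (En n)) (t : ℝ), 0 ≤ t →
    (volume ((K : Set (En n)) + t • Metric.closedBall (0 : En n) 1)).toReal
      = ∑ k : Fin (n+1), μ k.rev K * ballVol (k : ℕ) * t ^ (k : ℕ)


/-! ### Compact convex sets and valuations as set functions -/

/-- compact convex sets (possibly empty) -/
structure CC {E : Type*} [NormedAddCommGroup E] [NormedSpace ℝ E] (K : Set E) : Prop where
  cpt : IsCompact K
  cvx : Convex ℝ K

/-- Hausdorff closeness -/
def Close {E : Type*} [NormedAddCommGroup E] (δ : ℝ) (K L : Set E) : Prop :=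
  (∀ x ∈ K, ∃ y ∈ L, dist x y ≤ δ) ∧ (∀ y ∈ L, ∃ x ∈ K, dist x y ≤ δ)

section basics
variable {E : Type*} [NormedAddCommGroup E] [NormedSpace ℝ E]
variable {F : Type*} [NormedAddCommGroup F] [NormedSpace ℝ F]

theorem CC.inter_closed {K : Set E} (hK : CC K) {C : Set E} (h1 : IsClosed C) (h2 : Convex ℝ C) :
    CC (K ∩ C) := ⟨hK.cpt.inter_right h1, hK.cvx.inter h2⟩

theorem CC.inter {K L : Set E} (hK : CC K) (hL : CC L) : CC (K ∩ L) :=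
  hK.inter_closed hL.cpt.isClosed hL.cvx

theorem CC.empty : CC (∅ : Set E) := ⟨isCompact_empty, convex_empty⟩

theorem CC.add {K L : Set E} (hK : CC K) (hL : CC L) : CC (K + L) :=
  ⟨hK.cpt.add hL.cpt, hK.cvx.add hL.cvx⟩

theorem CC.smul {K : Set E} (c : ℝ) (hK : CC K) : CC (c • K) :=
  ⟨hK.cpt.smul c, hK.cvx.smul c⟩

theorem CC.vadd {K : Set E} (x : E) (hK : CC K) : CC (x +ᵥ K) :=
  ⟨hK.cpt.vadd x, hK.cvx.vadd x⟩

theorem CC.image [FiniteDimensional ℝ E] {K : Set E} (hK : CC K) (f : E →ₗ[ℝ] F) : CC (f '' K) :=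
  ⟨hK.cpt.image f.continuous_of_finiteDimensional, hK.cvx.linear_image f⟩

theorem CC.singleton (x : E) : CC ({x} : Set E) := ⟨isCompact_singleton, convex_singleton x⟩

theorem CC.ball [FiniteDimensional ℝ E] (r : ℝ) : CC (closedBall (0 : E) r) := by
  have : ProperSpace E := FiniteDimensional.proper_real E
  exact ⟨isCompact_closedBall _ _, convex_closedBall _ _⟩

theorem Close.mono {δ δ' : ℝ} (h : δ ≤ δ') {K L : Set E} (hc : Close δ K L) : Close δ' K L := by
  refine ⟨fun x hx => ?_, fun y hy => ?_⟩
  · obtain ⟨y, hy, h'⟩ := hc.1 x hx; exact ⟨y, hy, h'.trans h⟩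
  · obtain ⟨x, hx, h'⟩ := hc.2 y hy; exact ⟨x, hx, h'.trans h⟩

theorem Close.symm {δ : ℝ} {K L : Set E} (hc : Close δ K L) : Close δ L K := by
  refine ⟨fun x hx => ?_, fun y hy => ?_⟩
  · obtain ⟨y, hy, h'⟩ := hc.2 x hx; exact ⟨y, hy, by rwa [dist_comm]⟩
  · obtain ⟨x, hx, h'⟩ := hc.1 y hy; exact ⟨x, hx, by rwa [dist_comm]⟩

theorem Close.refl {δ : ℝ} (hδ : 0 ≤ δ) (K : Set E) : Close δ K K :=
  ⟨fun x hx => ⟨x, hx, by simpa using hδ⟩, fun x hx => ⟨x, hx, by simpa using hδ⟩⟩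

theorem Close.add {δ ε : ℝ} {K L K' L' : Set E} (h : Close δ K K') (h' : Close ε L L') :
    Close (δ + ε) (K + L) (K' + L') := by
  constructor
  · rintro _ ⟨x, hx, y, hy, rfl⟩
    obtain ⟨x', hx', h1⟩ := h.1 x hx
    obtain ⟨y', hy', h2⟩ := h'.1 y hy
    exact ⟨x' + y', ⟨x', hx', y', hy', rfl⟩, (dist_add_add_le _ _ _ _).trans (add_le_add h1 h2)⟩
  · rintro _ ⟨x, hx, y, hy, rfl⟩
    obtain ⟨x', hx', h1⟩ := h.2 x hx
    obtain ⟨y', hy', h2⟩ := h'.2 y hy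
    exact ⟨x' + y', ⟨x', hx', y', hy', rfl⟩, (dist_add_add_le _ _ _ _).trans (add_le_add h1 h2)⟩

theorem Close.image {δ C : ℝ} {K L : Set E} (h : Close δ K L) (f : E → F) (hC : 0 ≤ C)
    (hf : ∀ x y, dist (f x) (f y) ≤ C * dist x y) : Close (C * δ) (f '' K) (f '' L) := by
  constructor
  · rintro _ ⟨x, hx, rfl⟩
    obtain ⟨y, hy, h1⟩ := h.1 x hx
    exact ⟨f y, ⟨y, hy, rfl⟩, (hf _ _).trans (mul_le_mul_of_nonneg_left h1 hC)⟩
  · rintro _ ⟨x, hx, rfl⟩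
    obtain ⟨y, hy, h1⟩ := h.2 x hx
    exact ⟨f y, ⟨y, hy, rfl⟩, (hf _ _).trans (mul_le_mul_of_nonneg_left h1 hC)⟩

theorem Close.smul {δ : ℝ} {K L : Set E} (h : Close δ K L) (c : ℝ) :
    Close (|c| * δ) (c • K) (c • L) := by
  have := h.image (fun x => c • x) (abs_nonneg c) (fun x y => by
    rw [dist_smul₀, Real.norm_eq_abs])
  simpa [Set.image_smul] using this

theorem Close.nonempty {δ : ℝ} {K L : Set E} (h : Close δ K L) (hK : K.Nonempty) : L.Nonempty := by
  obtain ⟨x, hx⟩ := hK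
  obtain ⟨y, hy, -⟩ := h.1 x hx
  exact ⟨y, hy⟩

/-- `(K ∩ L) + M = (K + M) ∩ (L + M)` if `K ∪ L` is convex -/
theorem inter_add_of_convex {K L M : Set E} (hK : CC K) (hL : CC L) (hU : Convex ℝ (K ∪ L))
    (hM : Convex ℝ M) : (K ∩ L) + M = (K + M) ∩ (L + M) := by
  apply Set.Subset.antisymm (Set.inter_add_subset)
  rintro x ⟨⟨k, hk, b, hb, rfl⟩, ⟨l, hl, b', hb', h⟩⟩
  have hseg : segment ℝ k l ⊆ K ∪ L := hU.segment_subset (Or.inl hk) (Or.inr hl)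
  have hpre : IsPreconnected (segment ℝ k l) := (convex_segment k l).isPreconnected
  have := isPreconnected_closed_iff.1 hpre K L hK.cpt.isClosed hL.cpt.isClosed hseg
    ⟨k, left_mem_segment ℝ k l, hk⟩ ⟨l, right_mem_segment ℝ k l, hl⟩
  obtain ⟨p, ⟨s, t, hs, ht, hst, rfl⟩, hpK, hpL⟩ := this
  refine ⟨_, ⟨hpK, hpL⟩, s • b + t • b', hM hb hb' hs ht hst, ?_⟩
  have h2 : l + b' = k + b := h
  have h' : b' = k + b - l := by rw [← h2]; simp
  simp only
  have : s • k + t • l + (s • b + t • b') = (s + t) • (k + b) := by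
    rw [h', smul_sub, smul_add, add_smul, smul_add]
    simp only [smul_add]
    abel
  rw [this, hst, one_smul]

theorem inter_nonempty_of_convex {K L : Set E} (hK : CC K) (hL : CC L) (hU : Convex ℝ (K ∪ L))
    (h1 : K.Nonempty) (h2 : L.Nonempty) : (K ∩ L).Nonempty := by
  have hpre := hU.isPreconnected
  have := isPreconnected_closed_iff.1 hpre K L hK.cpt.isClosed hL.cpt.isClosed subset_rfl
    (by obtain ⟨x, hx⟩ := h1; exact ⟨x, Or.inl hx, hx⟩)
    (by obtain ⟨x, hx⟩ := h2; exact ⟨x, Or.inr hx, hx⟩)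
  obtain ⟨x, -, hx⟩ := this
  exact ⟨x, hx⟩

/-- continuous translation invariant valuation, as a set function -/
structure IsVal (μ : Set E → ℝ) : Prop where
  empty : μ ∅ = 0
  union : ∀ K L, CC K → CC L → Convex ℝ (K ∪ L) → (K ∩ L).Nonempty →
    μ (K ∪ L) + μ (K ∩ L) = μ K + μ L
  cont : ∀ K, CC K → K.Nonempty → ∀ ε > 0, ∃ δ > 0, ∀ L, CC L → L.Nonempty → Close δ K L →
    |μ L - μ K| < ε
  trans : ∀ (x : E) K, CC K → μ (x +ᵥ K) = μ K

/-- vanishing on bodies contained in hyperplanes -/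
def IsSimple (μ : Set E → ℝ) : Prop :=
  ∀ (f : E →ₗ[ℝ] ℝ) (c : ℝ), f ≠ 0 → ∀ K, CC K → (∀ x ∈ K, f x = c) → μ K = 0

theorem CC.le [FiniteDimensional ℝ E] {K : Set E} (hK : CC K) (f : E →ₗ[ℝ] ℝ) (c : ℝ) :
    CC (K ∩ {x | f x ≤ c}) :=
  hK.inter_closed (isClosed_le f.continuous_of_finiteDimensional continuous_const)
    (convex_halfSpace_le f.isLinear c)

theorem CC.ge [FiniteDimensional ℝ E] {K : Set E} (hK : CC K) (f : E →ₗ[ℝ] ℝ) (c : ℝ) :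
    CC (K ∩ {x | c ≤ f x}) :=
  hK.inter_closed (isClosed_le continuous_const f.continuous_of_finiteDimensional)
    (convex_halfSpace_ge f.isLinear c)

/-- cutting by a hyperplane -/
theorem IsVal.cut [FiniteDimensional ℝ E] {μ : Set E → ℝ} (hμ : IsVal μ) (hs : IsSimple μ)
    (f : E →ₗ[ℝ] ℝ) (hf : f ≠ 0) (c : ℝ) {K : Set E} (hK : CC K) :
    μ K = μ (K ∩ {x | f x ≤ c}) + μ (K ∩ {x | c ≤ f x}) := by
  have hU : K ∩ {x | f x ≤ c} ∪ K ∩ {x | c ≤ f x} = K := by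
    ext x; simp only [mem_union, mem_inter_iff, mem_ofPred_eq]
    have := le_total (f x) c
    tauto
  have hcU : Convex ℝ (K ∩ {x | f x ≤ c} ∪ K ∩ {x | c ≤ f x}) := by rw [hU]; exact hK.cvx
  by_cases h1 : (K ∩ {x | f x ≤ c}).Nonempty
  · by_cases h2 : (K ∩ {x | c ≤ f x}).Nonempty
    · have := hμ.union _ _ (hK.le f c) (hK.ge f c) hcU
        (inter_nonempty_of_convex (hK.le f c) (hK.ge f c) hcU h1 h2)
      rw [hU] at this
      rw [← this, hs f c hf _ ((hK.le f c).inter (hK.ge f c)) ?_, add_zero]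
      rintro x ⟨⟨_, h⟩, ⟨_, h'⟩⟩
      exact le_antisymm h h'
    · rw [not_nonempty_iff_eq_empty] at h2
      rw [h2, union_empty] at hU
      rw [hU, h2, hμ.empty, add_zero]
  · rw [not_nonempty_iff_eq_empty] at h1
    rw [h1, empty_union] at hU
    rw [hU, h1, hμ.empty, zero_add]

theorem IsVal.sub {μ ν : Set E → ℝ} (hμ : IsVal μ) (hν : IsVal ν) : IsVal (fun K => μ K - ν K) where
  empty := by simp [hμ.empty, hν.empty]
  union K L hK hL hU hI := by
    have h1 := hμ.union K L hK hL hU hI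
    have h2 := hν.union K L hK hL hU hI
    linarith
  cont K hK hn ε hε := by
    obtain ⟨δ1, h1, h1'⟩ := hμ.cont K hK hn (ε / 2) (by positivity)
    obtain ⟨δ2, h2, h2'⟩ := hν.cont K hK hn (ε / 2) (by positivity)
    refine ⟨min δ1 δ2, lt_min h1 h2, fun L hL hLn hc => ?_⟩
    have a := h1' L hL hLn (hc.mono (min_le_left _ _))
    have b := h2' L hL hLn (hc.mono (min_le_right _ _))
    rw [abs_lt] at *
    constructor <;> linarith
  trans x K hK := by simp only [hμ.trans x K hK, hν.trans x K hK]

theorem IsVal.const_mul {μ : Set E → ℝ} (a : ℝ) (hμ : IsVal μ) : IsVal (fun K => a * μ K) where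
  empty := by simp [hμ.empty]
  union K L hK hL hU hI := by
    have h1 := hμ.union K L hK hL hU hI
    simp only [← mul_add, h1]
  cont K hK hn ε hε := by
    obtain ⟨δ1, h1, h1'⟩ := hμ.cont K hK hn (ε / (|a| + 1)) (by positivity)
    refine ⟨δ1, h1, fun L hL hLn hc => ?_⟩
    have := h1' L hL hLn hc
    rw [← mul_sub, abs_mul]
    have h3 : |a| * |μ L - μ K| ≤ (|a| + 1) * |μ L - μ K| := by
      apply mul_le_mul_of_nonneg_right _ (abs_nonneg _); linarith
    rw [lt_div_iff₀ (by positivity)] at this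
    linarith
  trans x K hK := by simp only [hμ.trans x K hK]

theorem IsVal.add {μ ν : Set E → ℝ} (hμ : IsVal μ) (hν : IsVal ν) : IsVal (fun K => μ K + ν K) := by
  have := hμ.sub (hν.const_mul (-1))
  simpa using this

theorem IsVal.zero : IsVal (fun _ : Set E => (0 : ℝ)) where
  empty := rfl
  union := by intros; simp
  cont K hK hn ε hε := ⟨1, one_pos, by intros; simpa⟩
  trans := by intros; rfl

theorem IsVal.sum {ι : Type*} (s : Finset ι) {μ : ι → Set E → ℝ} (h : ∀ i ∈ s, IsVal (μ i)) :
    IsVal (fun K => ∑ i ∈ s, μ i K) := by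
  classical
  induction s using Finset.induction_on with
  | empty => simpa using IsVal.zero
  | insert a s ha ih =>
    simp only [Finset.sum_insert ha]
    exact (h a (Finset.mem_insert_self a s)).add
      (ih fun i hi => h i (Finset.mem_insert_of_mem hi))

/-- pulling back along `K ↦ c • K` -/
theorem IsVal.comp_smul {μ : Set E → ℝ} (hμ : IsVal μ) {c : ℝ} (hc : c ≠ 0) :
    IsVal (fun K => μ (c • K)) where
  empty := by simp [hμ.empty]
  union K L hK hL hU hI := by
    have := hμ.union (c • K) (c • L) (hK.smul c) (hL.smul c)
      (by rw [← Set.smul_set_union]; exact hU.smul c)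
      (by rw [← Set.smul_set_inter₀ hc]; exact hI.smul_set)
    rwa [← Set.smul_set_union, ← Set.smul_set_inter₀ hc] at this
  cont K hK hn ε hε := by
    obtain ⟨δ, h1, h1'⟩ := hμ.cont (c • K) (hK.smul c) hn.smul_set ε hε
    refine ⟨δ / |c|, by positivity, fun L hL hLn hcl => h1' _ (hL.smul c) hLn.smul_set ?_⟩
    have := hcl.smul c
    rwa [mul_div_cancel₀ _ (abs_ne_zero.2 hc)] at this
  trans x K hK := by
    have : c • (x +ᵥ K) = (c • x) +ᵥ (c • K) := by
      ext y
      simp only [Set.mem_smul_set, Set.mem_vadd_set, vadd_eq_add]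
      constructor
      · rintro ⟨_, ⟨k, hk, rfl⟩, rfl⟩
        exact ⟨_, ⟨k, hk, rfl⟩, by rw [smul_add]⟩
      · rintro ⟨_, ⟨k, hk, rfl⟩, rfl⟩
        exact ⟨_, ⟨k, hk, rfl⟩, by rw [smul_add]⟩
    simp only [this, hμ.trans _ _ (hK.smul c)]

/-- pulling back along `K ↦ K + M` -/
theorem IsVal.comp_add {μ : Set E → ℝ} (hμ : IsVal μ) {M : Set E} (hM : CC M) (hMn : M.Nonempty) :
    IsVal (fun K => μ (K + M)) where
  empty := by simp [hμ.empty]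
  union K L hK hL hU hI := by
    have h := inter_add_of_convex hK hL hU hM.cvx
    have := hμ.union (K + M) (L + M) (hK.add hM) (hL.add hM)
      (by rw [← Set.union_add]; exact hU.add hM.cvx)
      (by rw [← h]; exact hI.add hMn)
    rwa [← Set.union_add, ← h] at this
  cont K hK hn ε hε := by
    obtain ⟨δ, h1, h1'⟩ := hμ.cont (K + M) (hK.add hM) (hn.add hMn) ε hε
    refine ⟨δ, h1, fun L hL hLn hcl => h1' _ (hL.add hM) (hLn.add hMn) ?_⟩
    have := hcl.add (Close.refl le_rfl M)
    rwa [add_zero] at this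
  trans x K hK := by
    have : (x +ᵥ K) + M = x +ᵥ (K + M) := by
      rw [vadd_add_assoc]
    simp only [this, hμ.trans _ _ (hK.add hM)]

end basics

set_option linter.unusedSectionVars false

/-! ### Fiber reduction -/
section fiber
variable {E : Type*} [NormedAddCommGroup E] [NormedSpace ℝ E] [FiniteDimensional ℝ E]
variable {F : Type*} [NormedAddCommGroup F] [NormedSpace ℝ F] [FiniteDimensional ℝ F]

/-- value of an affine function -/
def ev (a : (F →ₗ[ℝ] ℝ) × ℝ) (x : F) : ℝ := a.1 x + a.2

/-- region over `C` under an affine function -/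
def wedge (e : E ≃ₗ[ℝ] F × ℝ) (C : Set F) (ℓ : F →ₗ[ℝ] ℝ) (c : ℝ) : Set E :=
  {z | (e z).1 ∈ C ∧ 0 ≤ (e z).2 ∧ (e z).2 ≤ ℓ (e z).1 + c}

def Reg (e : E ≃ₗ[ℝ] F × ℝ) (C : Set F) (a b : (F →ₗ[ℝ] ℝ) × ℝ)
    (fs gs : List ((F →ₗ[ℝ] ℝ) × ℝ)) (hs : List ((E →ₗ[ℝ] ℝ) × ℝ)) : Set E :=
  {z | (e z).1 ∈ C ∧ ev a (e z).1 ≤ (e z).2 ∧ (e z).2 ≤ ev b (e z).1 ∧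
    (∀ f ∈ fs, ev f (e z).1 ≤ (e z).2) ∧ (∀ g ∈ gs, (e z).2 ≤ ev g (e z).1) ∧
    ∀ h ∈ hs, h.1 z ≤ h.2}

theorem ev_continuous (a : (F →ₗ[ℝ] ℝ) × ℝ) : Continuous (ev a) :=
  a.1.continuous_of_finiteDimensional.add continuous_const

theorem e_continuous (e : E ≃ₗ[ℝ] F × ℝ) : Continuous e :=
  LinearMap.continuous_of_finiteDimensional (e : E →ₗ[ℝ] F × ℝ)

theorem p_continuous (e : E ≃ₗ[ℝ] F × ℝ) : Continuous fun z => (e z).1 :=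
  continuous_fst.comp (e_continuous e)

theorem q_continuous (e : E ≃ₗ[ℝ] F × ℝ) : Continuous fun z => (e z).2 :=
  continuous_snd.comp (e_continuous e)

theorem slab_compact (e : E ≃ₗ[ℝ] F × ℝ) {C : Set F} (hC : IsCompact C) (m M : ℝ) :
    IsCompact {z | (e z).1 ∈ C ∧ m ≤ (e z).2 ∧ (e z).2 ≤ M} := by
  have h1 : IsCompact (C ×ˢ Icc m M) := hC.prod isCompact_Icc
  have h2 := h1.image (LinearMap.continuous_of_finiteDimensional (e.symm : F × ℝ →ₗ[ℝ] E))
  convert h2 using 1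
  ext z
  simp only [mem_ofPred_eq, mem_image, mem_prod, mem_Icc]
  constructor
  · intro h
    exact ⟨e z, h, by simp⟩
  · rintro ⟨w, h, rfl⟩
    simpa using h

theorem exists_ev_bound {C : Set F} (hC : IsCompact C) (a : (F →ₗ[ℝ] ℝ) × ℝ) :
    ∃ M, ∀ x ∈ C, |ev a x| ≤ M := by
  obtain ⟨M, hM⟩ := (hC.image (ev_continuous a)).isBounded.exists_norm_le
  exact ⟨M, fun x hx => hM _ ⟨x, hx, rfl⟩⟩

theorem ev_convex (a : (F →ₗ[ℝ] ℝ) × ℝ) (x y : F) {s t : ℝ} (hst : s + t = 1) :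
    ev a (s • x + t • y) = s * ev a x + t * ev a y := by
  simp only [ev, map_add, map_smul, smul_eq_mul]
  have : a.2 = (s + t) * a.2 := by rw [hst, one_mul]
  rw [this]; ring_nf; rw [show t = 1 - s by linarith]; ring

theorem Reg.cc (e : E ≃ₗ[ℝ] F × ℝ) {C : Set F} (hC : CC C) (a b : (F →ₗ[ℝ] ℝ) × ℝ)
    (fs gs : List ((F →ₗ[ℝ] ℝ) × ℝ)) (hs : List ((E →ₗ[ℝ] ℝ) × ℝ)) :
    CC (Reg e C a b fs gs hs) := by
  obtain ⟨M1, h1⟩ := exists_ev_bound hC.cpt a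
  obtain ⟨M2, h2⟩ := exists_ev_bound hC.cpt b
  constructor
  · refine (slab_compact e hC.cpt (-M1) M2).of_isClosed_subset ?_ ?_
    · have pc := p_continuous e
      have qc := q_continuous e
      have hC' := hC.cpt.isClosed.preimage pc
      have e1 : IsClosed {z | ev a (e z).1 ≤ (e z).2} :=
        isClosed_le ((ev_continuous a).comp pc) qc
      have e2 : IsClosed {z | (e z).2 ≤ ev b (e z).1} :=
        isClosed_le qc ((ev_continuous b).comp pc)
      have e3 : IsClosed {z | ∀ f ∈ fs, ev f (e z).1 ≤ (e z).2} := by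
        simp only [ofPred_forall]
        exact isClosed_biInter fun f _ => isClosed_le ((ev_continuous f).comp pc) qc
      have e4 : IsClosed {z | ∀ f ∈ gs, (e z).2 ≤ ev f (e z).1} := by
        simp only [ofPred_forall]
        exact isClosed_biInter fun f _ => isClosed_le qc ((ev_continuous f).comp pc)
      have e5 : IsClosed {z | ∀ h ∈ hs, h.1 z ≤ h.2} := by
        simp only [ofPred_forall]
        exact isClosed_biInter fun f _ =>
          isClosed_le f.1.continuous_of_finiteDimensional continuous_const
      exact hC'.inter (e1.inter (e2.inter (e3.inter (e4.inter e5))))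
    · rintro z ⟨hz, h3, h4, -⟩
      exact ⟨hz, (abs_le.1 (h1 _ hz)).1.trans h3, h4.trans (abs_le.1 (h2 _ hz)).2⟩
  · rintro x ⟨x1, x2, x3, x4, x5, x6⟩ y ⟨y1, y2, y3, y4, y5, y6⟩ s t hs ht hst
    have e1 : (e (s • x + t • y)).1 = s • (e x).1 + t • (e y).1 := by simp
    have e2 : (e (s • x + t • y)).2 = s * (e x).2 + t * (e y).2 := by simp
    refine ⟨?_, ?_, ?_, fun f hf => ?_, fun f hf => ?_, fun f hf => ?_⟩
    · rw [e1]; exact hC.cvx x1 y1 hs ht hst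
    · rw [e1, e2, ev_convex _ _ _ hst]; gcongr
    · rw [e1, e2, ev_convex _ _ _ hst]; gcongr
    · rw [e1, e2, ev_convex _ _ _ hst]; have := x4 f hf; have := y4 f hf; gcongr
    · rw [e1, e2, ev_convex _ _ _ hst]; have := x5 f hf; have := y5 f hf; gcongr
    · rw [map_add, map_smul, map_smul, smul_eq_mul, smul_eq_mul]
      have h1 := mul_le_mul_of_nonneg_left (x6 f hf) hs
      have h2 := mul_le_mul_of_nonneg_left (y6 f hf) ht
      have : f.2 = s * f.2 + t * f.2 := by rw [← add_mul, hst, one_mul]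
      linarith

theorem wedge_eq_reg (e : E ≃ₗ[ℝ] F × ℝ) (C : Set F) (ℓ : F →ₗ[ℝ] ℝ) (c : ℝ) :
    wedge e C ℓ c = Reg e C (0, 0) (ℓ, c) [] [] [] := by
  ext z; simp [wedge, Reg, ev]

theorem wedge.cc (e : E ≃ₗ[ℝ] F × ℝ) {C : Set F} (hC : CC C) (ℓ : F →ₗ[ℝ] ℝ) (c : ℝ) :
    CC (wedge e C ℓ c) := by
  rw [wedge_eq_reg]; exact Reg.cc e hC _ _ _ _ _

/-- functional `f ∘ p + b q` -/
def fb (e : E ≃ₗ[ℝ] F × ℝ) (f : F →ₗ[ℝ] ℝ) (b : ℝ) : E →ₗ[ℝ] ℝ :=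
  (f.comp (LinearMap.fst ℝ F ℝ) + b • LinearMap.snd ℝ F ℝ).comp (e : E →ₗ[ℝ] F × ℝ)

@[simp] theorem fb_apply (e : E ≃ₗ[ℝ] F × ℝ) (f : F →ₗ[ℝ] ℝ) (b : ℝ) (z : E) :
    fb e f b z = f (e z).1 + b * (e z).2 := by
  simp [fb]

theorem fb_ne_left (e : E ≃ₗ[ℝ] F × ℝ) {f : F →ₗ[ℝ] ℝ} (hf : f ≠ 0) (b : ℝ) : fb e f b ≠ 0 := by
  intro h
  apply hf
  ext x
  have := congrArg (fun g => g (e.symm (x, 0))) h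
  simpa using this

theorem fb_ne_right (e : E ≃ₗ[ℝ] F × ℝ) (f : F →ₗ[ℝ] ℝ) {b : ℝ} (hb : b ≠ 0) : fb e f b ≠ 0 := by
  intro h
  apply hb
  have := congrArg (fun g => g (e.symm (0, 1))) h
  simpa using this

theorem exists_fb (e : E ≃ₗ[ℝ] F × ℝ) (h : E →ₗ[ℝ] ℝ) : ∃ f b, h = fb e f b := by
  refine ⟨h.comp ((e.symm : F × ℝ →ₗ[ℝ] E).comp (LinearMap.inl ℝ F ℝ)), h (e.symm (0, 1)), ?_⟩
  ext z
  simp only [fb_apply, LinearMap.comp_apply, LinearMap.inl_apply, LinearEquiv.coe_coe]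
  have : z = e.symm ((e z).1, 0) + (e z).2 • e.symm (0, 1) := by
    rw [← map_smul, ← map_add]; simp
  conv_lhs => rw [this]
  rw [map_add, map_smul, smul_eq_mul, mul_comm]

variable {μ : Set E → ℝ}

theorem F1 (e : E ≃ₗ[ℝ] F × ℝ) (hμ : IsVal μ) (hs : IsSimple μ)
    (hw : ∀ C ℓ c, CC C → (∀ x ∈ C, 0 ≤ ℓ x + c) → μ (wedge e C ℓ c) = 0)
    {C : Set F} (hC : CC C) (a b : (F →ₗ[ℝ] ℝ) × ℝ) : μ (Reg e C a b [] [] []) = 0 := by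
  set C' := C ∩ {x | (a.1 - b.1) x ≤ b.2 - a.2} with hC'
  have hCC : CC C' := hC.le _ _
  have hab : ∀ x, x ∈ C' ↔ x ∈ C ∧ ev a x ≤ ev b x := by
    intro x
    simp only [hC', mem_inter_iff, mem_ofPred_eq, ev, LinearMap.sub_apply]
    constructor <;> rintro ⟨h1, h2⟩ <;> exact ⟨h1, by linarith⟩
  obtain ⟨M, hM⟩ := exists_ev_bound hCC.cpt a
  have h1 : ∀ x ∈ C', 0 ≤ a.1 x + (a.2 + M) := by
    intro x hx
    have := (abs_le.1 (hM x hx)).1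
    simp only [ev] at this; linarith
  have h2 : ∀ x ∈ C', 0 ≤ b.1 x + (b.2 + M) := by
    intro x hx
    have h3 := h1 x hx
    have := ((hab x).1 hx).2
    simp only [ev] at this; linarith
  have hcut := hμ.cut hs (fb e (-a.1) 1) (fb_ne_right e _ one_ne_zero) (a.2 + M)
    (wedge.cc e hCC b.1 (b.2 + M))
  have e1 : wedge e C' b.1 (b.2 + M) ∩ {x | fb e (-a.1) 1 x ≤ a.2 + M}
      = wedge e C' a.1 (a.2 + M) := by
    ext z
    simp only [wedge, mem_inter_iff, mem_ofPred_eq, fb_apply, LinearMap.neg_apply]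
    constructor
    · rintro ⟨⟨h3, h4, h5⟩, h6⟩
      exact ⟨h3, h4, by linarith⟩
    · rintro ⟨h3, h4, h5⟩
      have := ((hab _).1 h3).2
      simp only [ev] at this
      exact ⟨⟨h3, h4, by linarith⟩, by linarith⟩
  have e2 : wedge e C' b.1 (b.2 + M) ∩ {x | a.2 + M ≤ fb e (-a.1) 1 x}
      = e.symm (0, M) +ᵥ Reg e C a b [] [] [] := by
    ext z
    rw [mem_vadd_set_iff_neg_vadd_mem]
    simp only [wedge, Reg, mem_inter_iff, mem_ofPred_eq, fb_apply, LinearMap.neg_apply,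
      vadd_eq_add, map_add, map_neg, LinearEquiv.apply_symm_apply, Prod.fst_add, Prod.snd_add,
      Prod.fst_neg, Prod.snd_neg, neg_zero, zero_add, ev, List.not_mem_nil, false_imp_iff,
      implies_true, and_true]
    constructor
    · rintro ⟨⟨h3, h4, h5⟩, h6⟩
      exact ⟨((hab _).1 h3).1, by linarith, by linarith⟩
    · rintro ⟨h3, h4, h5⟩
      have h7 : (e z).1 ∈ C' := (hab _).2 ⟨h3, by simp only [ev]; linarith⟩
      have := h1 _ h7
      exact ⟨⟨h7, by linarith, by linarith⟩, by linarith⟩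
  rw [e1, e2, hμ.trans _ _ (Reg.cc e hC _ _ _ _ _), hw _ _ _ hCC h1, hw _ _ _ hCC h2] at hcut
  linarith

theorem F2 (e : E ≃ₗ[ℝ] F × ℝ) (hμ : IsVal μ) (hs : IsSimple μ)
    (hw : ∀ C ℓ c, CC C → (∀ x ∈ C, 0 ≤ ℓ x + c) → μ (wedge e C ℓ c) = 0)
    (fs : List ((F →ₗ[ℝ] ℝ) × ℝ)) : ∀ {C : Set F} (_ : CC C) (a b : (F →ₗ[ℝ] ℝ) × ℝ),
    μ (Reg e C a b fs [] []) = 0 := by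
  induction fs with
  | nil => intro C hC a b; exact F1 e hμ hs hw hC a b
  | cons f fs ih =>
    intro C hC a b
    by_cases hl : a.1 - f.1 = 0
    · have hl' : a.1 = f.1 := sub_eq_zero.1 hl
      rcases le_total a.2 f.2 with h | h
      · have : Reg e C a b (f :: fs) [] [] = Reg e C f b fs [] [] := by
          ext z
          simp only [Reg, mem_ofPred_eq, List.forall_mem_cons, ev, hl']
          constructor
          · rintro ⟨h1, h2, h3, ⟨h4, h5⟩, h6⟩; exact ⟨h1, h4, h3, h5, h6⟩
          · rintro ⟨h1, h2, h3, h4, h6⟩; exact ⟨h1, by linarith, h3, ⟨h2, h4⟩, h6⟩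
        rw [this]; exact ih hC _ _
      · have : Reg e C a b (f :: fs) [] [] = Reg e C a b fs [] [] := by
          ext z
          simp only [Reg, mem_ofPred_eq, List.forall_mem_cons, ev, hl']
          constructor
          · rintro ⟨h1, h2, h3, ⟨h4, h5⟩, h6⟩; exact ⟨h1, h2, h3, h5, h6⟩
          · rintro ⟨h1, h2, h3, h4, h6⟩; exact ⟨h1, h2, h3, ⟨by linarith, h4⟩, h6⟩
        rw [this]; exact ih hC _ _
    · rw [hμ.cut hs (fb e (a.1 - f.1) 0) (fb_ne_left e hl 0) (f.2 - a.2) (Reg.cc e hC _ _ _ _ _)]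
      have e1 : Reg e C a b (f :: fs) [] [] ∩ {x | fb e (a.1 - f.1) 0 x ≤ f.2 - a.2}
          = Reg e (C ∩ {x | (a.1 - f.1) x ≤ f.2 - a.2}) f b fs [] [] := by
        ext z
        simp only [Reg, mem_ofPred_eq, List.forall_mem_cons, ev, mem_inter_iff, fb_apply,
          LinearMap.sub_apply, zero_mul, add_zero]
        constructor
        · rintro ⟨⟨h1, h2, h3, ⟨h4, h5⟩, h6⟩, h7⟩; exact ⟨⟨h1, h7⟩, h4, h3, h5, h6⟩
        · rintro ⟨⟨h1, h7⟩, h2, h3, h4, h6⟩; exact ⟨⟨h1, by linarith, h3, ⟨h2, h4⟩, h6⟩, h7⟩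
      have e2 : Reg e C a b (f :: fs) [] [] ∩ {x | f.2 - a.2 ≤ fb e (a.1 - f.1) 0 x}
          = Reg e (C ∩ {x | f.2 - a.2 ≤ (a.1 - f.1) x}) a b fs [] [] := by
        ext z
        simp only [Reg, mem_ofPred_eq, List.forall_mem_cons, ev, mem_inter_iff, fb_apply,
          LinearMap.sub_apply, zero_mul, add_zero]
        constructor
        · rintro ⟨⟨h1, h2, h3, ⟨h4, h5⟩, h6⟩, h7⟩; exact ⟨⟨h1, h7⟩, h2, h3, h5, h6⟩
        · rintro ⟨⟨h1, h7⟩, h2, h3, h4, h6⟩; exact ⟨⟨h1, h2, h3, ⟨by linarith, h4⟩, h6⟩, h7⟩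
      rw [e1, e2, ih (hC.le _ _), ih (hC.ge _ _), add_zero]

theorem F3 (e : E ≃ₗ[ℝ] F × ℝ) (hμ : IsVal μ) (hs : IsSimple μ)
    (hw : ∀ C ℓ c, CC C → (∀ x ∈ C, 0 ≤ ℓ x + c) → μ (wedge e C ℓ c) = 0)
    (fs gs : List ((F →ₗ[ℝ] ℝ) × ℝ)) : ∀ {C : Set F} (_ : CC C) (a b : (F →ₗ[ℝ] ℝ) × ℝ),
    μ (Reg e C a b fs gs []) = 0 := by
  induction gs with
  | nil => intro C hC a b; exact F2 e hμ hs hw fs hC a b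
  | cons f gs ih =>
    intro C hC a b
    by_cases hl : b.1 - f.1 = 0
    · have hl' : b.1 = f.1 := sub_eq_zero.1 hl
      rcases le_total f.2 b.2 with h | h
      · have : Reg e C a b fs (f :: gs) [] = Reg e C a f fs gs [] := by
          ext z
          simp only [Reg, mem_ofPred_eq, List.forall_mem_cons, ev, hl']
          constructor
          · rintro ⟨h1, h2, h3, h4, ⟨h5, h6⟩, h7⟩; exact ⟨h1, h2, h5, h4, h6, h7⟩
          · rintro ⟨h1, h2, h3, h4, h6, h7⟩; exact ⟨h1, h2, by linarith, h4, ⟨h3, h6⟩, h7⟩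
        rw [this]; exact ih hC _ _
      · have : Reg e C a b fs (f :: gs) [] = Reg e C a b fs gs [] := by
          ext z
          simp only [Reg, mem_ofPred_eq, List.forall_mem_cons, ev, hl']
          constructor
          · rintro ⟨h1, h2, h3, h4, ⟨h5, h6⟩, h7⟩; exact ⟨h1, h2, h3, h4, h6, h7⟩
          · rintro ⟨h1, h2, h3, h4, h6, h7⟩; exact ⟨h1, h2, h3, h4, ⟨by linarith, h6⟩, h7⟩
        rw [this]; exact ih hC _ _
    · rw [hμ.cut hs (fb e (b.1 - f.1) 0) (fb_ne_left e hl 0) (f.2 - b.2) (Reg.cc e hC _ _ _ _ _)]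
      have e1 : Reg e C a b fs (f :: gs) [] ∩ {x | fb e (b.1 - f.1) 0 x ≤ f.2 - b.2}
          = Reg e (C ∩ {x | (b.1 - f.1) x ≤ f.2 - b.2}) a b fs gs [] := by
        ext z
        simp only [Reg, mem_ofPred_eq, List.forall_mem_cons, ev, mem_inter_iff, fb_apply,
          LinearMap.sub_apply, zero_mul, add_zero]
        constructor
        · rintro ⟨⟨h1, h2, h3, h4, ⟨h5, h6⟩, h7⟩, h8⟩; exact ⟨⟨h1, h8⟩, h2, h3, h4, h6, h7⟩
        · rintro ⟨⟨h1, h8⟩, h2, h3, h4, h6, h7⟩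
          exact ⟨⟨h1, h2, h3, h4, ⟨by linarith, h6⟩, h7⟩, h8⟩
      have e2 : Reg e C a b fs (f :: gs) [] ∩ {x | f.2 - b.2 ≤ fb e (b.1 - f.1) 0 x}
          = Reg e (C ∩ {x | f.2 - b.2 ≤ (b.1 - f.1) x}) a f fs gs [] := by
        ext z
        simp only [Reg, mem_ofPred_eq, List.forall_mem_cons, ev, mem_inter_iff, fb_apply,
          LinearMap.sub_apply, zero_mul, add_zero]
        constructor
        · rintro ⟨⟨h1, h2, h3, h4, ⟨h5, h6⟩, h7⟩, h8⟩; exact ⟨⟨h1, h8⟩, h2, h5, h4, h6, h7⟩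
        · rintro ⟨⟨h1, h8⟩, h2, h3, h4, h6, h7⟩
          exact ⟨⟨h1, h2, by linarith, h4, ⟨h3, h6⟩, h7⟩, h8⟩
      rw [e1, e2, ih (hC.le _ _), ih (hC.ge _ _), add_zero]

theorem F4 (e : E ≃ₗ[ℝ] F × ℝ) (hμ : IsVal μ) (hs : IsSimple μ)
    (hw : ∀ C ℓ c, CC C → (∀ x ∈ C, 0 ≤ ℓ x + c) → μ (wedge e C ℓ c) = 0)
    (hl : List ((E →ₗ[ℝ] ℝ) × ℝ)) : ∀ (fs gs : List ((F →ₗ[ℝ] ℝ) × ℝ)) {C : Set F}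
    (_ : CC C) (a b : (F →ₗ[ℝ] ℝ) × ℝ), μ (Reg e C a b fs gs hl) = 0 := by
  induction hl with
  | nil => intro fs gs C hC a b; exact F3 e hμ hs hw fs gs hC a b
  | cons h hl ih =>
    intro fs gs C hC a b
    obtain ⟨f, t, hft⟩ := exists_fb e h.1
    rcases lt_trichotomy t 0 with ht | ht | ht
    · have : Reg e C a b fs gs (h :: hl) =
          Reg e C a b ((-(t⁻¹ • f), t⁻¹ * h.2) :: fs) gs hl := by
        ext z
        simp only [Reg, mem_ofPred_eq, List.forall_mem_cons, hft, fb_apply]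
        have : f (e z).1 + t * (e z).2 ≤ h.2 ↔ ev (-(t⁻¹ • f), t⁻¹ * h.2) (e z).1 ≤ (e z).2 := by
          simp only [ev, LinearMap.neg_apply, LinearMap.smul_apply, smul_eq_mul]
          rw [show -(t⁻¹ * f (e z).1) + t⁻¹ * h.2 = (h.2 - f (e z).1) / t by field_simp; ring,
            div_le_iff_of_neg ht]
          constructor <;> intro <;> linarith
        rw [this]; tauto
      rw [this]; exact ih _ _ hC _ _
    · have : Reg e C a b fs gs (h :: hl) = Reg e (C ∩ {x | f x ≤ h.2}) a b fs gs hl := by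
        ext z
        simp only [Reg, mem_ofPred_eq, List.forall_mem_cons, hft, fb_apply, ht, zero_mul, add_zero,
          mem_inter_iff]
        tauto
      rw [this]; exact ih _ _ (hC.le _ _) _ _
    · have : Reg e C a b fs gs (h :: hl) =
          Reg e C a b fs ((-(t⁻¹ • f), t⁻¹ * h.2) :: gs) hl := by
        ext z
        simp only [Reg, mem_ofPred_eq, List.forall_mem_cons, hft, fb_apply]
        have : f (e z).1 + t * (e z).2 ≤ h.2 ↔ (e z).2 ≤ ev (-(t⁻¹ • f), t⁻¹ * h.2) (e z).1 := by
          simp only [ev, LinearMap.neg_apply, LinearMap.smul_apply, smul_eq_mul]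
          rw [show -(t⁻¹ * f (e z).1) + t⁻¹ * h.2 = (h.2 - f (e z).1) / t by field_simp; ring,
            le_div_iff₀ ht]
          constructor <;> intro <;> linarith
        rw [this]; tauto
      rw [this]; exact ih _ _ hC _ _

/-- Fiber reduction -/
theorem fiber_reduction (e : E ≃ₗ[ℝ] F × ℝ) (hμ : IsVal μ) (hs : IsSimple μ)
    (hw : ∀ C ℓ c, CC C → (∀ x ∈ C, 0 ≤ ℓ x + c) → μ (wedge e C ℓ c) = 0)
    (K : Set E) (hK : CC K) : μ K = 0 := by
  rcases K.eq_empty_or_nonempty with rfl | hn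
  · exact hμ.empty
  by_contra hne
  obtain ⟨δ, hδ, h⟩ := hμ.cont K hK hn |μ K| (abs_pos.2 hne)
  obtain ⟨R, hR⟩ := (hK.cpt.image (e_continuous e)).isBounded.exists_norm_le
  have hball : CC (closedBall (0 : F) R) := CC.ball R
  set B := {z : E | (e z).1 ∈ closedBall (0 : F) R ∧ -R ≤ (e z).2 ∧ (e z).2 ≤ R} with hB
  have hBc : IsCompact B := slab_compact e hball.cpt _ _
  have hKB : K ⊆ B := by
    intro z hz
    have := hR _ ⟨z, hz, rfl⟩
    have h1 := (norm_fst_le (e z)).trans this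
    have h2 := (norm_snd_le (e z)).trans this
    rw [Real.norm_eq_abs, abs_le] at h2
    exact ⟨by simpa using h1, h2⟩
  have hD : IsCompact (B ∩ {z | δ ≤ infDist z K}) :=
    hBc.inter_right (isClosed_le continuous_const (continuous_infDist_pt K))
  have hsep : ∀ z ∈ B ∩ {z | δ ≤ infDist z K}, ∃ fc : (E →ₗ[ℝ] ℝ) × ℝ,
      (∀ k ∈ K, fc.1 k ≤ fc.2) ∧ fc.2 < fc.1 z := by
    rintro z ⟨-, hz⟩
    have hzK : z ∉ K := by
      intro hzK
      have : infDist z K = 0 := infDist_zero_of_mem hzK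
      simp only [mem_ofPred_eq] at hz; linarith
    obtain ⟨f, u, h1, h2⟩ := geometric_hahn_banach_closed_point hK.cvx hK.cpt.isClosed hzK
    exact ⟨(f, u), fun k hk => (h1 k hk).le, h2⟩
  choose! fc hfc1 hfc2 using hsep
  obtain ⟨t, ht, htc⟩ := hD.elim_nhds_subcover (fun z => {w | (fc z).2 < (fc z).1 w}) (by
    intro z hz
    exact (isOpen_lt continuous_const (fc z).1.continuous_of_finiteDimensional).mem_nhds
      (hfc2 z hz))
  set P := Reg e (closedBall (0 : F) R) (0, -R) (0, R) [] [] (t.toList.map fc) with hP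
  have hPB : ∀ z, z ∈ P ↔ z ∈ B ∧ ∀ w ∈ t, (fc w).1 z ≤ (fc w).2 := by
    intro z
    simp [hP, hB, Reg, ev]
    tauto
  have hKP : K ⊆ P := fun z hz => (hPB z).2 ⟨hKB hz, fun w hw => hfc1 w (ht w hw) z hz⟩
  have hPcc : CC P := Reg.cc e hball _ _ _ _ _
  have h0 : μ P = 0 := F4 e hμ hs hw _ _ _ hball _ _
  have := h P hPcc (hn.mono hKP) ⟨fun x hx => ⟨x, hKP hx, by simpa using hδ.le⟩, fun z hz => ?_⟩
  · rw [h0, zero_sub, abs_neg] at this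
    exact lt_irrefl _ this
  · obtain ⟨hzB, hzf⟩ := (hPB z).1 hz
    have hlt : infDist z K < δ := by
      by_contra hge
      push Not at hge
      obtain ⟨w, hw, hw'⟩ := mem_iUnion₂.1 (htc ⟨hzB, hge⟩)
      exact absurd (hzf w hw) (not_le.2 hw')
    obtain ⟨y, hy, hy'⟩ := (infDist_lt_iff hn).1 hlt
    exact ⟨y, hy, by rw [dist_comm]; exact hy'.le⟩

end fiber

set_option linter.unusedSectionVars false

section qclass
variable {E : Type*} [NormedAddCommGroup E] [InnerProductSpace ℝ E] [FiniteDimensional ℝ E]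
variable {F : Type*} [NormedAddCommGroup F] [InnerProductSpace ℝ F] [FiniteDimensional ℝ F]

/-- simple valuations vanishing on orthogonal products with one factor orthogonal to `u` -/
structure IsQ (u : E) (θ : Set E → ℝ) : Prop where
  val : IsVal θ
  simp : IsSimple θ
  prod : ∀ P : E →ₗ[ℝ] E, (∀ x, P (P x) = P x) → (∀ x y, inner ℝ (P x) y = inner ℝ x (P y)) →
    P ≠ 0 → P u = 0 → ∀ K, CC K → (∀ x ∈ K, ∀ y ∈ K, P x + (y - P y) ∈ K) → θ K = 0

/-- orthogonal splitting -/
def OSplit (e : E ≃ₗ[ℝ] F × ℝ) : Prop :=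
  ∀ x y, inner ℝ x y = inner ℝ (e x).1 (e y).1 + (e x).2 * (e y).2

theorem OSplit.norm_le {e : E ≃ₗ[ℝ] F × ℝ} (he : OSplit e) (z : E) :
    ‖z‖ ≤ ‖(e z).1‖ + |(e z).2| := by
  have h := he z z
  rw [real_inner_self_eq_norm_sq, real_inner_self_eq_norm_sq] at h
  have h3 : 0 ≤ ‖(e z).1‖ * |(e z).2| := by positivity
  have h4 : (e z).2 * (e z).2 = |(e z).2| ^ 2 := by rw [sq_abs, sq]
  apply le_of_sq_le_sq _ (by positivity)
  nlinarith

variable {e : E ≃ₗ[ℝ] F × ℝ} {u : E} {θ : Set E → ℝ}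

/-- lift of an endomorphism -/
def liftP (e : E ≃ₗ[ℝ] F × ℝ) (P : F →ₗ[ℝ] F) : E →ₗ[ℝ] E :=
  (e.symm : F × ℝ →ₗ[ℝ] E).comp
    ((LinearMap.inl ℝ F ℝ).comp (P.comp ((LinearMap.fst ℝ F ℝ).comp (e : E →ₗ[ℝ] F × ℝ))))

theorem e_liftP (P : F →ₗ[ℝ] F) (z : E) : e (liftP e P z) = (P (e z).1, 0) := by
  simp [liftP]

theorem IsQ.prod_lift (hθ : IsQ u θ) (he : OSplit e) (hu : e u = (0, 1)) (P : F →ₗ[ℝ] F)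
    (h1 : ∀ x, P (P x) = P x) (h2 : ∀ x y, inner ℝ (P x) y = inner ℝ x (P y)) (h3 : P ≠ 0)
    (K : Set E) (hK : CC K)
    (h : ∀ x ∈ K, ∀ y ∈ K, liftP e P x + (y - liftP e P y) ∈ K) : θ K = 0 := by
  refine hθ.prod (liftP e P) ?_ ?_ ?_ ?_ K hK h
  · intro x; apply e.injective; rw [e_liftP, e_liftP]; simp [h1]
  · intro x y; rw [he, he, e_liftP, e_liftP]; simp [h2]
  · intro h0
    apply h3
    ext x
    have := e_liftP (e := e) P (e.symm (x, 0))
    rw [h0] at this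
    simp only [LinearMap.zero_apply, map_zero, LinearEquiv.apply_symm_apply] at this
    exact (congrArg Prod.fst this).symm
  · apply e.injective; rw [e_liftP, hu]; simp

theorem IsQ.box [Nontrivial F] (hθ : IsQ u θ) (he : OSplit e) (hu : e u = (0, 1)) {C : Set F}
    (hC : CC C) (d : ℝ) : θ (wedge e C 0 d) = 0 := by
  refine hθ.prod_lift he hu LinearMap.id (fun x => rfl) (fun x y => rfl) ?_ _
    (wedge.cc e hC _ _) ?_
  · intro h
    obtain ⟨x, hx⟩ := exists_ne (0 : F)
    exact hx (by simpa using congrArg (fun g => g x) h)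
  · rintro x ⟨x1, x2, x3⟩ y ⟨y1, y2, y3⟩
    have : e (liftP e LinearMap.id x + (y - liftP e LinearMap.id y)) = ((e x).1, (e y).2) := by
      rw [map_add, map_sub, e_liftP, e_liftP]; ext <;> simp
    simp only [wedge, mem_ofPred_eq, this]
    exact ⟨x1, y2, by simpa using y3⟩

theorem wedge_shift_cut (hv : IsVal θ) (hs : IsSimple θ) (e : E ≃ₗ[ℝ] F × ℝ) {C : Set F}
    (hC : CC C) (ℓ : F →ₗ[ℝ] ℝ) {c d : ℝ} (hc : ∀ x ∈ C, 0 ≤ ℓ x + c) (hd : 0 ≤ d) :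
    θ (wedge e C ℓ (c + d)) = θ (wedge e C 0 d) + θ (wedge e C ℓ c) := by
  rw [hv.cut hs (fb e 0 1) (fb_ne_right e _ one_ne_zero) d (wedge.cc e hC ℓ (c + d))]
  have e1 : wedge e C ℓ (c + d) ∩ {x | fb e 0 1 x ≤ d} = wedge e C 0 d := by
    ext z
    simp only [wedge, mem_inter_iff, mem_ofPred_eq, fb_apply, LinearMap.zero_apply]
    constructor
    · rintro ⟨⟨h3, h4, h5⟩, h6⟩
      exact ⟨h3, h4, by linarith⟩
    · rintro ⟨h3, h4, h5⟩
      have := hc _ h3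
      exact ⟨⟨h3, h4, by linarith⟩, by linarith⟩
  have e2 : wedge e C ℓ (c + d) ∩ {x | d ≤ fb e 0 1 x} = e.symm (0, d) +ᵥ wedge e C ℓ c := by
    ext z
    rw [mem_vadd_set_iff_neg_vadd_mem]
    simp only [wedge, mem_inter_iff, mem_ofPred_eq, fb_apply, LinearMap.zero_apply,
      vadd_eq_add, map_add, map_neg, LinearEquiv.apply_symm_apply, Prod.fst_add, Prod.snd_add,
      Prod.fst_neg, Prod.snd_neg, neg_zero, zero_add]
    constructor
    · rintro ⟨⟨h3, h4, h5⟩, h6⟩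
      exact ⟨h3, by linarith, by linarith⟩
    · rintro ⟨h3, h4, h5⟩
      exact ⟨⟨h3, by linarith, by linarith⟩, by linarith⟩
  rw [e1, e2, hv.trans _ _ (wedge.cc e hC _ _)]

theorem IsQ.shift [Nontrivial F] (hθ : IsQ u θ) (he : OSplit e) (hu : e u = (0, 1)) {C : Set F}
    (hC : CC C) (ℓ : F →ₗ[ℝ] ℝ) {c d : ℝ} (hc : ∀ x ∈ C, 0 ≤ ℓ x + c) (hd : 0 ≤ d) :
    θ (wedge e C ℓ (c + d)) = θ (wedge e C ℓ c) := by
  rw [wedge_shift_cut hθ.val hθ.simp e hC ℓ hc hd, hθ.box he hu hC, zero_add]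

theorem IsQ.indep [Nontrivial F] (hθ : IsQ u θ) (he : OSplit e) (hu : e u = (0, 1)) {C : Set F}
    (hC : CC C) (ℓ : F →ₗ[ℝ] ℝ) {c d : ℝ} (hc : ∀ x ∈ C, 0 ≤ ℓ x + c)
    (hd : ∀ x ∈ C, 0 ≤ ℓ x + d) :
    θ (wedge e C ℓ c) = θ (wedge e C ℓ d) := by
  rcases le_total c d with h | h
  · have := hθ.shift he hu hC ℓ hc (sub_nonneg.2 h)
    rw [add_sub_cancel] at this; exact this.symm
  · have := hθ.shift he hu hC ℓ hd (sub_nonneg.2 h)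
    rw [add_sub_cancel] at this; exact this

open Classical in
/-- the transferred valuation -/
def TT (e : E ≃ₗ[ℝ] F × ℝ) (ℓ : F →ₗ[ℝ] ℝ) (θ : Set E → ℝ) (C : Set F) : ℝ :=
  θ (wedge e C ℓ (if h : ∃ c, ∀ x ∈ C, 0 ≤ ℓ x + c then h.choose else 0))

theorem exists_valid {C : Set F} (hC : IsCompact C) (ℓ : F →ₗ[ℝ] ℝ) :
    ∃ c, 0 ≤ c ∧ ∀ x ∈ C, 0 ≤ ℓ x + c := by
  obtain ⟨M, hM⟩ := exists_ev_bound hC (ℓ, 0)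
  refine ⟨|M|, abs_nonneg _, fun x hx => ?_⟩
  have := (abs_le.1 (hM x hx)).1
  have := le_abs_self M
  simp only [ev] at *
  linarith

theorem IsQ.TT_eq [Nontrivial F] (hθ : IsQ u θ) (he : OSplit e) (hu : e u = (0, 1)) {C : Set F}
    (hC : CC C) (ℓ : F →ₗ[ℝ] ℝ) {c : ℝ} (hc : ∀ x ∈ C, 0 ≤ ℓ x + c) :
    TT e ℓ θ C = θ (wedge e C ℓ c) := by
  have h : ∃ c, ∀ x ∈ C, 0 ≤ ℓ x + c := ⟨c, hc⟩
  rw [TT, dif_pos h]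
  exact hθ.indep he hu hC ℓ h.choose_spec hc

theorem IsQ.TT_val [Nontrivial F] (hθ : IsQ u θ) (he : OSplit e) (hu : e u = (0, 1))
    (ℓ : F →ₗ[ℝ] ℝ) : IsVal (TT e ℓ θ) where
  empty := by
    rw [TT]
    convert hθ.val.empty
    ext z; simp [wedge]
  union K L hK hL hU hI := by
    have hKL : CC (K ∪ L) := ⟨hK.cpt.union hL.cpt, hU⟩
    obtain ⟨c, -, hc⟩ := exists_valid hKL.cpt ℓ
    rw [hθ.TT_eq he hu hKL ℓ hc, hθ.TT_eq he hu hK ℓ fun x hx => hc x (Or.inl hx),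
      hθ.TT_eq he hu hL ℓ fun x hx => hc x (Or.inr hx),
      hθ.TT_eq he hu (hK.inter hL) ℓ fun x hx => hc x (Or.inl hx.1)]
    have e1 : wedge e (K ∪ L) ℓ c = wedge e K ℓ c ∪ wedge e L ℓ c := by
      ext z; simp only [wedge, mem_ofPred_eq, mem_union]; tauto
    have e2 : wedge e (K ∩ L) ℓ c = wedge e K ℓ c ∩ wedge e L ℓ c := by
      ext z; simp only [wedge, mem_ofPred_eq, mem_inter_iff]; tauto
    have := hθ.val.union _ _ (wedge.cc e hK ℓ c) (wedge.cc e hL ℓ c)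
      (by rw [← e1]; exact (wedge.cc e hKL ℓ c).cvx) (by
        rw [← e2]
        obtain ⟨x, hx⟩ := hI
        exact ⟨e.symm (x, 0), by simpa [wedge] using ⟨hx, hc x (Or.inl hx.1)⟩⟩)
    rw [e1, e2, this]
  cont K hK hn ε hε := by
    obtain ⟨c0, -, hc0⟩ := exists_valid hK.cpt ℓ
    set N := ‖LinearMap.toContinuousLinearMap ℓ‖ with hN
    have hN0 : 0 ≤ N := norm_nonneg _
    have hlip : ∀ x y, |ℓ x - ℓ y| ≤ N * dist x y := by
      intro x y
      have := (LinearMap.toContinuousLinearMap ℓ).le_opNorm (x - y)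
      simpa [dist_eq_norm] using this
    have hcK : ∀ x ∈ K, 0 ≤ ℓ x + (c0 + N) := fun x hx => by have := hc0 x hx; linarith
    have hne : ∀ L : Set F, L.Nonempty → (∀ x ∈ L, 0 ≤ ℓ x + (c0 + N)) →
        (wedge e L ℓ (c0 + N)).Nonempty := by
      rintro L ⟨x, hx⟩ h
      exact ⟨e.symm (x, 0), by simpa [wedge] using ⟨hx, h x hx⟩⟩
    obtain ⟨δ, hδ, h⟩ := hθ.val.cont _ (wedge.cc e hK ℓ (c0 + N)) (hne K hn hcK) ε hε
    refine ⟨min 1 (δ / (1 + N)), by positivity, fun L hL hLn hcl => ?_⟩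
    have hcL : ∀ x ∈ L, 0 ≤ ℓ x + (c0 + N) := by
      intro x hx
      obtain ⟨y, hy, hd⟩ := hcl.2 x hx
      have h1 := (abs_le.1 (hlip y x)).2
      have h2 := hc0 y hy
      have h3 : N * dist y x ≤ N * 1 :=
        mul_le_mul_of_nonneg_left (hd.trans (min_le_left _ _)) hN0
      linarith
    rw [hθ.TT_eq he hu hK ℓ hcK, hθ.TT_eq he hu hL ℓ hcL]
    refine h _ (wedge.cc e hL ℓ _) (hne L hLn hcL) ?_
    have key : ∀ x y : F, dist x y ≤ min 1 (δ / (1 + N)) → 0 ≤ ℓ y + (c0 + N) → ∀ z : E,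
        (e z).1 = x → 0 ≤ (e z).2 → (e z).2 ≤ ℓ x + (c0 + N) →
        dist z (e.symm (y, min (e z).2 (ℓ y + (c0 + N)))) ≤ δ := by
      intro x y hxy hy z hz hz0 hz1
      rw [dist_eq_norm]
      refine (he.norm_le _).trans ?_
      have h1 : dist x y ≤ δ / (1 + N) := hxy.trans (min_le_right _ _)
      rw [le_div_iff₀ (by positivity)] at h1
      simp only [map_sub, LinearEquiv.apply_symm_apply, Prod.fst_sub, Prod.snd_sub, hz]
      rw [← dist_eq_norm]
      have h2 : |(e z).2 - min (e z).2 (ℓ y + (c0 + N))| ≤ N * dist x y := by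
        rw [abs_of_nonneg (sub_nonneg.2 (min_le_left _ _))]
        have h3 := (abs_le.1 (hlip x y)).2
        rcases min_choice (e z).2 (ℓ y + (c0 + N)) with h4 | h4 <;> rw [h4]
        · simp only [sub_self]; positivity
        · linarith
      linarith
    constructor
    · rintro z ⟨h1, h2, h3⟩
      obtain ⟨y, hy, hd⟩ := hcl.1 _ h1
      refine ⟨_, ?_, key _ y hd (hcL y hy) z rfl h2 h3⟩
      simp only [wedge, mem_ofPred_eq, LinearEquiv.apply_symm_apply]
      exact ⟨hy, le_min h2 (hcL y hy), min_le_right _ _⟩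
    · rintro z ⟨h1, h2, h3⟩
      obtain ⟨y, hy, hd⟩ := hcl.2 _ h1
      rw [dist_comm] at hd
      refine ⟨_, ?_, by rw [dist_comm]; exact key _ y hd (hcK y hy) z rfl h2 h3⟩
      simp only [wedge, mem_ofPred_eq, LinearEquiv.apply_symm_apply]
      exact ⟨hy, le_min h2 (hcK y hy), min_le_right _ _⟩
  trans x K hK := by
    obtain ⟨c, -, hc⟩ := exists_valid (hK.vadd x).cpt ℓ
    have hc' : ∀ y ∈ K, 0 ≤ ℓ y + (ℓ x + c) := by
      intro y hy
      have := hc (x + y) ⟨y, hy, rfl⟩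
      rw [map_add] at this; linarith
    rw [hθ.TT_eq he hu (hK.vadd x) ℓ hc, hθ.TT_eq he hu hK ℓ hc']
    rw [← hθ.val.trans (e.symm (x, 0)) _ (wedge.cc e hK ℓ _)]
    congr 1
    ext z
    rw [mem_vadd_set_iff_neg_vadd_mem]
    simp only [wedge, mem_ofPred_eq, mem_vadd_set_iff_neg_vadd_mem,
      vadd_eq_add, map_add, map_neg, LinearEquiv.apply_symm_apply, Prod.fst_add, Prod.snd_add,
      Prod.fst_neg, Prod.snd_neg, neg_zero, zero_add]
    constructor
    · rintro ⟨h3, h4, h5⟩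
      exact ⟨h3, by linarith, by linarith⟩
    · rintro ⟨h3, h4, h5⟩
      exact ⟨h3, by linarith, by linarith⟩

theorem IsQ.TT_isQ [Nontrivial F] (hθ : IsQ u θ) (he : OSplit e) (hu : e u = (0, 1))
    (ℓ : F →ₗ[ℝ] ℝ) (u' : F) (s : ℝ) (hℓ : ∀ x, ℓ x = s * inner ℝ u' x) : IsQ u' (TT e ℓ θ) where
  val := hθ.TT_val he hu ℓ
  simp f c hf K hK h := by
    obtain ⟨d, -, hd⟩ := exists_valid hK.cpt ℓ
    rw [hθ.TT_eq he hu hK ℓ hd]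
    refine hθ.simp (fb e f 0) c (fb_ne_left e hf 0) _ (wedge.cc e hK ℓ d) ?_
    rintro z ⟨h1, -, -⟩
    simpa using h _ h1
  prod P h1 h2 h3 h4 K hK h := by
    obtain ⟨d, -, hd⟩ := exists_valid hK.cpt ℓ
    rw [hθ.TT_eq he hu hK ℓ hd]
    refine hθ.prod_lift he hu P h1 h2 h3 _ (wedge.cc e hK ℓ d) ?_
    rintro x ⟨x1, x2, x3⟩ y ⟨y1, y2, y3⟩
    have e1 : e (liftP e P x + (y - liftP e P y)) =
        (P (e x).1 + ((e y).1 - P (e y).1), (e y).2) := by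
      rw [map_add, map_sub, e_liftP, e_liftP]; ext <;> simp
    have hP : ∀ w, ℓ (P w) = 0 := by
      intro w; rw [hℓ, ← h2, h4]; simp
    simp only [wedge, mem_ofPred_eq, e1]
    refine ⟨h _ x1 _ y1, y2, ?_⟩
    rw [map_add, map_sub, hP, hP]; linarith

theorem smul_wedge (e : E ≃ₗ[ℝ] F × ℝ) (C : Set F) (ℓ : F →ₗ[ℝ] ℝ) (c : ℝ) :
    (2 : ℝ) • wedge e C ℓ c = wedge e ((2 : ℝ) • C) ℓ (2 * c) := by
  ext z
  rw [Set.mem_smul_set_iff_inv_smul_mem₀ two_ne_zero]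
  simp only [wedge, mem_ofPred_eq, Set.mem_smul_set_iff_inv_smul_mem₀ (two_ne_zero (α := ℝ)),
    map_smul, Prod.smul_fst, Prod.smul_snd, smul_eq_mul]
  constructor
  · rintro ⟨h1, h2, h3⟩; exact ⟨h1, by linarith, by linarith⟩
  · rintro ⟨h1, h2, h3⟩; exact ⟨h1, by linarith, by linarith⟩

theorem rho_simple (hs : IsSimple θ) : IsSimple fun K => θ ((2 : ℝ) • K) - 2 * θ K := by
  intro f c hf K hK h
  simp only
  rw [hs f c hf K hK h, hs f (2 * c) hf _ (hK.smul 2), mul_zero, sub_zero]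
  rintro _ ⟨x, hx, rfl⟩
  simp [h x hx]

/-- the segment lemma -/
theorem IsQ.seg [Nontrivial F] (hθ : IsQ u θ) (he : OSplit e) (hu : e u = (0, 1)) {t : ℝ}
    (ht : 0 ≤ t) {K : Set E} (hK : CC K) :
    θ (K + wedge e {0} 0 t) = θ K := by
  have hS : CC (wedge e ({0} : Set F) 0 t) := wedge.cc e (CC.singleton 0) 0 t
  have hSn : (wedge e ({0} : Set F) 0 t).Nonempty := ⟨0, by simpa [wedge] using ht⟩
  have hadd : ∀ C : Set F, ∀ ℓ : F →ₗ[ℝ] ℝ, ∀ c, (∀ x ∈ C, 0 ≤ ℓ x + c) →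
      wedge e C ℓ c + wedge e {0} 0 t = wedge e C ℓ (c + t) := by
    intro C ℓ c hc
    ext z
    rw [Set.mem_add]
    constructor
    · rintro ⟨x, ⟨x1, x2, x3⟩, y, ⟨y1, y2, y3⟩, rfl⟩
      have y1' : (e y).1 = 0 := y1
      have y3' : (e y).2 ≤ t := by simpa using y3
      simp only [wedge, mem_ofPred_eq, map_add, Prod.fst_add, Prod.snd_add, y1', add_zero]
      exact ⟨x1, by linarith, by linarith⟩
    · rintro ⟨h1, h2, h3⟩
      have h4 := hc _ h1
      refine ⟨e.symm ((e z).1, min (e z).2 (ℓ (e z).1 + c)), ?_,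
        e.symm (0, (e z).2 - min (e z).2 (ℓ (e z).1 + c)), ?_, ?_⟩
      · simp only [wedge, mem_ofPred_eq, LinearEquiv.apply_symm_apply]
        exact ⟨h1, le_min h2 h4, min_le_right _ _⟩
      · simp only [wedge, mem_ofPred_eq, LinearEquiv.apply_symm_apply, mem_singleton_iff,
          LinearMap.zero_apply]
        refine ⟨trivial, sub_nonneg.2 (min_le_left _ _), ?_⟩
        rcases min_choice (e z).2 (ℓ (e z).1 + c) with h5 | h5 <;> rw [h5] <;> linarith
      · apply e.injective; ext <;> simp
  have hval : IsVal fun K => θ (K + wedge e {0} 0 t) - θ K :=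
    (hθ.val.comp_add hS hSn).sub hθ.val
  have := fiber_reduction e hval ?_ ?_ K hK
  · exact sub_eq_zero.1 this
  · intro g k hg K hK h
    simp only
    rw [hθ.simp g k hg K hK h, sub_zero]
    obtain ⟨f, b, rfl⟩ := exists_fb e g
    by_cases hb : b = 0
    · subst hb
      refine hθ.simp (fb e f 0) k hg _ (hK.add hS) ?_
      rintro _ ⟨x, hx, y, ⟨y1, -, -⟩, rfl⟩
      have y1' : (e y).1 = 0 := y1
      have := h x hx
      simpa [y1'] using this
    · -- graph case
      set C : Set F := ((LinearMap.fst ℝ F ℝ).comp (e : E →ₗ[ℝ] F × ℝ)) '' K with hCdef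
      have hC : CC C := hK.image _
      set ℓ : F →ₗ[ℝ] ℝ := -(b⁻¹ • f) with hℓ
      have hgraph : ∀ z, z ∈ K → (e z).2 = ℓ (e z).1 + b⁻¹ * k := by
        intro z hz
        have := h z hz
        simp only [fb_apply] at this
        simp only [hℓ, LinearMap.neg_apply, LinearMap.smul_apply, smul_eq_mul]
        field_simp
        linarith
      have hmem : ∀ z, z ∈ K ↔ (e z).1 ∈ C ∧ (e z).2 = ℓ (e z).1 + b⁻¹ * k := by
        intro z
        constructor
        · intro hz; exact ⟨⟨z, hz, rfl⟩, hgraph z hz⟩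
        · rintro ⟨⟨w, hw, hw'⟩, h2⟩
          have hw'' : (e w).1 = (e z).1 := hw'
          have : w = z := by
            apply e.injective
            ext1
            · exact hw''
            · rw [hgraph w hw, h2, hw'']
          exact this ▸ hw
      obtain ⟨c, -, hc⟩ := exists_valid hC.cpt ℓ
      have hcut := hθ.val.cut hθ.simp (fb e (-ℓ) 1) (fb_ne_right e _ one_ne_zero) c
        (wedge.cc e hC ℓ (c + t))
      rw [hθ.shift he hu hC ℓ hc ht] at hcut
      have e1 : wedge e C ℓ (c + t) ∩ {x | fb e (-ℓ) 1 x ≤ c} = wedge e C ℓ c := by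
        ext z
        simp only [wedge, mem_inter_iff, mem_ofPred_eq, fb_apply, LinearMap.neg_apply]
        constructor
        · rintro ⟨⟨h3, h4, h5⟩, h6⟩
          exact ⟨h3, h4, by linarith⟩
        · rintro ⟨h3, h4, h5⟩
          exact ⟨⟨h3, h4, by linarith⟩, by linarith⟩
      have e2 : wedge e C ℓ (c + t) ∩ {x | c ≤ fb e (-ℓ) 1 x} =
          e.symm (0, c - b⁻¹ * k) +ᵥ (K + wedge e {0} 0 t) := by
        ext z
        rw [mem_vadd_set_iff_neg_vadd_mem, vadd_eq_add, Set.mem_add]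
        simp only [wedge, mem_inter_iff, mem_ofPred_eq, fb_apply, LinearMap.neg_apply]
        constructor
        · rintro ⟨⟨h3, h4, h5⟩, h6⟩
          refine ⟨e.symm ((e z).1, ℓ (e z).1 + b⁻¹ * k), ?_,
            e.symm (0, (e z).2 - c - ℓ (e z).1), ?_, ?_⟩
          · rw [hmem]; simpa using h3
          · simp only [LinearEquiv.apply_symm_apply, mem_singleton_iff, LinearMap.zero_apply]
            exact ⟨trivial, by linarith, by linarith⟩
          · apply e.injective
            ext
            · simp
            · simp; ring
        · rintro ⟨x, hx, y, ⟨y1, y2, y3⟩, h7⟩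
          have hz : z = e.symm (0, c - b⁻¹ * k) + (x + y) := by rw [h7]; simp
          have y1' : (e y).1 = 0 := y1
          obtain ⟨hx1, hx2⟩ := (hmem x).1 hx
          have y3' : (e y).2 ≤ t := by simpa using y3
          have := hc _ hx1
          rw [hz]
          simp only [map_add, LinearEquiv.apply_symm_apply, Prod.fst_add, Prod.snd_add, y1',
            zero_add, add_zero, hx2]
          exact ⟨⟨hx1, by linarith, by linarith⟩, by linarith⟩
      rw [e1, e2, hθ.val.trans _ _ (hK.add hS)] at hcut
      linarith
  · intro C ℓ c hC hc
    rw [hadd C ℓ c hc, hθ.shift he hu hC ℓ hc ht, sub_self]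

end qclass

/-! ### Euclidean coordinates -/

/-- splitting off the last coordinate -/
def split0 (m : ℕ) : En (m + 1) ≃ₗ[ℝ] En m × ℝ where
  toFun x := (WithLp.toLp 2 fun i => x i.castSucc, x (Fin.last m))
  invFun w := WithLp.toLp 2 (Fin.snoc (α := fun _ => ℝ) (fun i => w.1 i) w.2)
  map_add' x y := by ext <;> simp
  map_smul' c x := by ext <;> simp
  left_inv x := by
    ext i
    refine Fin.lastCases ?_ (fun i => ?_) i <;> simp
  right_inv w := by
    ext <;> simp

theorem split0_osplit (m : ℕ) : OSplit (split0 m) := by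
  intro x y
  simp only [PiLp.inner_apply, split0, LinearEquiv.coe_mk, LinearMap.coe_mk, AddHom.coe_mk]
  rw [Fin.sum_univ_castSucc]
  simp [mul_comm]

theorem exists_split {m : ℕ} (u : En (m + 1)) (hu : ‖u‖ = 1) :
    ∃ e : En (m + 1) ≃ₗ[ℝ] En m × ℝ, OSplit e ∧ e u = (0, 1) := by
  set v := (split0 m).symm (0, 1) with hv
  have hvn : ‖v‖ = 1 := by
    have := split0_osplit m v v
    rw [real_inner_self_eq_norm_sq, hv] at this
    simp only [LinearEquiv.apply_symm_apply] at this
    rw [← hv] at this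
    simp at this
    rcases this with h | h
    · exact h
    · have := norm_nonneg v; linarith
  set g := Submodule.reflection (ℝ ∙ (u - v))ᗮ with hg
  have hgu : g u = v := Submodule.reflection_sub (by rw [hu, hvn])
  refine ⟨g.toLinearEquiv.trans (split0 m), ?_, ?_⟩
  · intro x y
    simp only [LinearEquiv.trans_apply]
    rw [← split0_osplit m]
    exact (g.inner_map_map x y).symm
  · simp only [LinearEquiv.trans_apply]
    change split0 m (g u) = _
    rw [hgu, hv]; simp

theorem lemmaH : ∀ (m : ℕ) (u : En (m + 1)) (_ : ‖u‖ = 1) (θ : Set (En (m + 1)) → ℝ)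
    (_ : IsQ u θ) (K : Set (En (m + 1))) (_ : CC K), θ ((2 : ℝ) • K) = 2 * θ K := by
  intro m
  induction m with
  | zero =>
    intro u hu θ hθ K hK
    obtain ⟨e, he, heu⟩ := exists_split u hu
    have := fiber_reduction e ((hθ.val.comp_smul two_ne_zero).sub (hθ.val.const_mul 2))
      (rho_simple hθ.simp) ?_ K hK
    · linarith
    · intro C ℓ c hC hc
      have hℓ : ℓ = 0 := by ext x; rw [Subsingleton.elim x 0]; simp
      subst hℓ
      rw [smul_wedge]
      have h2C : (2 : ℝ) • C = C := by
        ext x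
        rw [Set.mem_smul_set_iff_inv_smul_mem₀ two_ne_zero, Subsingleton.elim ((2 : ℝ)⁻¹ • x) x]
      rw [h2C]
      rcases C.eq_empty_or_nonempty with rfl | ⟨x, hx⟩
      · have : ∀ d, wedge e ∅ 0 d = ∅ := by intro d; ext; simp [wedge]
        rw [this, this, hθ.val.empty]; simp
      · have := wedge_shift_cut hθ.val hθ.simp e hC 0 hc (by simpa using hc x hx)
        rw [two_mul c, this]; ring
  | succ m ih =>
    intro u hu θ hθ K hK
    obtain ⟨e, he, heu⟩ := exists_split u hu
    have := fiber_reduction e ((hθ.val.comp_smul two_ne_zero).sub (hθ.val.const_mul 2))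
      (rho_simple hθ.simp) ?_ K hK
    · linarith
    · intro C ℓ c hC hc
      obtain ⟨u', s, hu', hℓ⟩ : ∃ (u' : En (m + 1)) (s : ℝ), ‖u'‖ = 1 ∧
          ∀ x, ℓ x = s * inner ℝ u' x := by
        set w := (InnerProductSpace.toDual ℝ (En (m + 1))).symm (LinearMap.toContinuousLinearMap ℓ)
        have hw : ∀ x, ℓ x = inner ℝ w x := by
          intro x; simp [w]
        by_cases h0 : w = 0
        · obtain ⟨v, hv⟩ := exists_norm_eq (En (m + 1)) zero_le_one
          exact ⟨v, 0, hv, fun x => by rw [hw, h0]; simp⟩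
        · refine ⟨‖w‖⁻¹ • w, ‖w‖, norm_smul_inv_norm h0, fun x => ?_⟩
          rw [hw, real_inner_smul_left, ← mul_assoc, mul_inv_cancel₀ (norm_ne_zero_iff.2 h0),
            one_mul]
      have hT := ih u' hu' (TT e ℓ θ) (hθ.TT_isQ he heu ℓ u' s hℓ) C hC
      have hc2 : ∀ x ∈ (2 : ℝ) • C, 0 ≤ ℓ x + 2 * c := by
        rintro _ ⟨x, hx, rfl⟩
        have := hc x hx
        simp only [map_smul, smul_eq_mul]; linarith
      rw [hθ.TT_eq he heu hC ℓ hc, hθ.TT_eq he heu (hC.smul 2) ℓ hc2, ← smul_wedge] at hT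
      linarith

/-- the segment lemma in Euclidean coordinates -/
theorem seg_lemma {m : ℕ} (u : En (m + 2)) (hu : ‖u‖ = 1) (θ : Set (En (m + 2)) → ℝ)
    (hθ : IsQ u θ) {t : ℝ} (ht : 0 ≤ t) (K : Set (En (m + 2))) (hK : CC K) :
    θ (K + segment ℝ 0 (t • u)) = θ K := by
  obtain ⟨e, he, heu⟩ := exists_split u hu
  rw [← hθ.seg he heu ht hK]
  congr 2
  ext z
  rw [segment_eq_image]
  simp only [wedge, mem_image, mem_ofPred_eq, mem_singleton_iff, LinearMap.zero_apply, zero_add,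
    smul_zero, mem_Icc]
  constructor
  · rintro ⟨s, ⟨h0, h1⟩, rfl⟩
    simp only [map_smul, heu]
    refine ⟨by simp, by simp; positivity, ?_⟩
    simp only [Prod.smul_snd, smul_eq_mul]
    nlinarith
  · rintro ⟨h1, h2, h3⟩
    rcases ht.eq_or_lt with rfl | ht
    · refine ⟨0, by simp, ?_⟩
      apply e.injective
      ext1
      · simp [h1]
      · simp; linarith
    · refine ⟨(e z).2 / t, ⟨by positivity, (div_le_one ht).2 h3⟩, ?_⟩
      apply e.injective
      rw [map_smul, map_smul, heu]
      ext1
      · simp [h1]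
      · simp; field_simp

set_option linter.unusedSectionVars false
set_option linter.deprecated false

/-! ### Rotations -/
section rot
variable {E : Type*} [NormedAddCommGroup E] [InnerProductSpace ℝ E] [FiniteDimensional ℝ E]
variable {F : Type*} [NormedAddCommGroup F] [InnerProductSpace ℝ F] [FiniteDimensional ℝ F]
variable {G : Type*} [NormedAddCommGroup G] [InnerProductSpace ℝ G] [FiniteDimensional ℝ G]

/-- determinant of an isometry -/
def idet (g : E ≃ₗᵢ[ℝ] E) : ℝ := LinearMap.det (g.toLinearEquiv : E →ₗ[ℝ] E)

theorem idet_trans (g h : E ≃ₗᵢ[ℝ] E) : idet (g.trans h) = idet h * idet g := by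
  have : ((g.trans h).toLinearEquiv : E →ₗ[ℝ] E) =
    (h.toLinearEquiv : E →ₗ[ℝ] E) * (g.toLinearEquiv : E →ₗ[ℝ] E) := rfl
  rw [idet, this, map_mul]; rfl

theorem idet_refl : idet (LinearIsometryEquiv.refl ℝ E) = 1 := by
  have : ((LinearIsometryEquiv.refl ℝ E).toLinearEquiv : E →ₗ[ℝ] E) = LinearMap.id := rfl
  rw [idet, this, LinearMap.det_id]

theorem idet_reflection {v : E} (hv : v ≠ 0) :
    idet (Submodule.reflection (ℝ ∙ v)ᗮ) = -1 := by
  have := Submodule.det_reflection (ℝ ∙ v)ᗮ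
  rw [Submodule.orthogonal_orthogonal, finrank_span_singleton hv, pow_one] at this
  exact this

/-- rotation invariance -/
def IsRot (μ : Set E → ℝ) : Prop :=
  ∀ g : E ≃ₗᵢ[ℝ] E, idet g = 1 → ∀ K, CC K → μ (g '' K) = μ K

theorem exists_rot_pm {u v : E} (h : ‖u‖ = ‖v‖) (hu : u ≠ 0) :
    ∃ g : E ≃ₗᵢ[ℝ] E, idet g = 1 ∧ (g u = v ∨ g u = -v) := by
  by_cases huv : u = v
  · exact ⟨LinearIsometryEquiv.refl ℝ E, idet_refl, Or.inl huv⟩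
  · refine ⟨(Submodule.reflection (ℝ ∙ u)ᗮ).trans (Submodule.reflection (ℝ ∙ (u - v))ᗮ), ?_, ?_⟩
    · rw [idet_trans, idet_reflection hu, idet_reflection (sub_ne_zero.2 huv)]; norm_num
    · right
      simp only [LinearIsometryEquiv.trans_apply]
      rw [Submodule.reflection_orthogonalComplement_singleton_eq_neg, map_neg,
        Submodule.reflection_sub h]

theorem exists_rot (hE : 2 ≤ Module.finrank ℝ E) {u v : E} (h : ‖u‖ = ‖v‖) (hu : u ≠ 0) :
    ∃ g : E ≃ₗᵢ[ℝ] E, idet g = 1 ∧ g u = v := by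
  obtain ⟨g, hg, h1 | h1⟩ := exists_rot_pm h hu
  · exact ⟨g, hg, h1⟩
  · have hv : v ≠ 0 := by rw [← norm_ne_zero_iff, ← h]; exact norm_ne_zero_iff.2 hu
    have : ∃ w ∈ (ℝ ∙ v)ᗮ, w ≠ 0 := by
      apply Submodule.exists_mem_ne_zero_of_ne_bot
      intro h0
      have h2 := Submodule.finrank_add_finrank_orthogonal (ℝ ∙ v)
      rw [h0, finrank_bot, finrank_span_singleton hv] at h2
      omega
    obtain ⟨w, hw, hw0⟩ := this
    refine ⟨(g.trans (Submodule.reflection (ℝ ∙ v)ᗮ)).trans (Submodule.reflection (ℝ ∙ w)ᗮ), ?_, ?_⟩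
    · rw [idet_trans, idet_trans, idet_reflection hv, idet_reflection hw0, hg]; norm_num
    · simp only [LinearIsometryEquiv.trans_apply]
      rw [h1, map_neg, Submodule.reflection_orthogonalComplement_singleton_eq_neg, neg_neg]
      apply Submodule.reflection_mem_subspace_eq_self
      rw [Submodule.mem_orthogonal_singleton_iff_inner_right] at hw ⊢
      rw [real_inner_comm]; exact hw

theorem CC.isom {K : Set E} (hK : CC K) (g : E ≃ₗᵢ[ℝ] F) : CC (g '' K) :=
  hK.image (g.toLinearEquiv : E →ₗ[ℝ] F)

theorem Close.isom {K L : Set E} {δ : ℝ} (h : Close δ K L) (g : E ≃ₗᵢ[ℝ] F) :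
    Close δ (g '' K) (g '' L) := by
  have := h.image g zero_le_one (fun x y => by rw [g.dist_map, one_mul])
  rwa [one_mul] at this

/-- orthogonal splitting into a product -/
def OS2 (e : E ≃ₗ[ℝ] F × G) : Prop :=
  ∀ x y, inner ℝ x y = inner ℝ (e x).1 (e y).1 + inner ℝ (e x).2 (e y).2

/-- lift of an isometry -/
def liftI (e : E ≃ₗ[ℝ] F × G) (he : OS2 e) (g : F ≃ₗᵢ[ℝ] F) : E ≃ₗᵢ[ℝ] E :=
  ((e.trans (g.toLinearEquiv.prodCongr (LinearEquiv.refl ℝ G))).trans e.symm).isometryOfInner (by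
    intro x y
    rw [he, he]
    simp only [LinearEquiv.trans_apply, LinearEquiv.apply_symm_apply, LinearEquiv.prodCongr_apply,
      LinearIsometryEquiv.coe_toLinearEquiv, g.inner_map_map, LinearEquiv.refl_apply])

theorem e_liftI (e : E ≃ₗ[ℝ] F × G) (he : OS2 e) (g : F ≃ₗᵢ[ℝ] F) (x : E) :
    e (liftI e he g x) = (g (e x).1, (e x).2) := by
  simp [liftI]

theorem idet_liftI (e : E ≃ₗ[ℝ] F × G) (he : OS2 e) (g : F ≃ₗᵢ[ℝ] F) :
    idet (liftI e he g) = idet g := by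
  have h1 := LinearMap.det_conj
    (LinearMap.prodMap (g.toLinearEquiv : F →ₗ[ℝ] F) (LinearMap.id : G →ₗ[ℝ] G)) e.symm
  rw [LinearMap.det_prodMap, LinearMap.det_id, mul_one] at h1
  rw [idet, idet, ← h1]
  rfl

/-- product set -/
def pr (e : E ≃ₗ[ℝ] F × G) (P : Set F) (Q : Set G) : Set E := {z | (e z).1 ∈ P ∧ (e z).2 ∈ Q}

theorem pr_eq (e : E ≃ₗ[ℝ] F × G) (P : Set F) (Q : Set G) : pr e P Q = e.symm '' (P ×ˢ Q) := by
  ext z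
  simp only [pr, mem_ofPred_eq, mem_image, mem_prod]
  constructor
  · intro h; exact ⟨e z, h, by simp⟩
  · rintro ⟨w, h, rfl⟩; simpa using h

theorem pr.cc (e : E ≃ₗ[ℝ] F × G) {P : Set F} {Q : Set G} (hP : CC P) (hQ : CC Q) :
    CC (pr e P Q) := by
  rw [pr_eq]
  have : CC (P ×ˢ Q) := ⟨hP.cpt.prod hQ.cpt, hP.cvx.prod hQ.cvx⟩
  exact this.image (e.symm : F × G →ₗ[ℝ] E)

theorem OS2.norm_sub {e : E ≃ₗ[ℝ] F × G} (he : OS2 e) {z w : E} (h : (e z).2 = (e w).2) :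
    dist z w = dist (e z).1 (e w).1 := by
  rw [dist_eq_norm, dist_eq_norm]
  have := he (z - w) (z - w)
  simp only [map_sub, Prod.fst_sub, Prod.snd_sub, h, sub_self, inner_zero_left, add_zero] at this
  rw [real_inner_self_eq_norm_sq, real_inner_self_eq_norm_sq] at this
  exact (sq_eq_sq₀ (norm_nonneg _) (norm_nonneg _)).1 this

theorem pr_close {e : E ≃ₗ[ℝ] F × G} (he : OS2 e) {K L : Set F} {δ : ℝ} (h : Close δ K L)
    (Q : Set G) : Close δ (pr e K Q) (pr e L Q) := by
  constructor
  · rintro z ⟨h1, h2⟩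
    obtain ⟨y, hy, hd⟩ := h.1 _ h1
    refine ⟨e.symm (y, (e z).2), by simpa [pr] using ⟨hy, h2⟩, ?_⟩
    rw [he.norm_sub (by simp)]; simpa using hd
  · rintro z ⟨h1, h2⟩
    obtain ⟨y, hy, hd⟩ := h.2 _ h1
    refine ⟨e.symm (y, (e z).2), by simpa [pr] using ⟨hy, h2⟩, ?_⟩
    rw [he.norm_sub (by simp)]; simpa using hd

theorem pr_val {e : E ≃ₗ[ℝ] F × G} (he : OS2 e) {μ : Set E → ℝ} (hμ : IsVal μ) {Q : Set G}
    (hQ : CC Q) (hQn : Q.Nonempty) : IsVal fun P => μ (pr e P Q) where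
  empty := by
    convert hμ.empty
    ext; simp [pr]
  union K L hK hL hU hI := by
    have e1 : pr e (K ∪ L) Q = pr e K Q ∪ pr e L Q := by
      ext z; simp only [pr, mem_ofPred_eq, mem_union]; tauto
    have e2 : pr e (K ∩ L) Q = pr e K Q ∩ pr e L Q := by
      ext z; simp only [pr, mem_ofPred_eq, mem_inter_iff]; tauto
    simp only [e1, e2]
    refine hμ.union _ _ (pr.cc e hK hQ) (pr.cc e hL hQ) ?_ ?_
    · rw [← e1]; exact (pr.cc e ⟨hK.cpt.union hL.cpt, hU⟩ hQ).cvx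
    · rw [← e2]
      obtain ⟨x, hx⟩ := hI
      obtain ⟨y, hy⟩ := hQn
      exact ⟨e.symm (x, y), by simpa [pr] using ⟨hx, hy⟩⟩
  cont K hK hn ε hε := by
    have hne : ∀ L : Set F, L.Nonempty → (pr e L Q).Nonempty := by
      rintro L ⟨x, hx⟩
      obtain ⟨y, hy⟩ := hQn
      exact ⟨e.symm (x, y), by simpa [pr] using ⟨hx, hy⟩⟩
    obtain ⟨δ, hδ, h⟩ := hμ.cont _ (pr.cc e hK hQ) (hne K hn) ε hε
    exact ⟨δ, hδ, fun L hL hLn hc => h _ (pr.cc e hL hQ) (hne L hLn) (pr_close he hc Q)⟩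
  trans x K hK := by
    rw [← hμ.trans (e.symm (x, 0)) _ (pr.cc e hK hQ)]
    congr 1
    ext z
    rw [mem_vadd_set_iff_neg_vadd_mem]
    simp [pr, mem_vadd_set_iff_neg_vadd_mem]

theorem pr_rot {e : E ≃ₗ[ℝ] F × G} (he : OS2 e) {μ : Set E → ℝ} (hμ : IsRot μ) {Q : Set G}
    (hQ : CC Q) : IsRot fun P => μ (pr e P Q) := by
  intro g hg K hK
  simp only
  rw [← hμ (liftI e he g) (by rw [idet_liftI, hg]) _ (pr.cc e hK hQ)]
  congr 1
  ext z
  simp only [pr, mem_ofPred_eq, mem_image]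
  constructor
  · rintro ⟨⟨x, hx, hxz⟩, hz⟩
    refine ⟨e.symm (x, (e z).2), by simpa using ⟨hx, hz⟩, ?_⟩
    apply e.injective
    rw [e_liftI]; ext1 <;> simp [hxz]
  · rintro ⟨w, ⟨h1, h2⟩, rfl⟩
    rw [e_liftI]
    exact ⟨⟨_, h1, rfl⟩, h2⟩

theorem pr_simple (e : E ≃ₗ[ℝ] F × G) {μ : Set E → ℝ} (hμ : IsSimple μ) {Q : Set G}
    (hQ : CC Q) : IsSimple fun P => μ (pr e P Q) := by
  intro f c hf K hK h
  refine hμ ((f.comp (LinearMap.fst ℝ F G)).comp (e : E →ₗ[ℝ] F × G)) c ?_ _ (pr.cc e hK hQ) ?_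
  · intro h0
    apply hf
    ext x
    have := congrArg (fun g => g (e.symm (x, 0))) h0
    simpa using this
  · rintro z ⟨h1, -⟩
    simpa using h _ h1

theorem OS2.swap {e : E ≃ₗ[ℝ] F × G} (he : OS2 e) : OS2 (e.trans (LinearEquiv.prodComm ℝ F G)) := by
  intro x y
  rw [he]; simp [add_comm]

theorem pr_swap (e : E ≃ₗ[ℝ] F × G) (P : Set F) (Q : Set G) :
    pr (e.trans (LinearEquiv.prodComm ℝ F G)) Q P = pr e P Q := by
  ext z; simp [pr, and_comm]

end rot

theorem exists_matrix {n : ℕ} (h : En n ≃ₗᵢ[ℝ] En n) :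
    ∃ M ∈ Matrix.unitaryGroup (Fin n) ℝ, Matrix.toEuclideanLin M = (h.toLinearEquiv : En n →ₗ[ℝ] En n)
      ∧ M.det = idet h := by
  set M := Matrix.toEuclideanLin.symm (h.toLinearEquiv : En n →ₗ[ℝ] En n) with hM
  have hM' : Matrix.toEuclideanLin M = (h.toLinearEquiv : En n →ₗ[ℝ] En n) := by rw [hM]; simp
  have hent : ∀ i j, M i j = (h (EuclideanSpace.single j 1)) i := by
    intro i j
    have : h (EuclideanSpace.single j 1) = Matrix.toEuclideanLin M (EuclideanSpace.single j 1) := by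
      rw [hM']; rfl
    rw [this]
    simp [Matrix.toEuclideanLin_apply]
  refine ⟨M, ?_, hM', ?_⟩
  · rw [Matrix.mem_unitaryGroup_iff']
    ext i j
    rw [Matrix.mul_apply]
    have h1 := h.inner_map_map (EuclideanSpace.single j (1 : ℝ)) (EuclideanSpace.single i 1)
    rw [PiLp.inner_apply] at h1
    simp only [EuclideanSpace.inner_single_left, map_one, one_mul, RCLike.inner_apply, conj_trivial,
      PiLp.single_apply] at h1
    simp only [Matrix.star_apply, star_trivial, hent, Matrix.one_apply]
    rw [h1]
    simp only [eq_comm]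
  · rw [idet, ← hM', Matrix.toEuclideanLin_eq_toLin_orthonormal, LinearMap.det_toLin]

theorem exists_so {n : ℕ} (h : En n ≃ₗᵢ[ℝ] En n) (hd : idet h = 1) :
    ∃ g : SO n, ∀ x, soAct g x = h x := by
  obtain ⟨M, hM, h1, h2⟩ := exists_matrix h
  refine ⟨⟨⟨M, hM⟩, by change M.det = 1; rw [h2, hd]⟩, fun x => ?_⟩
  change Matrix.toEuclideanLin M x = _
  rw [h1]; rfl

theorem idet_sq {n : ℕ} (h : En n ≃ₗᵢ[ℝ] En n) : idet h = 1 ∨ idet h = -1 := by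
  obtain ⟨M, hM, h1, h2⟩ := exists_matrix h
  rw [← h2]
  have := Matrix.det_of_mem_unitary hM
  have h3 := (Unitary.mem_iff.1 this).1
  simp only [star_trivial] at h3
  exact mul_self_eq_one_iff.1 h3

/-- the isometry given by an element of `SO n` -/
theorem soAct_inner {n : ℕ} (g : SO n) (x y : En n) :
    inner ℝ (soAct g x) (soAct g y) = inner ℝ x y := by
  have h := Matrix.mem_unitaryGroup_iff'.1 (g : Matrix.unitaryGroup (Fin n) ℝ).2
  set M := ((g : Matrix.unitaryGroup (Fin n) ℝ) : Matrix (Fin n) (Fin n) ℝ)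
  rw [EuclideanSpace.inner_eq_star_dotProduct, EuclideanSpace.inner_eq_star_dotProduct]
  simp only [soAct, Matrix.ofLp_toEuclideanLin_apply, star_trivial]
  rw [Matrix.dotProduct_mulVec, ← Matrix.mulVec_transpose, Matrix.mulVec_mulVec]
  have h' : M.transpose * M = 1 := by simpa [Matrix.star_eq_conjTranspose] using h
  rw [h', Matrix.one_mulVec]

theorem soAct_mul {n : ℕ} (g h : SO n) (x : En n) : soAct (g * h) x = soAct g (soAct h x) := by
  simp [soAct, Matrix.toEuclideanLin_apply, Matrix.mulVec_mulVec]

theorem soAct_one {n : ℕ} (x : En n) : soAct (1 : SO n) x = x := by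
  simp [soAct, Matrix.toEuclideanLin_apply]

def soIso {n : ℕ} (g : SO n) : En n ≃ₗᵢ[ℝ] En n :=
  (LinearEquiv.ofLinear (soAct g) (soAct g⁻¹)
    (by ext1 x; simp only [LinearMap.comp_apply, LinearMap.id_apply]; rw [← soAct_mul, mul_inv_cancel, soAct_one])
    (by ext1 x; simp only [LinearMap.comp_apply, LinearMap.id_apply]; rw [← soAct_mul, inv_mul_cancel, soAct_one])).isometryOfInner
    (fun x y => soAct_inner g x y)

@[simp] theorem soIso_apply {n : ℕ} (g : SO n) (x : En n) : soIso g x = soAct g x := rfl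

theorem idet_soIso {n : ℕ} (g : SO n) : idet (soIso g) = 1 := by
  have : ((soIso g).toLinearEquiv : En n →ₗ[ℝ] En n) = soAct g := rfl
  rw [idet, this, soAct, Matrix.toEuclideanLin_eq_toLin_orthonormal, LinearMap.det_toLin]
  exact g.2

theorem IsRot.so {n : ℕ} {μ : Set (En n) → ℝ} (h : IsRot μ) (g : SO n) {K : Set (En n)} (hK : CC K) :
    μ (soAct g '' K) = μ K := h (soIso g) (idet_soIso g) K hK

theorem isRot_of_so {n : ℕ} {μ : Set (En n) → ℝ}
    (h : ∀ (g : SO n) K, CC K → μ (soAct g '' K) = μ K) : IsRot μ := by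
  intro g hg K hK
  obtain ⟨g', hg'⟩ := exists_so g hg
  rw [← h g' K hK]
  congr 1
  exact image_congr fun x _ => (hg' x).symm

set_option linter.unusedSectionVars false
set_option linter.deprecated false

/-! ### Cubes, hyperplanes and products -/

/-- the `j`-dimensional unit cube in `ℝⁿ` -/
def cube (n j : ℕ) : Set (En n) := {x | ∀ i, 0 ≤ x i ∧ x i ≤ if (i : ℕ) < j then 1 else 0}

theorem cube.cc (n j : ℕ) : CC (cube n j) := by
  constructor
  · have h1 : IsCompact (Set.pi univ fun i : Fin n => Icc (0 : ℝ) (if (i : ℕ) < j then 1 else 0)) :=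
      isCompact_univ_pi fun i => isCompact_Icc
    have h2 := h1.image (PiLp.continuous_toLp 2 (fun _ : Fin n => ℝ))
    have h3 : cube n j = WithLp.toLp 2 '' (Set.pi univ fun i : Fin n => Icc (0 : ℝ) (if (i : ℕ) < j then 1 else 0)) := ?_
    · rw [h3]; exact h2
    refine Set.ext fun x => ?_
    simp only [cube, mem_ofPred_eq, mem_image, mem_pi, mem_univ, true_imp_iff, mem_Icc]
    constructor
    · intro h; exact ⟨x.ofLp, h, rfl⟩
    · rintro ⟨y, h, rfl⟩; exact h
  · intro x hx y hy s t hs ht hst i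
    simp only [PiLp.add_apply, PiLp.smul_apply, smul_eq_mul]
    obtain ⟨h1, h2⟩ := hx i
    obtain ⟨h3, h4⟩ := hy i
    refine ⟨by positivity, ?_⟩
    set w : ℝ := if (i : ℕ) < j then 1 else 0
    have : w = s * w + t * w := by rw [← add_mul, hst, one_mul]
    rw [this]; gcongr

theorem cube.nonempty (n j : ℕ) : (cube n j).Nonempty :=
  ⟨0, fun i => by simp; split_ifs <;> norm_num⟩

def Uprop (n : ℕ) : Prop := ∀ φ : Set (En n) → ℝ, IsVal φ → IsRot φ →
  (∀ j ≤ n, φ (cube n j) = 0) → ∀ K, CC K → φ K = 0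

def Vprop (n : ℕ) : Prop := ∀ φ : Set (En n) → ℝ, IsVal φ → IsRot φ → IsSimple φ →
  φ (cube n n) = 0 → ∀ K, CC K → φ K = 0

theorem split0_os2 (n : ℕ) : OS2 (split0 n) := by
  intro x y
  rw [split0_osplit n]
  simp [mul_comm]

theorem pr_cube {n j : ℕ} (hj : j ≤ n) : pr (split0 n) (cube n j) {0} = cube (n + 1) j := by
  ext z
  simp only [pr, cube, mem_ofPred_eq, mem_singleton_iff, split0, LinearEquiv.coe_mk,
    LinearMap.coe_mk, AddHom.coe_mk]
  rw [Fin.forall_fin_succ', Fin.val_last, if_neg (by omega)]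
  simp only [Fin.val_castSucc]
  refine and_congr_right fun _ => ⟨fun h => by simp [h], fun h => le_antisymm h.2 h.1⟩

theorem split0_symm_inner {n : ℕ} (a : ℝ) (x : En (n + 1)) :
    inner ℝ ((split0 n).symm (0, a)) x = a * (split0 n x).2 := by
  rw [split0_osplit]; simp

theorem uprime {n : ℕ} (hU : Uprop n) {φ : Set (En (n + 1)) → ℝ} (hv : IsVal φ) (hr : IsRot φ)
    (h : ∀ j ≤ n, φ (cube (n + 1) j) = 0) : IsSimple φ := by
  have he := split0_os2 n
  have h0 : ∀ P, CC P → φ (pr (split0 n) P {0}) = 0 :=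
    hU (fun P => φ (pr (split0 n) P {0})) (pr_val he hv (CC.singleton 0) (singleton_nonempty 0))
      (pr_rot he hr (CC.singleton 0)) (fun j hj => by rw [pr_cube hj]; exact h j hj)
  intro f c hf K hK hfK
  set w := (InnerProductSpace.toDual ℝ (En (n + 1))).symm (LinearMap.toContinuousLinearMap f)
  have hw : ∀ x, f x = inner ℝ w x := by intro x; simp [w]
  have hw0 : w ≠ 0 := by
    intro h0; apply hf; ext x; rw [hw, h0]; simp
  set v := (split0 n).symm (0, ‖w‖) with hvdef
  have hvn : ‖w‖ = ‖v‖ := by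
    have := split0_osplit n v v
    rw [real_inner_self_eq_norm_sq, hvdef] at this
    simp only [LinearEquiv.apply_symm_apply, inner_zero_left, zero_add] at this
    rw [← sq] at this
    exact ((sq_eq_sq₀ (norm_nonneg _) (norm_nonneg _)).1 this).symm
  obtain ⟨g, hg, hgw⟩ := exists_rot_pm hvn hw0
  have hpos : 0 < ‖w‖ := norm_pos_iff.2 hw0
  obtain ⟨d, hd⟩ : ∃ d, ∀ x ∈ K, (split0 n (g x)).2 = d := by
    rcases hgw with hgw | hgw
    · refine ⟨c / ‖w‖, fun x hx => ?_⟩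
      have h1 := hfK x hx
      rw [hw, ← g.inner_map_map, hgw, hvdef, split0_symm_inner] at h1
      rw [← h1]; field_simp
    · refine ⟨-(c / ‖w‖), fun x hx => ?_⟩
      have h1 := hfK x hx
      rw [hw, ← g.inner_map_map, hgw, inner_neg_left, hvdef, split0_symm_inner] at h1
      rw [← h1]; field_simp
  rw [← hr g hg K hK, ← hv.trans ((split0 n).symm (0, -d)) _ (hK.isom g)]
  set L := (split0 n).symm (0, -d) +ᵥ g '' K with hL
  have hLcc : CC L := (hK.isom g).vadd _
  have hL0 : ∀ x ∈ L, (split0 n x).2 = 0 := by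
    rintro _ ⟨_, ⟨x, hx, rfl⟩, rfl⟩
    simp [hd x hx]
  have hL' : L = pr (split0 n)
      (((LinearMap.fst ℝ (En n) ℝ).comp (split0 n : En (n + 1) →ₗ[ℝ] En n × ℝ)) '' L) {0} := by
    ext x
    constructor
    · intro hx; exact ⟨⟨x, hx, rfl⟩, hL0 x hx⟩
    · rintro ⟨⟨y, hy, h1⟩, h2⟩
      have : y = x := by
        apply (split0 n).injective
        ext1
        · exact h1
        · rw [hL0 y hy]; exact (mem_singleton_iff.1 h2).symm
      exact this ▸ hy
  rw [hL']
  exact h0 _ (hLcc.image _)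

theorem U_succ {n : ℕ} (hU : Uprop n) (hV : Vprop (n + 1)) : Uprop (n + 1) := by
  intro φ hv hr h
  exact hV φ hv hr (uprime hU hv hr fun j hj => h j (by omega)) (h _ le_rfl)

theorem V_zero : Vprop 0 := by
  intro φ hv _ _ h K hK
  rcases K.eq_empty_or_nonempty with rfl | ⟨x, hx⟩
  · exact hv.empty
  · rw [← h]
    congr 1
    ext y
    rw [Subsingleton.elim y x]
    simp only [hx, true_iff]
    intro i; exact i.elim0

theorem U_zero : Uprop 0 := by
  intro φ hv _ h K hK
  rcases K.eq_empty_or_nonempty with rfl | ⟨x, hx⟩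
  · exact hv.empty
  · rw [← h 0 le_rfl]
    congr 1
    ext y
    rw [Subsingleton.elim y x]
    simp only [hx, true_iff]
    intro i; exact i.elim0

theorem cube_isom {n : ℕ} {φ : Set (En n) → ℝ} (hv : IsVal φ) (hr : IsRot φ) (i0 : Fin n)
    (h : En n ≃ₗᵢ[ℝ] En n) : φ (h '' cube n n) = φ (cube n n) := by
  rcases idet_sq h with hd | hd
  · exact hr h hd _ (cube.cc n n)
  · set v : En n := EuclideanSpace.single i0 1 with hvdef
    have hv0 : v ≠ 0 := by
      intro h0
      have := congrArg (fun x : En n => x i0) h0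
      simp [hvdef] at this
    have hvn : ‖v‖ = 1 := by simp [hvdef]
    set r := Submodule.reflection (ℝ ∙ v)ᗮ with hrdef
    have hrx : ∀ x, r x = x - (2 * x i0) • v := by
      intro x
      rw [hrdef, Submodule.reflection_orthogonal_apply, Submodule.reflection_singleton_apply, hvn]
      simp [hvdef, EuclideanSpace.inner_single_left, two_mul, add_smul]
      rw [two_smul]
    have hcomp : idet (r.trans h) = 1 := by
      rw [idet_trans, idet_reflection hv0, hd]; norm_num
    have h1 : h '' cube n n = (r.trans h) '' (r '' cube n n) := by
      rw [image_image]
      apply image_congr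
      intro x _
      simp only [LinearIsometryEquiv.trans_apply]
      rw [hrdef, Submodule.reflection_reflection]
    have h2 : r '' cube n n = (-v) +ᵥ cube n n := by
      have hvi : ∀ i, v i = if i = i0 then 1 else 0 := by
        intro i; simp [hvdef, PiLp.single_apply]
      ext y
      rw [mem_vadd_set_iff_neg_vadd_mem, neg_neg]
      have hmem : ∀ x, x ∈ cube n n ↔ ∀ i, 0 ≤ x i ∧ x i ≤ 1 := by
        intro x; simp [cube]
      constructor
      · rintro ⟨x, hx, rfl⟩
        rw [hmem] at hx ⊢
        intro i
        rw [hrx]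
        simp only [vadd_eq_add, PiLp.add_apply, PiLp.sub_apply, PiLp.smul_apply, smul_eq_mul, hvi]
        have := hx i
        by_cases hi : i = i0
        · subst hi; simp only [if_true]; constructor <;> linarith
        · simpa [hi] using this
      · intro hy
        refine ⟨r y, ?_, by rw [hrdef, Submodule.reflection_reflection]⟩
        rw [hmem] at hy ⊢
        intro i
        rw [hrx]
        have := hy i
        simp only [vadd_eq_add, PiLp.add_apply, PiLp.sub_apply, PiLp.smul_apply, smul_eq_mul,
          hvi] at this ⊢
        by_cases hi : i = i0
        · subst hi; simp only [if_true] at this ⊢; constructor <;> linarith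
        · simpa [hi] using this
    rw [h1, h2, hr _ hcomp _ ((cube.cc n n).vadd _), hv.trans _ _ (cube.cc n n)]

/-- standard splitting -/
def splitJK (j k : ℕ) : En (j + k) ≃ₗ[ℝ] En j × En k where
  toFun x := (WithLp.toLp 2 fun i => x (Fin.castAdd k i), WithLp.toLp 2 fun i => x (Fin.natAdd j i))
  invFun w := WithLp.toLp 2 (Fin.append (fun i => w.1 i) (fun i => w.2 i))
  map_add' x y := by ext <;> simp
  map_smul' c x := by ext <;> simp
  left_inv x := by
    ext i
    refine Fin.addCases (fun i => ?_) (fun i => ?_) i <;> simp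
  right_inv w := by
    ext <;> simp

theorem splitJK_os2 (j k : ℕ) : OS2 (splitJK j k) := by
  intro x y
  simp only [PiLp.inner_apply, splitJK, LinearEquiv.coe_mk, LinearMap.coe_mk, AddHom.coe_mk]
  rw [Fin.sum_univ_add]

theorem prod_zero {n j k : ℕ} (hnjk : n = j + k) (hj : 0 < j) (hVj : Vprop j) (hVk : Vprop k)
    {φ : Set (En n) → ℝ} (hv : IsVal φ) (hr : IsRot φ) (hs : IsSimple φ) (hc : φ (cube n n) = 0)
    (e : En n ≃ₗ[ℝ] En j × En k) (he : OS2 e) {P : Set (En j)} {Q : Set (En k)} (hP : CC P)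
    (hQ : CC Q) : φ (pr e P Q) = 0 := by
  subst hnjk
  rcases Q.eq_empty_or_nonempty with rfl | hQn
  · convert hv.empty
    ext; simp [pr]
  have h0 : φ (pr e (cube j j) (cube k k)) = 0 := by
    set h : En (j + k) ≃ₗᵢ[ℝ] En (j + k) := ((splitJK j k).trans e.symm).isometryOfInner (by
      intro x y
      rw [he, splitJK_os2 j k x y]; simp) with hh
    rw [← hc, ← cube_isom hv hr ⟨0, by omega⟩ h]
    congr 1
    have e1 : cube (j + k) (j + k) = pr (splitJK j k) (cube j j) (cube k k) := by
      ext z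
      simp only [pr, cube, mem_ofPred_eq, splitJK, LinearEquiv.coe_mk, LinearMap.coe_mk,
        AddHom.coe_mk, Fin.is_lt, if_true, Fin.forall_fin_add]
    rw [e1, pr_eq, pr_eq, image_image]
    apply image_congr
    intro x _
    simp [hh]
  have h1 : ∀ Q, CC Q → φ (pr e (cube j j) Q) = 0 := by
    intro Q hQ
    have := hVk (fun Q => φ (pr (e.trans (LinearEquiv.prodComm ℝ _ _)) Q (cube j j)))
      (pr_val he.swap hv (cube.cc j j) (cube.nonempty j j)) (pr_rot he.swap hr (cube.cc j j))
      (pr_simple _ hs (cube.cc j j)) (by rw [pr_swap]; exact h0) Q hQ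
    rwa [pr_swap] at this
  exact hVj (fun P => φ (pr e P Q)) (pr_val he hv hQ hQn) (pr_rot he hr hQ)
    (pr_simple _ hs hQ) (h1 Q hQ) P hP

theorem exists_proj_split {n : ℕ} (P : En n →ₗ[ℝ] En n) (h1 : ∀ x, P (P x) = P x)
    (h2 : ∀ x y, inner ℝ (P x) y = inner ℝ x (P y)) :
    ∃ (j k : ℕ) (e : En n ≃ₗ[ℝ] En j × En k), OS2 e ∧ ∀ z, (e (P z)).2 = 0 ∧
      (e (z - P z)).1 = 0 := by
  set A := LinearMap.range P with hA
  refine ⟨_, _, (Submodule.prodEquivOfIsCompl A Aᗮ A.isCompl_orthogonal_of_hasOrthogonalProjection).symm.trans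
    ((stdOrthonormalBasis ℝ A).repr.toLinearEquiv.prodCongr
      (stdOrthonormalBasis ℝ Aᗮ).repr.toLinearEquiv), ?_, ?_⟩
  · intro x y
    obtain ⟨a, rfl⟩ := (Submodule.prodEquivOfIsCompl A Aᗮ
      A.isCompl_orthogonal_of_hasOrthogonalProjection).surjective x
    obtain ⟨b, rfl⟩ := (Submodule.prodEquivOfIsCompl A Aᗮ
      A.isCompl_orthogonal_of_hasOrthogonalProjection).surjective y
    simp only [LinearEquiv.trans_apply, LinearEquiv.symm_apply_apply, LinearEquiv.prodCongr_apply,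
      LinearIsometryEquiv.coe_toLinearEquiv, LinearIsometryEquiv.inner_map_map]
    rw [Submodule.coe_prodEquivOfIsCompl', Submodule.coe_prodEquivOfIsCompl']
    rw [inner_add_left, inner_add_right, inner_add_right,
      Submodule.inner_right_of_mem_orthogonal a.1.2 b.2.2,
      Submodule.inner_left_of_mem_orthogonal b.1.2 a.2.2]
    simp
  · intro z
    have hz1 : P z ∈ A := ⟨z, rfl⟩
    have hz2 : z - P z ∈ Aᗮ := by
      rw [Submodule.mem_orthogonal]
      rintro _ ⟨y, rfl⟩
      rw [h2, map_sub, h1, sub_self, inner_zero_right]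
    simp only [LinearEquiv.trans_apply, LinearEquiv.prodCongr_apply]
    have e1 := Submodule.prodEquivOfIsCompl_symm_apply_left A Aᗮ
      A.isCompl_orthogonal_of_hasOrthogonalProjection ⟨P z, hz1⟩
    have e2 := Submodule.prodEquivOfIsCompl_symm_apply_right A Aᗮ
      A.isCompl_orthogonal_of_hasOrthogonalProjection ⟨z - P z, hz2⟩
    simp only at e1 e2
    rw [e1, e2]
    simp

theorem isQ_of {n : ℕ} (hV : ∀ j < n, Vprop j) {φ : Set (En n) → ℝ} (hv : IsVal φ) (hr : IsRot φ)
    (hs : IsSimple φ) (hc : φ (cube n n) = 0) {u : En n} (hu : u ≠ 0) : IsQ u φ := by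
  refine ⟨hv, hs, ?_⟩
  intro P h1 h2 h3 h4 K hK hmix
  obtain ⟨j, k, e, he, hez⟩ := exists_proj_split P h1 h2
  have hn : n = j + k := by
    have := e.finrank_eq
    simpa using this
  have hj : 0 < j := by
    rcases Nat.eq_zero_or_pos j with rfl | hj
    · exfalso; apply h3
      ext1 z
      apply e.injective
      ext1
      · exact Subsingleton.elim _ _
      · rw [(hez z).1]; simp
    · exact hj
  have hk : 0 < k := by
    rcases Nat.eq_zero_or_pos k with rfl | hk
    · exfalso; apply hu
      apply e.injective
      have := (hez u).2
      rw [h4, sub_zero] at this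
      ext1
      · rw [this]; simp
      · exact Subsingleton.elim _ _
    · exact hk
  have hK' : K = pr e (((LinearMap.fst ℝ (En j) (En k)).comp (e : En n →ₗ[ℝ] En j × En k)) '' K)
      (((LinearMap.snd ℝ (En j) (En k)).comp (e : En n →ₗ[ℝ] En j × En k)) '' K) := by
    ext z
    constructor
    · intro hz; exact ⟨⟨z, hz, rfl⟩, ⟨z, hz, rfl⟩⟩
    · rintro ⟨⟨x, hx, hxz⟩, ⟨y, hy, hyz⟩⟩
      have hxz' : (e x).1 = (e z).1 := hxz
      have hyz' : (e y).2 = (e z).2 := hyz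
      have : P x + (y - P y) = z := by
        apply e.injective
        rw [map_add]
        have a1 : (e (P x)).1 = (e x).1 := by
          have := (hez x).2
          rw [map_sub, Prod.fst_sub, sub_eq_zero] at this; exact this.symm
        have a2 : (e (y - P y)).2 = (e y).2 := by
          rw [map_sub, Prod.snd_sub, (hez y).1, sub_zero]
        ext1
        · rw [Prod.fst_add, a1, (hez y).2, add_zero, hxz']
        · rw [Prod.snd_add, a2, (hez x).1, zero_add, hyz']
      rw [← this]
      exact hmix x hx y hy
  rw [hK']
  exact prod_zero hn hj (hV j (by omega)) (hV k (by omega)) hv hr hs hc e he (hK.image _)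
    (hK.image _)

set_option linter.unusedSectionVars false
set_option linter.deprecated false

/-! ### Dimension one -/

theorem V_one : Vprop 1 := by
  intro φ hv hr hs hc K hK
  set f : ℝ → ℝ := fun t => φ (wedge (split0 0) univ 0 t) with hf
  have hu : CC (univ : Set (En 0)) := by
    have : (univ : Set (En 0)) = {0} := by ext x; simp [Subsingleton.elim x 0]
    rw [this]; exact CC.singleton 0
  have hadd : ∀ c d : ℝ, 0 ≤ c → 0 ≤ d → f (c + d) = f d + f c := by
    intro c d hc hd
    exact wedge_shift_cut hv hs (split0 0) hu 0 (by simpa using hc) hd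
  have h1 : f 1 = 0 := by
    rw [← hc]
    show φ (wedge (split0 0) univ 0 1) = φ (cube 1 1)
    congr 1
    ext z
    simp [wedge, cube, split0]
  have h0 : f 0 = 0 := by
    have := hadd 0 0 le_rfl le_rfl
    rw [add_zero] at this; linarith
  have hk : ∀ (k : ℕ) (t : ℝ), 0 ≤ t → f (k * t) = k * f t := by
    intro k t ht
    induction k with
    | zero => simp [h0]
    | succ k ih =>
      push_cast
      rw [add_mul, one_mul, hadd _ _ (by positivity) ht, ih]; ring
  have hq : ∀ (k m : ℕ), 0 < m → f (k * (1 / m)) = 0 := by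
    intro k m hm
    have hm' : (0 : ℝ) < m := by exact_mod_cast hm
    have h2 := hk m (1 / m) (by positivity)
    rw [mul_one_div_cancel hm'.ne', h1] at h2
    rw [hk _ _ (by positivity)]
    have : f (1 / m) = 0 := by
      rcases mul_eq_zero.1 h2.symm with h | h
      · exact absurd h hm'.ne'
      · exact h
    rw [this, mul_zero]
  have hz : ∀ c, 0 ≤ c → f c = 0 := by
    intro c hc0
    by_contra hne
    have hmem : ∀ t : ℝ, 0 ≤ t → (split0 0).symm (0, 0) ∈ wedge (split0 0) univ 0 t := by
      intro t ht
      simp [wedge, ht]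
    have hmem' : ∀ t s : ℝ, 0 ≤ s → s ≤ t → (split0 0).symm (0, s) ∈ wedge (split0 0) univ 0 t := by
      intro t s hs ht
      simp [wedge, ht, hs]
    obtain ⟨δ, hδ, hcl⟩ := hv.cont _ (wedge.cc (split0 0) hu 0 c) ⟨_, hmem c hc0⟩ |f c|
      (abs_pos.2 hne)
    obtain ⟨m, hm⟩ := exists_nat_one_div_lt hδ
    set M : ℕ := m + 1
    have hM : (0 : ℝ) < M := by positivity
    set k := ⌊c * M⌋₊
    have hk1 : (k : ℝ) ≤ c * M := Nat.floor_le (by positivity)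
    have hk2 : c * M < k + 1 := Nat.lt_floor_add_one _
    set d : ℝ := k * (1 / M)
    have hd0 : 0 ≤ d := by positivity
    have hd1 : d ≤ c := by
      simp only [d]; rw [mul_one_div, div_le_iff₀ hM]; exact hk1
    have hd2 : c ≤ d + 1 / M := by
      simp only [d]; rw [mul_one_div, ← add_div, le_div_iff₀ hM]; exact hk2.le
    have hM2 : (1 : ℝ) / M < δ := by simpa [M] using hm
    have := hcl (wedge (split0 0) univ 0 d) (wedge.cc (split0 0) hu 0 d) ⟨_, hmem d hd0⟩ ?_
    · have h3 : φ (wedge (split0 0) univ 0 d) = 0 := hq k M (Nat.succ_pos m)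
      rw [h3] at this
      simp [hf] at this
    · have hdist : ∀ x y : En 1, dist x y = |(split0 0 x).2 - (split0 0 y).2| := by
        intro x y
        rw [EuclideanSpace.dist_eq]
        simp [split0, Real.sqrt_sq_eq_abs, Real.dist_eq]
      constructor
      · intro x hx
        obtain ⟨-, hx1, hx2⟩ := hx
        simp only [LinearMap.zero_apply, zero_add] at hx2
        refine ⟨_, hmem' d (min (split0 0 x).2 d) (le_min hx1 hd0) (min_le_right _ _), ?_⟩
        rw [hdist]
        simp only [LinearEquiv.apply_symm_apply]
        rcases min_cases (split0 0 x).2 d with h | h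
        · rw [h.1]; simp [hδ.le]
        · rw [h.1, abs_of_nonneg (by linarith)]; linarith
      · intro x hx
        obtain ⟨-, hx1, hx2⟩ := hx
        simp only [LinearMap.zero_apply, zero_add] at hx2
        refine ⟨x, ⟨mem_univ _, hx1, ?_⟩, by simp [hδ.le]⟩
        simp only [LinearMap.zero_apply, zero_add]; linarith
  refine fiber_reduction (split0 0) hv hs ?_ K hK
  intro C ℓ c hC hcc
  rcases C.eq_empty_or_nonempty with rfl | ⟨x, hx⟩
  · have : wedge (split0 0) (∅ : Set (En 0)) ℓ c = ∅ := by ext z; simp [wedge]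
    rw [this]; exact hv.empty
  · have hC' : C = univ := by
      ext y; simp [Subsingleton.elim y x, hx]
    have hl : ℓ = 0 := by ext y; simp [Subsingleton.elim y 0]
    subst hC' hl
    exact hz c (by simpa using hcc x hx)

set_option linter.unusedSectionVars false
set_option linter.deprecated false

/-! ### Averaging over the rotation group -/

instance matrixBorel (n : ℕ) : BorelSpace (Matrix (Fin n) (Fin n) ℝ) :=
  inferInstanceAs (BorelSpace (Fin n → Fin n → ℝ))

instance soBorel (n : ℕ) : BorelSpace (SO n) := by
  have h1 : BorelSpace (Matrix.unitaryGroup (Fin n) ℝ) := Subtype.borelSpace _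
  exact Subtype.borelSpace _

theorem so_coe_continuous (n : ℕ) : Continuous
    (fun g : SO n => ((g : Matrix.unitaryGroup (Fin n) ℝ) : Matrix (Fin n) (Fin n) ℝ)) :=
  continuous_subtype_val.comp continuous_subtype_val

theorem soAct_continuous₂ (n : ℕ) : Continuous (fun p : SO n × En n => soAct p.1 p.2) := by
  simp only [soAct, Matrix.toEuclideanLin_apply]
  apply (PiLp.continuous_toLp 2 (fun _ : Fin n => ℝ)).comp
  exact ((so_coe_continuous n).comp continuous_fst).matrix_mulVec
    ((PiLp.continuous_ofLp 2 (fun _ : Fin n => ℝ)).comp continuous_snd)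

theorem soAct_continuous (n : ℕ) (x : En n) : Continuous (fun g : SO n => soAct g x) :=
  (soAct_continuous₂ n).comp (Continuous.prodMk continuous_id continuous_const)

instance soCompact (n : ℕ) : CompactSpace (SO n) := by
  have hT : IsCompact (Set.pi univ fun _ : Fin n => Set.pi univ fun _ : Fin n => Icc (-1 : ℝ) 1) :=
    isCompact_univ_pi fun _ => isCompact_univ_pi fun _ => isCompact_Icc
  have hcl : IsClosed {M : Matrix (Fin n) (Fin n) ℝ | M * star M = 1 ∧ M.det = 1} := by
    have h1 : IsClosed {M : Matrix (Fin n) (Fin n) ℝ | M * star M = 1} :=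
      isClosed_eq (continuous_id.mul (continuous_id.matrix_conjTranspose)) continuous_const
    have h2 : IsClosed {M : Matrix (Fin n) (Fin n) ℝ | M.det = 1} :=
      isClosed_eq continuous_id.matrix_det continuous_const
    exact h1.inter h2
  have hE : Topology.IsEmbedding
      (fun g : SO n => ((g : Matrix.unitaryGroup (Fin n) ℝ) : Matrix (Fin n) (Fin n) ℝ)) :=
    Topology.IsEmbedding.subtypeVal.comp Topology.IsEmbedding.subtypeVal
  rw [← isCompact_univ_iff, hE.isCompact_iff]
  have hc2 : IsCompact ({M : Matrix (Fin n) (Fin n) ℝ | M * star M = 1 ∧ M.det = 1} ∩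
      (Set.pi univ fun _ : Fin n => Set.pi univ fun _ : Fin n => Icc (-1 : ℝ) 1)) :=
    hT.inter_left hcl
  convert hc2 using 1
  ext M
  constructor
  · rintro ⟨g, -, rfl⟩
    have hu := (g : Matrix.unitaryGroup (Fin n) ℝ).2
    refine ⟨⟨Matrix.mem_unitaryGroup_iff.1 hu, g.2⟩, fun i _ j _ => ?_⟩
    have := entry_norm_bound_of_unitary hu i j
    rw [Real.norm_eq_abs, abs_le] at this
    exact this
  · rintro ⟨⟨h1, h2⟩, -⟩
    exact ⟨⟨⟨M, Matrix.mem_unitaryGroup_iff.2 h1⟩, h2⟩, mem_univ _, rfl⟩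

theorem exists_haar {G : Type*} [Group G] [TopologicalSpace G] [IsTopologicalGroup G]
    [CompactSpace G] [MeasurableSpace G] [BorelSpace G] :
    ∃ ν : Measure G, IsProbabilityMeasure ν ∧ ν.IsOpenPosMeasure ∧
      (∀ (f : G → ℝ) (g : G), ∫ x, f (g * x) ∂ν = ∫ x, f x ∂ν) ∧
      (∀ (f : G → ℝ) (g : G), ∫ x, f (x * g) ∂ν = ∫ x, f x ∂ν) ∧
      (∀ (f : G → ℝ), ∫ x, f x⁻¹ ∂ν = ∫ x, f x ∂ν) := by
  let K0 : TopologicalSpace.PositiveCompacts G := ⊤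
  let ν : Measure G := Measure.haarMeasure K0
  have hprob : IsProbabilityMeasure ν := ⟨by
    have := Measure.haarMeasure_self (K₀ := K0)
    simpa [K0] using this⟩
  have hreg : ν.Regular := inferInstance
  have hright : ∀ g : G, Measure.map (· * g) ν = ν := by
    intro g
    have h1 : IsProbabilityMeasure (Measure.map (· * g) ν) :=
      Measure.isProbabilityMeasure_map (measurable_mul_const g).aemeasurable
    exact Measure.isHaarMeasure_eq_of_isProbabilityMeasure _ _
  have hri : ν.IsMulRightInvariant := ⟨hright⟩
  have hmi : MeasurableInv G := inferInstance
  have hinv : Measure.map (fun x => x⁻¹) ν = ν := by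
    have h1 : IsProbabilityMeasure (Measure.map (fun x => x⁻¹) ν) :=
      Measure.isProbabilityMeasure_map measurable_inv.aemeasurable
    have h2 : (Measure.map (fun x => x⁻¹) ν).IsMulLeftInvariant := by
      constructor
      intro g
      rw [Measure.map_map (measurable_const_mul g) measurable_inv]
      have : ((fun x => g * x) ∘ fun x : G => x⁻¹) = (fun x => x⁻¹) ∘ (fun x => x * g⁻¹) := by
        ext x; simp
      rw [this, ← Measure.map_map measurable_inv (measurable_mul_const _), hright]
    have h3 := Measure.isMulInvariant_eq_smul_of_compactSpace (Measure.map (fun x => x⁻¹) ν) ν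
    have h4 := congrArg (fun m : Measure G => m univ) h3
    simp only [Measure.smul_apply, measure_univ] at h4
    rw [h3]
    have h5 : (Measure.map (fun x => x⁻¹) ν).haarScalarFactor ν = 1 := by
      rw [ENNReal.smul_def, smul_eq_mul, mul_one] at h4
      exact_mod_cast h4.symm
    rw [h5, one_smul]
  have hii : ν.IsInvInvariant := ⟨hinv⟩
  exact ⟨ν, hprob, inferInstance, fun f g => integral_mul_left_eq_self f g,
    fun f g => integral_mul_right_eq_self f g, fun f => integral_inv_eq_self f ν⟩

structure IsAvg {G : Type*} [Group G] [TopologicalSpace G] [MeasurableSpace G]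
    (ν : Measure G) : Prop where
  prob : IsProbabilityMeasure ν
  pos : ν.IsOpenPosMeasure
  left : ∀ (f : G → ℝ) (g : G), ∫ x, f (g * x) ∂ν = ∫ x, f x ∂ν
  right : ∀ (f : G → ℝ) (g : G), ∫ x, f (x * g) ∂ν = ∫ x, f x ∂ν
  inv : ∀ (f : G → ℝ), ∫ x, f x⁻¹ ∂ν = ∫ x, f x ∂ν

theorem exists_avg (n : ℕ) : ∃ ν : Measure (SO n), IsAvg ν := by
  obtain ⟨ν, h1, h2, h3, h4, h5⟩ := exists_haar (G := SO n)
  exact ⟨ν, h1, h2, h3, h4, h5⟩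

theorem so_integrable {n : ℕ} {ν : Measure (SO n)} (hν : IsAvg ν) {f : SO n → ℝ}
    (hf : Continuous f) : Integrable f ν := by
  have := hν.prob
  exact hf.integrable_of_hasCompactSupport (HasCompactSupport.of_compactSpace f)

/-- uniform closeness of rotated copies -/
theorem so_close {n : ℕ} {L : Set (En n)} (hL : IsCompact L) (g : SO n) {δ : ℝ} (hδ : 0 < δ) :
    ∀ᶠ g' in nhds g, Close δ (soAct g '' L) ((soAct g') '' L) := by
  have hc := (soAct_continuous₂ n)
  have h1 : ∀ x ∈ L, ∀ᶠ p : SO n × En n in nhds g ×ˢ nhds x,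
      dist (soAct g p.2) (soAct p.1 p.2) < δ := by
    intro x _
    have h2 : Continuous fun p : SO n × En n => dist (soAct g p.2) (soAct p.1 p.2) := by
      refine Continuous.dist ?_ hc
      exact hc.comp (Continuous.prodMk continuous_const continuous_snd)
    rw [← nhds_prod_eq]
    apply h2.continuousAt.eventually_lt continuousAt_const
    simpa using hδ
  have h2 : ∀ᶠ g' in nhds g, ∀ x ∈ L, dist (soAct g x) (soAct g' x) < δ :=
    hL.eventually_forall_of_forall_eventually (fun x hx => by
      have := h1 x hx
      rw [← nhds_prod_eq] at this
      exact this)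
  filter_upwards [h2] with g' hg'
  constructor
  · rintro _ ⟨x, hx, rfl⟩
    exact ⟨_, ⟨x, hx, rfl⟩, (hg' x hx).le⟩
  · rintro _ ⟨x, hx, rfl⟩
    exact ⟨_, ⟨x, hx, rfl⟩, (hg' x hx).le⟩

set_option linter.unusedSectionVars false
set_option linter.deprecated false

/-! ### Averaged Minkowski additivity -/

theorem so_inv_image {n : ℕ} (g : SO n) (L : Set (En n)) : soAct g⁻¹ '' (soAct g '' L) = L := by
  rw [image_image]
  have : (fun x => soAct g⁻¹ (soAct g x)) = id := by
    ext1 x; rw [← soAct_mul, inv_mul_cancel, soAct_one]; rfl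
  rw [this, image_id]

theorem avg_near {n : ℕ} {ψ : Set (En n) → ℝ} (hv : IsVal ψ) {K L : Set (En n)} (hK : CC K)
    (hKn : K.Nonempty) (hL : CC L) (hLn : L.Nonempty) (g : SO n) {ε : ℝ} (hε : 0 < ε) :
    ∃ δ > 0, ∀ᶠ g' in nhds g, ∀ K', CC K' → K'.Nonempty → Close δ K K' →
      |ψ (K' + (soAct g') '' L) - ψ (K + soAct g '' L)| < ε := by
  obtain ⟨δ, hδ, h⟩ := hv.cont _ (hK.add (hL.image (soAct g))) (hKn.add (hLn.image _)) ε hε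
  refine ⟨δ / 2, by positivity, ?_⟩
  filter_upwards [so_close hL.cpt g (half_pos hδ)] with g' hg' K' hK' hKn' hc
  apply h _ (hK'.add (hL.image (soAct g'))) (hKn'.add (hLn.image _))
  have := hc.add hg'
  rwa [add_halves] at this

theorem avg_continuous {n : ℕ} {ψ : Set (En n) → ℝ} (hv : IsVal ψ) {K L : Set (En n)} (hK : CC K)
    (hL : CC L) : Continuous fun g : SO n => ψ (K + soAct g '' L) := by
  rcases K.eq_empty_or_nonempty with rfl | hKn
  · simp only [empty_add]; exact continuous_const
  rcases L.eq_empty_or_nonempty with rfl | hLn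
  · simp only [image_empty, add_empty]; exact continuous_const
  rw [continuous_iff_continuousAt]
  intro g
  rw [ContinuousAt, Metric.tendsto_nhds]
  intro ε hε
  obtain ⟨δ, hδ, h⟩ := avg_near hv hK hKn hL hLn g hε
  filter_upwards [h] with g' hg'
  rw [Real.dist_eq]
  exact hg' K hK hKn (Close.refl hδ.le K)

theorem avg_unif {n : ℕ} {ψ : Set (En n) → ℝ} (hv : IsVal ψ) {K L : Set (En n)} (hK : CC K)
    (hKn : K.Nonempty) (hL : CC L) (hLn : L.Nonempty) {ε : ℝ} (hε : 0 < ε) :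
    ∃ δ > 0, ∀ K', CC K' → K'.Nonempty → Close δ K K' → ∀ g : SO n,
      |ψ (K' + soAct g '' L) - ψ (K + soAct g '' L)| < ε := by
  have := (isCompact_univ (X := SO n)).induction_on
    (p := fun s => ∃ δ > 0, ∀ K', CC K' → K'.Nonempty → Close δ K K' → ∀ g ∈ s,
      |ψ (K' + soAct g '' L) - ψ (K + soAct g '' L)| < ε) ⟨1, one_pos, by simp⟩ ?_ ?_ ?_
  · obtain ⟨δ, hδ, h⟩ := this
    exact ⟨δ, hδ, fun K' h1 h2 h3 g => h K' h1 h2 h3 g (mem_univ g)⟩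
  · rintro s t hst ⟨δ, hδ, h⟩
    exact ⟨δ, hδ, fun K' h1 h2 h3 g hg => h K' h1 h2 h3 g (hst hg)⟩
  · rintro s t ⟨δ, hδ, h⟩ ⟨δ', hδ', h'⟩
    refine ⟨min δ δ', lt_min hδ hδ', fun K' h1 h2 h3 g hg => ?_⟩
    rcases hg with hg | hg
    · exact h K' h1 h2 (h3.mono (min_le_left _ _)) g hg
    · exact h' K' h1 h2 (h3.mono (min_le_right _ _)) g hg
  · intro g _
    obtain ⟨δ, hδ, h⟩ := avg_near hv hK hKn hL hLn g (half_pos hε)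
    refine ⟨{g' | ∀ K', CC K' → K'.Nonempty → Close δ K K' →
      |ψ (K' + (soAct g') '' L) - ψ (K + soAct g '' L)| < ε / 2}, mem_nhdsWithin_of_mem_nhds h,
      δ, hδ, ?_⟩
    intro K' h1 h2 h3 g' hg'
    have a := hg' K' h1 h2 h3
    have b := hg' K hK hKn (Close.refl hδ.le K)
    rw [abs_lt] at *
    constructor <;> linarith [a.1, a.2, b.1, b.2]

def avg {n : ℕ} (ν : Measure (SO n)) (ψ : Set (En n) → ℝ) (L K : Set (En n)) : ℝ :=
  ∫ g, ψ (K + soAct g '' L) ∂ν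

theorem avg_val {n : ℕ} {ν : Measure (SO n)} (hν : IsAvg ν) {ψ : Set (En n) → ℝ} (hv : IsVal ψ)
    {L : Set (En n)} (hL : CC L) (hLn : L.Nonempty) : IsVal (avg ν ψ L) where
  empty := by simp [avg, hv.empty]
  union K M hK hM hU hI := by
    have hUc : CC (K ∪ M) := ⟨hK.cpt.union hM.cpt, hU⟩
    simp only [avg]
    rw [← integral_add (so_integrable hν (avg_continuous hv hUc hL))
      (so_integrable hν (avg_continuous hv (hK.inter hM) hL)),
      ← integral_add (so_integrable hν (avg_continuous hv hK hL))
      (so_integrable hν (avg_continuous hv hM hL))]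
    congr 1
    ext1 g
    exact (hv.comp_add (hL.image (soAct g)) (hLn.image _)).union K M hK hM hU hI
  cont K hK hKn ε hε := by
    have := hν.prob
    obtain ⟨δ, hδ, h⟩ := avg_unif hv hK hKn hL hLn (half_pos hε)
    refine ⟨δ, hδ, fun M hM hMn hc => ?_⟩
    simp only [avg]
    rw [← integral_sub (so_integrable hν (avg_continuous hv hM hL))
      (so_integrable hν (avg_continuous hv hK hL))]
    have h2 := norm_integral_le_of_norm_le_const (μ := ν)
      (f := fun g => ψ (M + soAct g '' L) - ψ (K + soAct g '' L)) (C := ε / 2)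
      (Filter.Eventually.of_forall fun g => (h M hM hMn hc g).le)
    rw [Real.norm_eq_abs] at h2
    simp only [measureReal_def, measure_univ, ENNReal.toReal_one, mul_one] at h2
    linarith
  trans x K hK := by
    simp only [avg]
    congr 1
    ext1 g
    exact (hv.comp_add (hL.image (soAct g)) (hLn.image _)).trans x K hK

theorem avg_rot {n : ℕ} {ν : Measure (SO n)} (hν : IsAvg ν) {ψ : Set (En n) → ℝ}
    (hr : IsRot ψ) {L : Set (En n)} (hL : CC L) : IsRot (avg ν ψ L) := by
  apply isRot_of_so
  intro h K hK
  simp only [avg]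
  rw [← hν.left (fun g => ψ (soAct h '' K + soAct g '' L)) h]
  congr 1
  ext1 g
  rw [← hr.so h (hK.add (hL.image (soAct g))), Set.image_add, image_image]
  congr 3
  ext1 x
  rw [soAct_mul]

theorem avg_symm {n : ℕ} {ν : Measure (SO n)} (hν : IsAvg ν) {ψ : Set (En n) → ℝ}
    (hr : IsRot ψ) {K L : Set (En n)} (hK : CC K) (hL : CC L) : avg ν ψ L K = avg ν ψ K L := by
  simp only [avg]
  rw [← hν.inv (fun g => ψ (K + soAct g '' L))]
  congr 1
  ext1 g
  rw [← hr.so g (hK.add (hL.image _)), Set.image_add, add_comm]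
  congr 2
  have := so_inv_image g⁻¹ L
  rwa [inv_inv] at this

open Classical in
/-- Euler characteristic -/
def chi {n : ℕ} (K : Set (En n)) : ℝ := if K.Nonempty then 1 else 0

theorem chi_of_nonempty {n : ℕ} {K : Set (En n)} (h : K.Nonempty) : chi K = 1 := if_pos h

theorem chi_val {n : ℕ} : IsVal (chi (n := n)) where
  empty := by simp [chi]
  union K L hK hL hU hI := by
    rw [chi_of_nonempty hI, chi_of_nonempty (hI.mono inter_subset_left),
      chi_of_nonempty (hI.mono inter_subset_right),
      chi_of_nonempty (hI.mono (inter_subset_left.trans subset_union_left))]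
  cont K hK hn ε hε := ⟨1, one_pos, fun L _ hLn _ => by
    rw [chi_of_nonempty hn, chi_of_nonempty hLn]; simpa⟩
  trans x K hK := by
    rcases K.eq_empty_or_nonempty with rfl | h
    · simp
    · rw [chi_of_nonempty h, chi_of_nonempty h.vadd_set]

theorem chi_rot {n : ℕ} : IsRot (chi (n := n)) := by
  intro g hg K hK
  rcases K.eq_empty_or_nonempty with rfl | h
  · simp
  · rw [chi_of_nonempty h, chi_of_nonempty (h.image _)]

def DD {n : ℕ} (ν : Measure (SO n)) (ψ : Set (En n) → ℝ) (L K : Set (En n)) : ℝ :=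
  avg ν ψ L K - ψ K - ψ L * chi K

theorem DD_val {n : ℕ} {ν : Measure (SO n)} (hν : IsAvg ν) {ψ : Set (En n) → ℝ} (hv : IsVal ψ)
    {L : Set (En n)} (hL : CC L) (hLn : L.Nonempty) : IsVal (DD ν ψ L) :=
  ((avg_val hν hv hL hLn).sub hv).sub (chi_val.const_mul _)

theorem DD_rot {n : ℕ} {ν : Measure (SO n)} (hν : IsAvg ν) {ψ : Set (En n) → ℝ}
    (hr : IsRot ψ) {L : Set (En n)} (hL : CC L) : IsRot (DD ν ψ L) := by
  intro g hg K hK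
  simp only [DD]
  rw [avg_rot hν hr hL g hg K hK, hr g hg K hK, chi_rot g hg K hK]

theorem cube_zero (n : ℕ) : cube n 0 = {0} := by
  ext x
  simp only [cube, mem_ofPred_eq, mem_singleton_iff, Nat.not_lt_zero, if_false]
  constructor
  · intro h; ext i; exact le_antisymm (h i).2 (h i).1
  · rintro rfl i; simp

theorem cube_succ {n j : ℕ} (hj : j < n) :
    cube n (j + 1) = cube n j + segment ℝ 0 ((1 : ℝ) • EuclideanSpace.single (⟨j, hj⟩ : Fin n) (1 : ℝ)) := by
  ext x
  rw [segment_eq_image]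
  simp only [smul_zero, zero_add, one_smul]
  constructor
  · intro hx
    refine ⟨x - x ⟨j, hj⟩ • EuclideanSpace.single (⟨j, hj⟩ : Fin n) (1 : ℝ), ?_, _,
      ⟨x ⟨j, hj⟩, ?_, rfl⟩, by simp⟩
    · intro i
      have := hx i
      by_cases hi : i = ⟨j, hj⟩
      · subst hi; simp
      · have h1 : (i : ℕ) ≠ j := fun h => hi (Fin.ext h)
        have h2 : ((i : ℕ) < j + 1) ↔ (i : ℕ) < j := by omega
        simp only [h2] at this
        simpa [hi] using this
    · have := hx ⟨j, hj⟩
      simpa using this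
  · rintro ⟨y, hy, _, ⟨t, ht, rfl⟩, rfl⟩ i
    have := hy i
    by_cases hi : i = ⟨j, hj⟩
    · subst hi
      simp only [lt_irrefl, if_false] at this
      have h0 : y ⟨j, hj⟩ = 0 := le_antisymm this.2 this.1
      simpa [h0] using ht
    · have h1 : (i : ℕ) ≠ j := fun h => hi (Fin.ext h)
      have h2 : ((i : ℕ) < j + 1) ↔ (i : ℕ) < j := by omega
      simp only [h2]
      simpa [hi] using this

theorem IsSimple.point {m : ℕ} {ψ : Set (En (m + 1)) → ℝ} (hs : IsSimple ψ) (x : En (m + 1)) :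
    ψ {x} = 0 := by
  refine hs ((innerₛₗ ℝ) (EuclideanSpace.single (0 : Fin (m + 1)) (1 : ℝ)))
    (inner ℝ (EuclideanSpace.single (0 : Fin (m + 1)) (1 : ℝ)) x) ?_ {x} (CC.singleton x) ?_
  · intro h
    have := congrArg (fun f => f (EuclideanSpace.single (0 : Fin (m + 1)) (1 : ℝ))) h
    simp at this
  · rintro y rfl; simp

structure Good (m : ℕ) (ψ : Set (En (m + 2)) → ℝ) : Prop where
  val : IsVal ψ
  rot : IsRot ψ
  simp : IsSimple ψ
  cub : ψ (cube (m + 2) (m + 2)) = 0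

theorem single_ne {m : ℕ} (i : Fin m) : EuclideanSpace.single i (1 : ℝ) ≠ 0 := by
  intro h
  have := congrArg norm h
  simp at this

theorem Good.dbl {m : ℕ} (hV : ∀ j < m + 2, Vprop j) {ψ : Set (En (m + 2)) → ℝ} (h : Good m ψ)
    {K : Set (En (m + 2))} (hK : CC K) : ψ ((2 : ℝ) • K) = 2 * ψ K :=
  lemmaH (m + 1) (EuclideanSpace.single 0 1) (by simp) ψ
    (isQ_of hV h.val h.rot h.simp h.cub (single_ne 0)) K hK

theorem Good.seg {m : ℕ} (hV : ∀ j < m + 2, Vprop j) {ψ : Set (En (m + 2)) → ℝ} (h : Good m ψ)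
    {K : Set (En (m + 2))} (hK : CC K) {t : ℝ} (ht : 0 ≤ t) {u : En (m + 2)} (hu : ‖u‖ = 1) :
    ψ (K + segment ℝ 0 (t • u)) = ψ K := by
  refine seg_lemma u hu ψ (isQ_of hV h.val h.rot h.simp h.cub ?_) ht K hK
  intro h0; rw [h0] at hu; simp at hu

theorem Good.cube_add {m : ℕ} (hV : ∀ j < m + 2, Vprop j) {ψ : Set (En (m + 2)) → ℝ} (h : Good m ψ)
    {K : Set (En (m + 2))} (hK : CC K) : ∀ j ≤ m + 2, ψ (cube (m + 2) j + K) = ψ K := by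
  intro j
  induction j with
  | zero => intro _; rw [cube_zero]; simp
  | succ j ih =>
    intro hj
    rw [cube_succ (by omega), add_right_comm, h.seg hV ((cube.cc _ _).add hK) zero_le_one (by simp),
      ih (by omega)]

theorem Good.DD {m : ℕ} (hV : ∀ j < m + 2, Vprop j) (hU : Uprop (m + 1))
    {ψ : Set (En (m + 2)) → ℝ} (h : Good m ψ) {ν : Measure (SO (m + 2))} (hν : IsAvg ν)
    {L : Set (En (m + 2))} (hL : CC L) (hLn : L.Nonempty) : Good m (DD ν ψ L) := by
  have := hν.prob
  have hc : ∀ j ≤ m + 2, _root_.DD ν ψ L (cube (m + 2) j) = 0 := by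
    intro j hj
    simp only [_root_.DD, avg]
    have h1 : ψ (cube (m + 2) j) = 0 := by
      have := h.cube_add hV (CC.singleton 0) j hj
      rw [h.simp.point, singleton_zero, add_zero] at this
      exact this
    have h2 : ∀ g : SO (m + 2), ψ (cube (m + 2) j + soAct g '' L) = ψ L := by
      intro g
      rw [h.cube_add hV (hL.image _) j hj, h.rot.so g hL]
    simp only [h2, h1, chi_of_nonempty (cube.nonempty _ _)]
    simp
  have h1 := DD_val hν h.val hL hLn
  have h2 := DD_rot hν h.rot hL
  exact ⟨h1, h2, uprime hU h1 h2 fun j hj => hc j (by omega), hc _ le_rfl⟩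

theorem Good.mean {m : ℕ} (hV : ∀ j < m + 2, Vprop j) (hU : Uprop (m + 1))
    {ψ : Set (En (m + 2)) → ℝ} (h : Good m ψ) {ν : Measure (SO (m + 2))} (hν : IsAvg ν)
    {K L : Set (En (m + 2))} (hK : CC K) (hKn : K.Nonempty) (hL : CC L) (hLn : L.Nonempty) :
    avg ν ψ L K = ψ K + ψ L := by
  have hsymm : ∀ {K L : Set (En (m + 2))}, CC K → K.Nonempty → CC L → L.Nonempty →
      _root_.DD ν ψ L K = _root_.DD ν ψ K L := by
    intro K L hK hKn hL hLn
    simp only [_root_.DD]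
    rw [avg_symm hν h.rot hK hL, chi_of_nonempty hKn, chi_of_nonempty hLn]; ring
  have h2K := hK.smul 2
  have h2L := hL.smul 2
  have h2Kn : ((2 : ℝ) • K).Nonempty := hKn.smul_set
  have h2Ln : ((2 : ℝ) • L).Nonempty := hLn.smul_set
  have e1 : _root_.DD ν ψ ((2 : ℝ) • L) ((2 : ℝ) • K) = 2 * _root_.DD ν ψ ((2 : ℝ) • L) K :=
    (h.DD hV hU hν h2L h2Ln).dbl hV hK
  have e2 : _root_.DD ν ψ ((2 : ℝ) • L) K = 2 * _root_.DD ν ψ L K := by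
    rw [hsymm hK hKn h2L h2Ln, (h.DD hV hU hν hK hKn).dbl hV hL, hsymm hL hLn hK hKn]
  have e3 : _root_.DD ν ψ ((2 : ℝ) • L) ((2 : ℝ) • K) = 2 * _root_.DD ν ψ L K := by
    simp only [_root_.DD]
    rw [h.dbl hV hK, h.dbl hV hL, chi_of_nonempty hKn, chi_of_nonempty h2Kn]
    have : avg ν ψ ((2 : ℝ) • L) ((2 : ℝ) • K) = 2 * avg ν ψ L K := by
      simp only [avg]
      rw [← integral_const_mul]
      congr 1
      ext1 g
      rw [← h.dbl hV (hK.add (hL.image _)), smul_add, image_smul_set]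
    rw [this]; ring
  have e4 : _root_.DD ν ψ L K = 0 := by linarith
  simp only [_root_.DD] at e4
  rw [chi_of_nonempty hKn] at e4
  linarith

set_option linter.unusedSectionVars false
set_option linter.deprecated false

/-! ### Support functions -/

section support
variable {E : Type*} [NormedAddCommGroup E] [InnerProductSpace ℝ E]

/-- support function -/
def hS (K : Set E) (u : E) : ℝ := sSup ((fun x => inner ℝ u x) '' K)

theorem hS_greatest {K : Set E} (hK : IsCompact K) (hn : K.Nonempty) (u : E) :
    IsGreatest ((fun x => inner ℝ u x) '' K) (hS K u) :=
  (hK.image (continuous_const.inner continuous_id)).isGreatest_sSup (hn.image _)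

theorem hS_le {K : Set E} (hK : IsCompact K) (hn : K.Nonempty) (u : E) {x : E} (hx : x ∈ K) :
    inner ℝ u x ≤ hS K u := (hS_greatest hK hn u).2 ⟨x, hx, rfl⟩

theorem hS_attained {K : Set E} (hK : IsCompact K) (hn : K.Nonempty) (u : E) :
    ∃ x ∈ K, inner ℝ u x = hS K u := (hS_greatest hK hn u).1

theorem hS_le_of {K : Set E} (hK : IsCompact K) (hn : K.Nonempty) {u : E} {c : ℝ}
    (h : ∀ x ∈ K, inner ℝ u x ≤ c) : hS K u ≤ c := by
  obtain ⟨x, hx, h1⟩ := hS_attained hK hn u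
  rw [← h1]; exact h x hx

theorem hS_add {K L : Set E} (hK : IsCompact K) (hn : K.Nonempty) (hL : IsCompact L)
    (hLn : L.Nonempty) (u : E) : hS (K + L) u = hS K u + hS L u := by
  apply le_antisymm
  · apply hS_le_of (hK.add hL) (hn.add hLn)
    rintro _ ⟨x, hx, y, hy, rfl⟩
    rw [inner_add_right]
    exact add_le_add (hS_le hK hn u hx) (hS_le hL hLn u hy)
  · obtain ⟨x, hx, h1⟩ := hS_attained hK hn u
    obtain ⟨y, hy, h2⟩ := hS_attained hL hLn u
    rw [← h1, ← h2, ← inner_add_right]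
    exact hS_le (hK.add hL) (hn.add hLn) u ⟨x, hx, y, hy, rfl⟩

theorem hS_smul {K : Set E} (hK : IsCompact K) (hn : K.Nonempty) {c : ℝ} (hc : 0 ≤ c) (u : E) :
    hS (c • K) u = c * hS K u := by
  apply le_antisymm
  · apply hS_le_of (hK.smul c) hn.smul_set
    rintro _ ⟨x, hx, rfl⟩
    simp only [inner_smul_right]
    exact mul_le_mul_of_nonneg_left (hS_le hK hn u hx) hc
  · obtain ⟨x, hx, h1⟩ := hS_attained hK hn u
    rw [← h1, ← inner_smul_right]
    exact hS_le (hK.smul c) hn.smul_set u ⟨x, hx, rfl⟩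

theorem hS_close {K L : Set E} (hK : IsCompact K) (hn : K.Nonempty) (hL : IsCompact L)
    (hLn : L.Nonempty) {δ : ℝ} (hc : Close δ K L) {u : E} (hu : ‖u‖ = 1) :
    |hS K u - hS L u| ≤ δ := by
  have key : ∀ x y : E, dist x y ≤ δ → inner ℝ u x ≤ inner ℝ u y + δ := by
    intro x y h
    have h1 := real_inner_le_norm u (x - y)
    rw [hu, one_mul, ← dist_eq_norm, inner_sub_right] at h1
    linarith
  rw [abs_le]
  constructor
  · have : hS L u ≤ hS K u + δ := by
      apply hS_le_of hL hLn
      intro y hy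
      obtain ⟨x, hx, h⟩ := hc.2 y hy
      rw [dist_comm] at h
      linarith [key y x h, hS_le hK hn u hx]
    linarith
  · have : hS K u ≤ hS L u + δ := by
      apply hS_le_of hK hn
      intro x hx
      obtain ⟨y, hy, h⟩ := hc.1 x hx
      linarith [key x y h, hS_le hL hLn u hy]
    linarith

theorem hS_continuous {K : Set E} (hK : IsCompact K) (hn : K.Nonempty) : Continuous (hS K) := by
  obtain ⟨R, hR⟩ := hK.isBounded.exists_norm_le
  have hR0 : 0 ≤ R := by
    obtain ⟨x, hx⟩ := hn
    exact (norm_nonneg x).trans (hR x hx)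
  have key : ∀ u v, hS K u ≤ hS K v + R * dist u v := by
    intro u v
    apply hS_le_of hK hn
    intro x hx
    have h1 := real_inner_le_norm (u - v) x
    have h2 : ‖u - v‖ * ‖x‖ ≤ R * dist u v := by
      rw [dist_eq_norm, mul_comm]; gcongr; exact hR x hx
    rw [inner_sub_left] at h1
    linarith [hS_le hK hn v hx]
  have : LipschitzWith R.toNNReal (hS K) := by
    apply LipschitzWith.of_dist_le_mul
    intro u v
    rw [Real.dist_eq, abs_le]
    have h1 := key u v
    have h2 := key v u
    rw [dist_comm v u] at h2
    rw [Real.coe_toNNReal R hR0]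
    constructor <;> linarith
  exact this.continuous

/-- a convex body with constant support function is a ball -/
theorem eq_ball_of_hS [FiniteDimensional ℝ E] [Nontrivial E] {K : Set E} (hK : CC K)
    (hn : K.Nonempty) {r : ℝ} (h : ∀ u : E, ‖u‖ = 1 → hS K u = r) :
    0 ≤ r ∧ K = closedBall 0 r := by
  have : CompleteSpace E := FiniteDimensional.complete ℝ E
  have hr : 0 ≤ r := by
    obtain ⟨u, hu⟩ := exists_norm_eq E zero_le_one
    obtain ⟨x, hx⟩ := hn
    have h1 := hS_le hK.cpt ⟨x, hx⟩ u hx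
    have h2 := hS_le hK.cpt ⟨x, hx⟩ (-u) hx
    rw [h u hu] at h1
    rw [h (-u) (by rwa [norm_neg]), inner_neg_left] at h2
    linarith
  refine ⟨hr, ?_⟩
  ext x
  rw [mem_closedBall_zero_iff]
  constructor
  · intro hx
    by_cases hx0 : x = 0
    · rw [hx0, norm_zero]; exact hr
    · have hpos : 0 < ‖x‖ := norm_pos_iff.2 hx0
      have h1 := hS_le hK.cpt hn (‖x‖⁻¹ • x) hx
      rw [h _ (by rw [norm_smul, norm_inv, norm_norm, inv_mul_cancel₀ hpos.ne']), inner_smul_left,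
        real_inner_self_eq_norm_sq] at h1
      have : (starRingEnd ℝ) ‖x‖⁻¹ * ‖x‖ ^ 2 = ‖x‖ := by
        simp only [conj_trivial]; field_simp
      rwa [this] at h1
  · intro hx
    by_contra hxK
    obtain ⟨f, s, hf1, hf2⟩ := geometric_hahn_banach_closed_point hK.cvx hK.cpt.isClosed hxK
    set w := (InnerProductSpace.toDual ℝ E).symm f
    have hw : ∀ y, f y = inner ℝ w y := by intro y; simp [w]
    have hw0 : w ≠ 0 := by
      intro h0
      obtain ⟨y, hy⟩ := hn
      have := hf1 y hy
      rw [hw, h0, inner_zero_left] at this hf2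
      linarith
    have hpos : 0 < ‖w‖ := norm_pos_iff.2 hw0
    obtain ⟨y, hy, hy2⟩ := hS_attained hK.cpt hn (‖w‖⁻¹ • w)
    rw [h _ (by rw [norm_smul, norm_inv, norm_norm, inv_mul_cancel₀ hpos.ne']), inner_smul_left] at hy2
    simp only [conj_trivial] at hy2
    have h1 : inner ℝ w y < inner ℝ w x := by
      rw [← hw, ← hw]; exact (hf1 y hy).trans hf2
    have h2 := real_inner_le_norm w x
    have h3 : inner ℝ w y = r * ‖w‖ := by
      rw [← hy2]; field_simp
    have h4 : ‖w‖ * ‖x‖ ≤ ‖w‖ * r := by gcongr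
    linarith
end support

theorem hS_so {n : ℕ} {K : Set (En n)} (hK : IsCompact K) (hn : K.Nonempty) (g : SO n) (u : En n) :
    hS (soAct g '' K) u = hS K (soAct g⁻¹ u) := by
  have hgc : IsCompact (soAct g '' K) := hK.image (soAct g).continuous_of_finiteDimensional
  have key : ∀ x, inner ℝ u (soAct g x) = inner ℝ (soAct g⁻¹ u) x := by
    intro x
    rw [← soAct_inner g (soAct g⁻¹ u) x, ← soAct_mul, mul_inv_cancel, soAct_one]
  apply le_antisymm
  · apply hS_le_of hgc (hn.image _)
    rintro _ ⟨x, hx, rfl⟩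
    rw [key]; exact hS_le hK hn _ hx
  · apply hS_le_of hK hn
    intro x hx
    rw [← key]; exact hS_le hgc (hn.image _) u ⟨x, hx, rfl⟩

set_option linter.unusedSectionVars false
set_option linter.deprecated false

/-! ### Maximum principle -/

instance soSecond (n : ℕ) : SecondCountableTopology (SO n) := by
  have h0 : SecondCountableTopology (Matrix (Fin n) (Fin n) ℝ) :=
    inferInstanceAs (SecondCountableTopology (Fin n → Fin n → ℝ))
  have hE : Topology.IsEmbedding
      (fun g : SO n => ((g : Matrix.unitaryGroup (Fin n) ℝ) : Matrix (Fin n) (Fin n) ℝ)) :=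
    Topology.IsEmbedding.subtypeVal.comp Topology.IsEmbedding.subtypeVal
  exact hE.secondCountableTopology

theorem soAct_norm {n : ℕ} (g : SO n) (x : En n) : ‖soAct g x‖ = ‖x‖ := (soIso g).norm_map x

/-- base point of the sphere -/
def uo (m : ℕ) : En (m + 2) := EuclideanSpace.single 0 1

theorem uo_norm (m : ℕ) : ‖uo m‖ = 1 := by simp [uo]

def kk {m : ℕ} (K : Set (En (m + 2))) (g : SO (m + 2)) : ℝ := hS K (soAct g (uo m))

def rr {m : ℕ} (ν : Measure (SO (m + 2))) (K : Set (En (m + 2))) : ℝ := ∫ g, kk K g ∂ν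

def qq {m : ℕ} (ν : Measure (SO (m + 2))) (K : Set (En (m + 2))) : ℝ := ∫ g, kk K g ^ 2 ∂ν

def mid {m : ℕ} (K : Set (En (m + 2))) (g : SO (m + 2)) : Set (En (m + 2)) :=
  (1 / 2 : ℝ) • (K + soAct g '' K)

section maxp
variable {m : ℕ} {ν : Measure (SO (m + 2))} {K L : Set (En (m + 2))}

theorem kk_continuous (hK : CC K) (hn : K.Nonempty) : Continuous (kk K) :=
  (hS_continuous hK.cpt hn).comp (soAct_continuous _ _)

theorem kk_close (hK : CC K) (hn : K.Nonempty) (hL : CC L) (hLn : L.Nonempty) {δ : ℝ}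
    (hc : Close δ K L) (g : SO (m + 2)) : |kk K g - kk L g| ≤ δ :=
  hS_close hK.cpt hn hL.cpt hLn hc (by rw [soAct_norm, uo_norm])

theorem kk_bound (hK : CC K) (hn : K.Nonempty) {R : ℝ} (hR : K ⊆ closedBall 0 R)
    (g : SO (m + 2)) : |kk K g| ≤ R := by
  obtain ⟨x, hx, h⟩ := hS_attained hK.cpt hn (soAct g (uo m))
  rw [kk, ← h]
  have h1 := abs_real_inner_le_norm (soAct g (uo m)) x
  rw [soAct_norm, uo_norm, one_mul] at h1
  exact h1.trans (mem_closedBall_zero_iff.1 (hR hx))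

theorem int_bound (hν : IsAvg ν) {f : SO (m + 2) → ℝ} {C : ℝ} (h : ∀ g, |f g| ≤ C) :
    |∫ g, f g ∂ν| ≤ C := by
  have := hν.prob
  have h2 := norm_integral_le_of_norm_le_const (μ := ν) (f := f) (C := C)
      (Filter.Eventually.of_forall h)
  rw [Real.norm_eq_abs] at h2
  simpa only [measureReal_def, measure_univ, ENNReal.toReal_one, mul_one] using h2

theorem rr_close (hν : IsAvg ν) (hK : CC K) (hn : K.Nonempty) (hL : CC L) (hLn : L.Nonempty) {δ : ℝ}
    (hc : Close δ K L) : |rr ν K - rr ν L| ≤ δ := by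
  rw [rr, rr, ← integral_sub (so_integrable hν (kk_continuous hK hn))
    (so_integrable hν (kk_continuous hL hLn))]
  exact int_bound hν (kk_close hK hn hL hLn hc)

theorem qq_close (hν : IsAvg ν) (hK : CC K) (hn : K.Nonempty) (hL : CC L) (hLn : L.Nonempty) {δ R : ℝ}
    (hc : Close δ K L) (hR : K ⊆ closedBall 0 R) (hR' : L ⊆ closedBall 0 R) :
    |qq ν K - qq ν L| ≤ δ * (2 * R) := by
  have i1 : Integrable (fun g => kk K g ^ 2) ν := so_integrable hν ((kk_continuous hK hn).pow 2)
  have i2 : Integrable (fun g => kk L g ^ 2) ν := so_integrable hν ((kk_continuous hL hLn).pow 2)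
  rw [qq, qq, ← integral_sub i1 i2]
  apply int_bound hν
  intro g
  have h1 := kk_close hK hn hL hLn hc g
  have h2 := kk_bound hK hn hR g
  have h3 := kk_bound hL hLn hR' g
  have h4 : |kk K g + kk L g| ≤ 2 * R := (abs_add_le _ _).trans (by linarith)
  have h5 : kk K g ^ 2 - kk L g ^ 2 = (kk K g - kk L g) * (kk K g + kk L g) := by ring
  rw [h5, abs_mul]
  exact mul_le_mul h1 h4 (abs_nonneg _) ((abs_nonneg _).trans h1)

theorem mid_cc (hK : CC K) (g : SO (m + 2)) : CC (mid K g) := (hK.add (hK.image _)).smul _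

theorem mid_nonempty (hn : K.Nonempty) (g : SO (m + 2)) : (mid K g).Nonempty :=
  (hn.add (hn.image _)).smul_set

theorem mid_ball {R : ℝ} (hR : K ⊆ closedBall 0 R) (g : SO (m + 2)) : mid K g ⊆ closedBall 0 R := by
  rintro _ ⟨_, ⟨x, hx, _, ⟨y, hy, rfl⟩, rfl⟩, rfl⟩
  have h1 := mem_closedBall_zero_iff.1 (hR hx)
  have h2 := mem_closedBall_zero_iff.1 (hR hy)
  rw [← soAct_norm g] at h2
  have h3 := norm_add_le x (soAct g y)
  rw [mem_closedBall_zero_iff]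
  simp only [norm_smul]
  norm_num
  linarith

theorem kk_mid (hK : CC K) (hn : K.Nonempty) (g g' : SO (m + 2)) :
    kk (mid K g) g' = (kk K g' + kk K (g⁻¹ * g')) / 2 := by
  have h := hK.image (soAct g)
  rw [kk, mid, hS_smul (hK.add h).cpt (hn.add (hn.image _)) (by norm_num),
    hS_add hK.cpt hn h.cpt (hn.image _), hS_so hK.cpt hn, ← soAct_mul]
  simp only [kk]; ring

theorem rr_mid (hν : IsAvg ν) (hK : CC K) (hn : K.Nonempty) (g : SO (m + 2)) :
    rr ν (mid K g) = rr ν K := by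
  have hk := kk_continuous hK hn
  have hk' : Continuous fun g' => kk K (g⁻¹ * g') := hk.comp (continuous_const.mul continuous_id)
  simp only [rr, kk_mid hK hn]
  rw [integral_div, integral_add (so_integrable hν hk) (so_integrable hν hk'),
    hν.left (fun g' => kk K g')]
  ring

theorem qq_mid (hν : IsAvg ν) (hK : CC K) (hn : K.Nonempty) :
    Integrable (fun g => qq ν (mid K g)) ν ∧
    ∫ g, qq ν (mid K g) ∂ν = (qq ν K + rr ν K ^ 2) / 2 := by
  have := hν.prob
  have hk := kk_continuous hK hn
  have hc2 : Continuous (Function.uncurry fun g g' : SO (m + 2) => kk K g' * kk K (g⁻¹ * g')) := by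
    have h1 : Continuous fun p : SO (m + 2) × SO (m + 2) => kk K p.2 := hk.comp continuous_snd
    have h2 : Continuous fun p : SO (m + 2) × SO (m + 2) => kk K (p.1⁻¹ * p.2) :=
      hk.comp (continuous_fst.inv.mul continuous_snd)
    exact h1.mul h2
  have hJ : ∀ g, qq ν (mid K g) = (qq ν K + ∫ g', kk K g' * kk K (g⁻¹ * g') ∂ν) / 2 := by
    intro g
    have hk' : Continuous fun g' => kk K (g⁻¹ * g') := hk.comp (continuous_const.mul continuous_id)
    have e1 : ∀ g', kk (mid K g) g' ^ 2 = (1 / 4) * kk K g' ^ 2 + (1 / 4) * kk K (g⁻¹ * g') ^ 2 +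
        (1 / 2) * (kk K g' * kk K (g⁻¹ * g')) := by
      intro g'; rw [kk_mid hK hn]; ring
    simp only [qq, e1]
    rw [integral_add, integral_add, integral_const_mul, integral_const_mul, integral_const_mul,
      hν.left (fun g' => kk K g' ^ 2)]
    · ring
    · exact so_integrable hν (continuous_const.mul (hk.pow 2))
    · exact so_integrable hν (continuous_const.mul (hk'.pow 2))
    · exact so_integrable hν ((continuous_const.mul (hk.pow 2)).add (continuous_const.mul (hk'.pow 2)))
    · exact so_integrable hν (continuous_const.mul (hk.mul hk'))
  have hInt : Integrable (Function.uncurry fun g g' : SO (m + 2) => kk K g' * kk K (g⁻¹ * g'))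
      (ν.prod ν) := hc2.integrable_of_hasCompactSupport (HasCompactSupport.of_compactSpace _)
  have hJi : Integrable (fun g => ∫ g', kk K g' * kk K (g⁻¹ * g') ∂ν) ν := hInt.integral_prod_left
  have hsw : ∫ g, ∫ g', kk K g' * kk K (g⁻¹ * g') ∂ν ∂ν = rr ν K ^ 2 := by
    rw [integral_integral_swap hInt]
    have : ∀ g' : SO (m + 2), ∫ g, kk K g' * kk K (g⁻¹ * g') ∂ν = kk K g' * rr ν K := by
      intro g'
      rw [integral_const_mul, hν.inv (fun g => kk K (g * g')), hν.right (fun g => kk K g)]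
      rfl
    simp only [this]
    rw [integral_mul_const, sq]; rfl
  simp only [hJ]
  constructor
  · exact ((integrable_const _).add hJi).div_const 2
  · rw [integral_div, integral_add (integrable_const _) hJi, hsw]
    simp

theorem const_of_qq (hν : IsAvg ν) (hK : CC K) (hn : K.Nonempty) (h : qq ν K ≤ rr ν K ^ 2) :
    ∀ u : En (m + 2), ‖u‖ = 1 → hS K u = rr ν K := by
  have := hν.prob
  have := hν.pos
  have hk := kk_continuous hK hn
  have hall : ∀ g, kk K g = rr ν K := by
    intro g
    by_contra hne
    have hpos : 0 < ∫ g, (kk K g - rr ν K) ^ 2 ∂ν := by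
      refine Continuous.integral_pos_of_hasCompactSupport_nonneg_nonzero (x := g)
        ((hk.sub continuous_const).pow 2) (HasCompactSupport.of_compactSpace _)
        (fun g => sq_nonneg _) ?_
      exact pow_ne_zero 2 (sub_ne_zero.2 hne)
    have e1 : ∀ g, (kk K g - rr ν K) ^ 2 = kk K g ^ 2 - (2 * rr ν K) * kk K g + rr ν K ^ 2 := by
      intro g; ring
    simp only [e1] at hpos
    rw [integral_add, integral_sub, integral_const_mul] at hpos
    · have e2 : ∫ g, kk K g ∂ν = rr ν K := rfl
      have e3 : ∫ g, kk K g ^ 2 ∂ν = qq ν K := rfl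
      rw [e2, e3] at hpos
      simp at hpos
      nlinarith
    · exact so_integrable hν (hk.pow 2)
    · exact so_integrable hν (continuous_const.mul hk)
    · exact so_integrable hν ((hk.pow 2).sub (continuous_const.mul hk))
    · exact integrable_const _
  intro u hu
  have h1 := uo_norm m
  obtain ⟨h, hd, hh⟩ := exists_rot (E := En (m + 2)) (by simp) (h1.trans hu.symm)
    (by intro h0; rw [h0] at h1; simp at h1)
  obtain ⟨g, hg⟩ := exists_so h hd
  have := hall g
  rw [kk, hg, hh] at this
  exact this

theorem Close.of_dist {A B : TopologicalSpace.NonemptyCompacts (En (m + 2))} {δ : ℝ}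
    (h : dist A B < δ) : Close δ (A : Set (En (m + 2))) B := by
  rw [NonemptyCompacts.dist_eq] at h
  have hne : EMetric.hausdorffEdist (A : Set (En (m + 2))) B ≠ ⊤ :=
    hausdorffEDist_ne_top_of_nonempty_of_bounded A.nonempty B.nonempty
      A.isCompact.isBounded B.isCompact.isBounded
  constructor
  · intro x hx
    obtain ⟨y, hy, h'⟩ := exists_dist_lt_of_hausdorffDist_lt hx h hne
    exact ⟨y, hy, h'.le⟩
  · intro y hy
    obtain ⟨x, hx, h'⟩ := exists_dist_lt_of_hausdorffDist_lt' hy h hne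
    exact ⟨x, hx, h'.le⟩

theorem closed_class (hν : IsAvg ν) (r : ℝ) :
    IsClosed {A : TopologicalSpace.NonemptyCompacts (En (m + 2)) |
      Convex ℝ (A : Set (En (m + 2))) ∧ rr ν A = r} := by
  apply isClosed_of_closure_subset
  intro A hA
  rw [Metric.mem_closure_iff] at hA
  have hcl : ∀ ε > 0, ∃ B : TopologicalSpace.NonemptyCompacts (En (m + 2)),
      (Convex ℝ (B : Set (En (m + 2))) ∧ rr ν B = r) ∧ Close ε (A : Set (En (m + 2))) B := by
    intro ε hε
    obtain ⟨B, hB, hd⟩ := hA ε hε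
    exact ⟨B, hB, Close.of_dist hd⟩
  have hcvx : Convex ℝ (A : Set (En (m + 2))) := by
    intro x hx y hy a b ha hb hab
    rw [← A.isCompact.isClosed.closure_eq, Metric.mem_closure_iff]
    intro ε hε
    obtain ⟨B, ⟨hB, -⟩, hc⟩ := hcl (ε / 3) (by positivity)
    obtain ⟨x', hx', h1⟩ := hc.1 x hx
    obtain ⟨y', hy', h2⟩ := hc.1 y hy
    obtain ⟨z, hz, h3⟩ := hc.2 _ (hB hx' hy' ha hb hab)
    refine ⟨z, hz, ?_⟩
    have h4 : dist (a • x + b • y) (a • x' + b • y') ≤ ε / 3 := by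
      calc dist (a • x + b • y) (a • x' + b • y')
          ≤ dist (a • x) (a • x') + dist (b • y) (b • y') := dist_add_add_le _ _ _ _
        _ = a * dist x x' + b * dist y y' := by
          rw [dist_smul₀, dist_smul₀, Real.norm_of_nonneg ha, Real.norm_of_nonneg hb]
        _ ≤ a * (ε / 3) + b * (ε / 3) := by gcongr
        _ = ε / 3 := by rw [← add_mul, hab, one_mul]
    have h5 := dist_triangle (a • x + b • y) (a • x' + b • y') z
    rw [dist_comm] at h3
    linarith
  refine ⟨hcvx, ?_⟩
  by_contra hne
  have hpos : 0 < |rr ν A - r| := abs_pos.2 (sub_ne_zero.2 hne)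
  obtain ⟨B, ⟨hB, hBr⟩, hc⟩ := hcl (|rr ν A - r| / 2) (by positivity)
  have := rr_close hν ⟨A.isCompact, hcvx⟩ A.nonempty ⟨B.isCompact, hB⟩ B.nonempty hc
  rw [hBr] at this
  linarith

end maxp

set_option linter.unusedSectionVars false
set_option linter.deprecated false

/-! ### Vanishing of simple valuations, and the induction -/

section maxp
variable {m : ℕ} {ν : Measure (SO (m + 2))} {K L : Set (En (m + 2))}

theorem Good.mid_mean (hV : ∀ j < m + 2, Vprop j) (hU : Uprop (m + 1))
    {ψ : Set (En (m + 2)) → ℝ} (h : Good m ψ) (hν : IsAvg ν) (hK : CC K) (hn : K.Nonempty) :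
    Integrable (fun g => ψ (mid K g)) ν ∧ ∫ g, ψ (mid K g) ∂ν = ψ K := by
  have e1 : ∀ g, ψ (mid K g) = ψ (K + soAct g '' K) / 2 := by
    intro g
    have := h.dbl hV (mid_cc hK g)
    rw [mid, smul_smul] at this
    norm_num at this
    rw [mid, this]; norm_num
  simp only [e1]
  have hc := avg_continuous h.val hK hK
  refine ⟨so_integrable hν (hc.div_const 2), ?_⟩
  rw [integral_div]
  have := h.mean hV hU hν hK hn hK hn
  rw [avg] at this
  rw [this]; ring

theorem Good.max_principle (hV : ∀ j < m + 2, Vprop j) (hU : Uprop (m + 1))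
    {ψ : Set (En (m + 2)) → ℝ} (h : Good m ψ) (hν : IsAvg ν) (hK : CC K) (hn : K.Nonempty) :
    0 ≤ rr ν K ∧ ψ K ≤ ψ (closedBall 0 (rr ν K)) := by
  obtain ⟨R, hR⟩ := hK.cpt.isBounded.subset_closedBall (0 : En (m + 2))
  have hR0 : 0 ≤ R := by
    obtain ⟨x, hx⟩ := hn
    exact (norm_nonneg x).trans (mem_closedBall_zero_iff.1 (hR hx))
  set S : Set (TopologicalSpace.NonemptyCompacts (En (m + 2))) :=
    {A | (A : Set (En (m + 2))) ⊆ closedBall 0 R} ∩ {A | Convex ℝ (A : Set (En (m + 2))) ∧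
      rr ν A = rr ν K} with hS
  have hScomp : IsCompact S :=
    (TopologicalSpace.NonemptyCompacts.isCompact_subsets_of_isCompact
      (isCompact_closedBall (0 : En (m + 2)) R)).inter_right (closed_class hν _)
  let K0 : TopologicalSpace.NonemptyCompacts (En (m + 2)) := ⟨⟨K, hK.cpt⟩, hn⟩
  have hK0 : K0 ∈ S := ⟨hR, hK.cvx, rfl⟩
  have key : ∀ c : ℝ, 0 < c → 0 ≤ rr ν K ∧ ψ K ≤ ψ (closedBall 0 (rr ν K)) + c * qq ν K := by
    intro c hc
    have hcont : ContinuousOn (fun A : TopologicalSpace.NonemptyCompacts (En (m + 2)) =>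
        ψ A - c * qq ν A) S := by
      rw [Metric.continuousOn_iff]
      rintro B ⟨hB1, hB2, -⟩ ε hε
      have hBc : CC (B : Set (En (m + 2))) := ⟨B.isCompact, hB2⟩
      obtain ⟨δ, hδ, h1⟩ := h.val.cont B hBc B.nonempty (ε / 2) (half_pos hε)
      set δ' := ε / (2 * (c * (2 * R) + 1)) with hδ'
      have hpos : 0 < c * (2 * R) + 1 := by positivity
      have hδ'0 : 0 < δ' := by positivity
      refine ⟨min δ δ', lt_min hδ hδ'0, ?_⟩
      rintro A ⟨hA1, hA2, -⟩ hd
      have hAc : CC (A : Set (En (m + 2))) := ⟨A.isCompact, hA2⟩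
      have hcl := Close.of_dist hd
      have a1 := h1 A hAc A.nonempty (hcl.symm.mono (min_le_left _ _))
      have a2 := qq_close hν hAc A.nonempty hBc B.nonempty (hcl.mono (min_le_right _ _)) hA1 hB1
      have a3 : c * |qq ν A - qq ν B| < ε / 2 := by
        calc c * |qq ν A - qq ν B| ≤ c * (δ' * (2 * R)) := by gcongr
          _ = δ' * (c * (2 * R)) := by ring
          _ < δ' * (c * (2 * R) + 1) := by gcongr; linarith
          _ = ε / 2 := by rw [hδ']; field_simp
      have a4 : |c * (qq ν A - qq ν B)| < ε / 2 := by rwa [abs_mul, abs_of_pos hc]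
      rw [Real.dist_eq]
      rw [abs_lt] at *
      constructor <;> nlinarith [a1.1, a1.2, a4.1, a4.2]
    obtain ⟨A, ⟨hA1, hA2, hA3⟩, hmax⟩ := hScomp.exists_isMaxOn ⟨K0, hK0⟩ hcont
    have hAc : CC (A : Set (En (m + 2))) := ⟨A.isCompact, hA2⟩
    obtain ⟨i1, e1⟩ := h.mid_mean hV hU hν hAc A.nonempty
    obtain ⟨i2, e2⟩ := qq_mid hν hAc A.nonempty
    have hle : ∀ g : SO (m + 2), ψ (mid A g) - c * qq ν (mid A g) ≤ ψ A - c * qq ν A := by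
      intro g
      exact hmax (a := (⟨⟨mid A g, (mid_cc hAc g).cpt⟩, mid_nonempty A.nonempty g⟩ :
        TopologicalSpace.NonemptyCompacts (En (m + 2))))
        ⟨mid_ball hA1 g, (mid_cc hAc g).cvx, (rr_mid hν hAc A.nonempty g).trans hA3⟩
    have := hν.prob
    have hle2 := integral_mono (μ := ν) (i1.sub (i2.const_mul c)) (integrable_const _) hle
    have e3 : ∫ g, (ψ (mid A g) - c * qq ν (mid A g)) ∂ν = ψ A - c * ((qq ν A + rr ν A ^ 2) / 2) := by
      rw [integral_sub i1 (i2.const_mul c), integral_const_mul, e1, e2]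
    have e4 : ∫ _ : SO (m + 2), (ψ A - c * qq ν A) ∂ν = ψ A - c * qq ν A := by simp
    have hle3 : ψ A - c * ((qq ν A + rr ν A ^ 2) / 2) ≤ ψ A - c * qq ν A := by
      rw [← e3, ← e4]; exact hle2
    have hq : qq ν A ≤ rr ν A ^ 2 := by
      have : c * qq ν A ≤ c * ((qq ν A + rr ν A ^ 2) / 2) := by linarith
      have := le_of_mul_le_mul_left this hc
      linarith
    have hconst := const_of_qq hν hAc A.nonempty hq
    rw [hA3] at hconst
    obtain ⟨hr0, hball⟩ := eq_ball_of_hS hAc A.nonempty hconst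
    refine ⟨hr0, ?_⟩
    have hK1 : ψ K - c * qq ν K ≤ ψ A - c * qq ν A := hmax hK0
    have hq0 : 0 ≤ qq ν A := integral_nonneg fun g => sq_nonneg _
    rw [hball] at hK1 hq0
    nlinarith [mul_nonneg hc.le hq0]
  refine ⟨(key 1 one_pos).1, ?_⟩
  apply le_of_forall_pos_le_add
  intro ε hε
  have hq0 : 0 ≤ qq ν K := integral_nonneg fun g => sq_nonneg _
  have h1 := (key (ε / (qq ν K + 1)) (by positivity)).2
  have h2 : ε / (qq ν K + 1) * qq ν K ≤ ε := by
    rw [div_mul_eq_mul_div, div_le_iff₀ (by positivity)]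
    nlinarith
  linarith

theorem Good.neg {ψ : Set (En (m + 2)) → ℝ} (h : Good m ψ) : Good m (fun K => -1 * ψ K) :=
  ⟨h.val.const_mul (-1), fun g hg K hK => by simp only [h.rot g hg K hK],
    fun f c hf K hK hc => by simp only [h.simp f c hf K hK hc, mul_zero],
    by simp only [h.cub, mul_zero]⟩

theorem Good.eq_ball (hV : ∀ j < m + 2, Vprop j) (hU : Uprop (m + 1))
    {ψ : Set (En (m + 2)) → ℝ} (h : Good m ψ) (hν : IsAvg ν) (hK : CC K) (hn : K.Nonempty) :
    0 ≤ rr ν K ∧ ψ K = ψ (closedBall 0 (rr ν K)) := by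
  obtain ⟨h0, h1⟩ := h.max_principle hV hU hν hK hn
  obtain ⟨-, h2⟩ := h.neg.max_principle hV hU hν hK hn
  exact ⟨h0, le_antisymm h1 (by linarith)⟩

theorem segment_cc (x y : En (m + 2)) : CC (segment ℝ x y) :=
  ⟨by
    rw [segment_eq_image]
    exact isCompact_Icc.image (by fun_prop), convex_segment x y⟩

theorem Good.segment_zero (hV : ∀ j < m + 2, Vprop j) {ψ : Set (En (m + 2)) → ℝ} (h : Good m ψ)
    {t : ℝ} (ht : 0 ≤ t) : ψ (segment ℝ 0 (t • uo m)) = 0 := by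
  have := h.seg hV (CC.singleton 0) ht (uo_norm m)
  rw [h.simp.point, singleton_zero, zero_add] at this
  exact this

theorem rr_segment_pos (hν : IsAvg ν) : 0 < rr ν (segment ℝ 0 (uo m)) := by
  have := hν.prob
  have := hν.pos
  have hcc := segment_cc (0 : En (m + 2)) (uo m)
  have hn : (segment ℝ (0 : En (m + 2)) (uo m)).Nonempty := ⟨0, left_mem_segment ℝ _ _⟩
  refine Continuous.integral_pos_of_hasCompactSupport_nonneg_nonzero (x := 1)
    (kk_continuous hcc hn) (HasCompactSupport.of_compactSpace _) (fun g => ?_) ?_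
  · have := hS_le hcc.cpt hn (soAct g (uo m)) (left_mem_segment ℝ _ _)
    rw [inner_zero_right] at this
    exact this
  · have := hS_le hcc.cpt hn (soAct 1 (uo m)) (right_mem_segment ℝ _ _)
    rw [soAct_one, real_inner_self_eq_norm_sq, uo_norm] at this
    rw [kk, soAct_one]
    linarith

theorem V_ge_two (hV : ∀ j < m + 2, Vprop j) (hU : Uprop (m + 1)) : Vprop (m + 2) := by
  intro ψ hv hr hs hc K hK
  have h : Good m ψ := ⟨hv, hr, hs, hc⟩
  rcases K.eq_empty_or_nonempty with rfl | hn
  · exact hv.empty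
  obtain ⟨ν, hν⟩ := exists_avg (m + 2)
  obtain ⟨h0, h1⟩ := h.eq_ball hV hU hν hK hn
  set s := rr ν (segment ℝ 0 (uo m)) with hsdef
  have hspos : 0 < s := rr_segment_pos hν
  have hcc := segment_cc (0 : En (m + 2)) (uo m)
  have hsn : (segment ℝ (0 : En (m + 2)) (uo m)).Nonempty := ⟨0, left_mem_segment ℝ _ _⟩
  set t := rr ν K / s with ht
  have ht0 : 0 ≤ t := by positivity
  have e1 : segment ℝ (0 : En (m + 2)) (t • uo m) = t • segment ℝ 0 (uo m) := by
    rw [segment_eq_image, segment_eq_image, ← image_smul, image_image]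
    apply image_congr
    intro a _
    simp only [smul_zero, zero_add]
    rw [smul_comm]
  have e2 : rr ν (segment ℝ 0 (t • uo m)) = rr ν K := by
    rw [e1]
    have : ∀ g, kk (t • segment ℝ (0 : En (m + 2)) (uo m)) g = t * kk (segment ℝ 0 (uo m)) g :=
      fun g => hS_smul hcc.cpt hsn ht0 _
    have e3 : rr ν (t • segment ℝ (0 : En (m + 2)) (uo m)) = t * s := by
      simp only [rr, this]
      rw [integral_const_mul]; rfl
    rw [e3, ht]; field_simp
  have h2 := (h.eq_ball hV hU hν (segment_cc 0 (t • uo m)) ⟨0, left_mem_segment ℝ _ _⟩).2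
  rw [h.segment_zero hV ht0, e2] at h2
  rw [h1, ← h2]
end maxp

theorem UV_all : ∀ n : ℕ, Uprop n ∧ Vprop n := by
  intro n
  induction n using Nat.strong_induction_on with
  | _ n ih =>
    match n, ih with
    | 0, _ => exact ⟨U_zero, V_zero⟩
    | 1, ih => exact ⟨U_succ (ih 0 (by norm_num)).1 V_one, V_one⟩
    | m + 2, ih =>
      have hV : Vprop (m + 2) := V_ge_two (fun j hj => (ih j hj).2) (ih (m + 1) (by omega)).1
      exact ⟨U_succ (ih (m + 1) (by omega)).1 hV, hV⟩

set_option linter.unusedSectionVars false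
set_option linter.deprecated false

/-- convex body from a set -/
def mkBody {n : ℕ} (K : Set (En n)) (h : CC K) (hn : K.Nonempty) : ConvexBody (En n) :=
  ⟨K, h.cvx, h.cpt, hn⟩

theorem mkBody_coe {n : ℕ} (K : Set (En n)) (h : CC K) (hn : K.Nonempty) :
    (mkBody K h hn : Set (En n)) = K := rfl

theorem body_cc {n : ℕ} (K : ConvexBody (En n)) : CC (K : Set (En n)) :=
  ⟨K.isCompact, K.convex⟩

open Classical in
/-- extension of a body functional to sets -/
def extV {n : ℕ} (φ : ConvexBody (En n) → ℝ) (K : Set (En n)) : ℝ :=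
  if h : CC K ∧ K.Nonempty then φ (mkBody K h.1 h.2) else 0

theorem extV_mk {n : ℕ} (φ : ConvexBody (En n) → ℝ) {K : Set (En n)} (h : CC K) (hn : K.Nonempty) :
    extV φ K = φ (mkBody K h hn) := by
  rw [extV, dif_pos ⟨h, hn⟩]

theorem extV_coe {n : ℕ} (φ : ConvexBody (En n) → ℝ) (K : ConvexBody (En n)) :
    extV φ (K : Set (En n)) = φ K := by
  rw [extV_mk φ (body_cc K) K.nonempty]
  congr 1

theorem extV_empty {n : ℕ} (φ : ConvexBody (En n) → ℝ) : extV φ ∅ = 0 := by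
  simp [extV]

theorem extV_isVal {n : ℕ} {φ : ConvexBody (En n) → ℝ} (hval : IsValuation φ) (hcont : Continuous φ)
    (htrans : IsTranslationInvariant φ) : IsVal (extV φ) where
  empty := extV_empty φ
  union K L hK hL hU hI := by
    have hKn : K.Nonempty := hI.mono inter_subset_left
    have hLn : L.Nonempty := hI.mono inter_subset_right
    have hUc : CC (K ∪ L) := ⟨hK.cpt.union hL.cpt, hU⟩
    rw [extV_mk φ hUc (hKn.mono subset_union_left), extV_mk φ (hK.inter hL) hI, extV_mk φ hK hKn,
      extV_mk φ hL hLn]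
    exact hval _ _ _ _ rfl rfl
  cont K hK hn ε hε := by
    obtain ⟨δ, hδ, h⟩ := Metric.continuous_iff.1 hcont (mkBody K hK hn) ε hε
    refine ⟨δ / 2, by positivity, fun L hL hLn hc => ?_⟩
    rw [extV_mk φ hK hn, extV_mk φ hL hLn, ← Real.dist_eq]
    apply h
    rw [← ConvexBody.hausdorffDist_coe, mkBody_coe, mkBody_coe]
    refine lt_of_le_of_lt (hausdorffDist_le_of_mem_dist (r := δ / 2) (by positivity) ?_ ?_) (by linarith)
    · intro x hx
      obtain ⟨y, hy, h'⟩ := hc.2 x hx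
      exact ⟨y, hy, by rwa [dist_comm]⟩
    · intro x hx
      obtain ⟨y, hy, h'⟩ := hc.1 x hx
      exact ⟨y, hy, h'⟩
  trans x K hK := by
    rcases K.eq_empty_or_nonempty with rfl | hn
    · simp
    · rw [extV_mk φ hK hn, extV_mk φ (hK.vadd x) (by simpa using hn)]
      exact htrans x _ _ rfl

theorem extV_isRot {n : ℕ} {φ : ConvexBody (En n) → ℝ} (hso : IsSOInvariant n φ) : IsRot (extV φ) := by
  apply isRot_of_so
  intro g K hK
  rcases K.eq_empty_or_nonempty with rfl | hn
  · simp
  · rw [extV_mk φ hK hn, extV_mk φ (hK.image (soAct g)) (hn.image _)]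
    exact hso g _ _ rfl

/-- parallel volume -/
def Wp {n : ℕ} (t : ℝ) (K : Set (En n)) : ℝ := (volume (K + t • closedBall (0 : En n) 1)).toReal

theorem Wp_cc {n : ℕ} (t : ℝ) {K : Set (En n)} (hK : CC K) : CC (K + t • closedBall (0 : En n) 1) :=
  hK.add ((CC.ball 1).smul t)

theorem Wp_mono {n : ℕ} {s t : ℝ} {K L : Set (En n)} (hL : CC L)
    (h : K + s • closedBall (0 : En n) 1 ⊆ L + t • closedBall (0 : En n) 1) : Wp s K ≤ Wp t L :=
  ENNReal.toReal_mono (Wp_cc t hL).cpt.measure_lt_top.ne (measure_mono h)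

theorem Wp_le {n : ℕ} {s δ : ℝ} {K L : Set (En n)} (hs : 0 ≤ s) (hδ : 0 ≤ δ) (hL : CC L)
    (h : ∀ x ∈ K, ∃ y ∈ L, dist x y ≤ δ) : Wp s K ≤ Wp (δ + s) L := by
  apply Wp_mono hL
  rw [(convex_closedBall (0 : En n) 1).add_smul hδ hs, ← add_assoc]
  apply Set.add_subset_add_right
  intro x hx
  obtain ⟨y, hy, hd⟩ := h x hx
  refine ⟨y, hy, x - y, ?_, by simp⟩
  rw [smul_unitClosedBall_of_nonneg hδ]
  simpa [← dist_eq_norm] using hd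

theorem Wp_isVal {n : ℕ} {μ : Fin (n+1) → ConvexBody (En n) → ℝ} (hμ : SteinerFamily n μ)
    {t : ℝ} (ht : 0 < t) : IsVal (Wp t : Set (En n) → ℝ) where
  empty := by simp [Wp]
  union K L hK hL hU hI := by
    have h := inter_add_of_convex hK hL hU ((CC.ball (E := En n) 1).smul t).cvx
    have h2 := measure_union_add_inter (μ := (volume : Measure (En n)))
      (K + t • closedBall (0 : En n) 1) (t := L + t • closedBall (0 : En n) 1)
      (Wp_cc t hL).cpt.measurableSet
    rw [← Set.union_add, ← h] at h2
    have hUc : CC (K ∪ L) := ⟨hK.cpt.union hL.cpt, hU⟩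
    have h3 := congrArg ENNReal.toReal h2
    rw [ENNReal.toReal_add (Wp_cc t hUc).cpt.measure_lt_top.ne
        (Wp_cc t (hK.inter hL)).cpt.measure_lt_top.ne,
      ENNReal.toReal_add (Wp_cc t hK).cpt.measure_lt_top.ne
        (Wp_cc t hL).cpt.measure_lt_top.ne] at h3
    exact h3
  cont K hK hn ε hε := by
    have hc : Continuous (fun s : ℝ => ∑ k : Fin (n+1),
      μ k.rev (mkBody K hK hn) * ballVol (k : ℕ) * s ^ (k : ℕ)) := by fun_prop
    have hW : ∀ s, 0 ≤ s → Wp s K = ∑ k : Fin (n+1),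
      μ k.rev (mkBody K hK hn) * ballVol (k : ℕ) * s ^ (k : ℕ) := fun s hs => hμ (mkBody K hK hn) s hs
    obtain ⟨δ, hδ, h⟩ := Metric.continuous_iff.1 hc t ε hε
    have hm : 0 < min (δ / 2) t := by positivity
    set d := min (δ / 2) t with hd
    have hd1 : d ≤ δ / 2 := min_le_left _ _
    have hd2 : d ≤ t := min_le_right _ _
    refine ⟨d, hm, fun L hL hLn hcl => ?_⟩
    have a1 : Wp t L ≤ Wp (d + t) K := Wp_le ht.le hm.le hK (fun x hx => by
      obtain ⟨y, hy, h'⟩ := hcl.2 x hx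
      exact ⟨y, hy, by rwa [dist_comm]⟩)
    have a2 : Wp (t - d) K ≤ Wp (d + (t - d)) L := Wp_le (by linarith) hm.le hL hcl.1
    rw [show d + (t - d) = t by ring] at a2
    have b1 := h (d + t) (by rw [Real.dist_eq, add_sub_cancel_right, abs_of_pos hm]; linarith)
    have b2 := h (t - d) (by
      rw [Real.dist_eq, show t - d - t = -d by ring, abs_neg, abs_of_pos hm]; linarith)
    rw [← hW _ (by linarith), ← hW _ ht.le, Real.dist_eq, abs_lt] at b1
    rw [← hW _ (by linarith), ← hW _ ht.le, Real.dist_eq, abs_lt] at b2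
    rw [abs_lt]
    constructor <;> linarith
  trans x K hK := by
    unfold Wp
    rw [vadd_add_assoc, measure_vadd]

theorem Wp_isRot {n : ℕ} (t : ℝ) : IsRot (Wp t : Set (En n) → ℝ) := by
  intro g _ K hK
  unfold Wp
  have h1 : g '' closedBall (0 : En n) 1 = closedBall 0 1 := by
    rw [g.image_closedBall, map_zero]
  have h2 : g '' (K + t • closedBall (0 : En n) 1) = g '' K + t • closedBall (0 : En n) 1 := by
    rw [Set.image_add, Set.image_smul_comm _ _ _ (fun b => map_smul g t b), h1]
  rw [← h2]
  congr 1
  have := g.measurePreserving.measure_preimage (Wp_cc t (hK.isom g)).cpt.nullMeasurableSet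
  rw [h2.symm.symm, ← this]
  congr 1
  rw [← h2, Set.preimage_image_eq _ g.injective]

/-- Vandermonde matrix with nodes `1, …, n+1` -/
def VM (n : ℕ) : Matrix (Fin (n+1)) (Fin (n+1)) ℝ := Matrix.vandermonde (fun i => ((i : ℕ) : ℝ) + 1)

theorem VM_unit (n : ℕ) : IsUnit (VM n).det := by
  rw [isUnit_iff_ne_zero, VM, Matrix.det_vandermonde_ne_zero_iff]
  intro i j h
  simpa [Fin.ext_iff] using h

theorem VM_inj {n : ℕ} {a b : Fin (n+1) → ℝ}
    (h : ∀ i : Fin (n+1), ∑ k : Fin (n+1), a k * (((i : ℕ) : ℝ) + 1) ^ (k : ℕ)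
      = ∑ k : Fin (n+1), b k * (((i : ℕ) : ℝ) + 1) ^ (k : ℕ)) : a = b := by
  apply Matrix.mulVec_injective_iff_isUnit.2 ((Matrix.isUnit_iff_isUnit_det _).2 (VM_unit n))
  ext i
  simp only [VM, Matrix.mulVec, dotProduct, Matrix.vandermonde_apply]
  simpa only [mul_comm] using h i

theorem VM_inv {n : ℕ} {a b : Fin (n+1) → ℝ}
    (h : ∀ i : Fin (n+1), b i = ∑ k : Fin (n+1), a k * (((i : ℕ) : ℝ) + 1) ^ (k : ℕ)) (k : Fin (n+1)) :
    a k = ∑ i, (VM n)⁻¹ k i * b i := by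
  have h1 : b = (VM n).mulVec a := by
    ext i
    simp only [VM, Matrix.mulVec, dotProduct, Matrix.vandermonde_apply]
    simpa only [mul_comm] using h i
  have h2 : (VM n)⁻¹.mulVec b = a := by
    rw [h1, Matrix.mulVec_mulVec, Matrix.nonsing_inv_mul _ (VM_unit n), Matrix.one_mulVec]
  rw [← h2]; rw [h2]; exact (congrFun h2 k).symm

theorem ballVol_pos (k : ℕ) : 0 < ballVol k :=
  ENNReal.toReal_pos (measure_closedBall_pos _ _ one_pos).ne' measure_closedBall_lt_top.ne

/-- intrinsic volumes as set functions -/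
def nuV (n : ℕ) (k : Fin (n+1)) (K : Set (En n)) : ℝ :=
  ∑ i : Fin (n+1), ((ballVol (k.rev : ℕ))⁻¹ * (VM n)⁻¹ k.rev i) * Wp (((i : ℕ) : ℝ) + 1) K

theorem nuV_eq {n : ℕ} {μ : Fin (n+1) → ConvexBody (En n) → ℝ} (hμ : SteinerFamily n μ)
    (k : Fin (n+1)) (K : ConvexBody (En n)) : nuV n k (K : Set (En n)) = μ k K := by
  have h := VM_inv (a := fun k => μ k.rev K * ballVol (k : ℕ))
    (b := fun i => Wp (((i : ℕ) : ℝ) + 1) (K : Set (En n))) (fun i => hμ K _ (by positivity)) k.rev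
  simp only [Fin.rev_rev] at h
  have hp := (ballVol_pos (k.rev : ℕ)).ne'
  unfold nuV
  simp only [mul_assoc]
  rw [← Finset.mul_sum, ← h]
  field_simp

theorem nuV_isVal {n : ℕ} {μ : Fin (n+1) → ConvexBody (En n) → ℝ} (hμ : SteinerFamily n μ)
    (k : Fin (n+1)) : IsVal (nuV n k) :=
  IsVal.sum _ (fun i _ => (Wp_isVal hμ (by positivity)).const_mul _)

theorem nuV_isRot (n : ℕ) (k : Fin (n+1)) : IsRot (nuV n k) := by
  intro g hg K hK
  unfold nuV
  simp only [Wp_isRot _ g hg K hK]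

theorem mu_ball {n : ℕ} {μ : Fin (n+1) → ConvexBody (En n) → ℝ} (hμ : SteinerFamily n μ)
    {r : ℝ} (hr : 0 ≤ r) (k : Fin (n+1)) :
    μ k.rev (mkBody (closedBall 0 r) (CC.ball r) (nonempty_closedBall.2 hr)) * ballVol (k : ℕ)
      = (n.choose k : ℝ) * ballVol n * r ^ (n - (k : ℕ)) := by
  have key : (fun k : Fin (n+1) =>
      μ k.rev (mkBody (closedBall 0 r) (CC.ball r) (nonempty_closedBall.2 hr)) * ballVol (k : ℕ))
      = fun k : Fin (n+1) => (n.choose k : ℝ) * ballVol n * r ^ (n - (k : ℕ)) := by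
    apply VM_inj
    intro i
    have h := hμ (mkBody (closedBall 0 r) (CC.ball r) (nonempty_closedBall.2 hr))
      (((i : ℕ) : ℝ) + 1) (by positivity)
    rw [← h, mkBody_coe, smul_unitClosedBall_of_nonneg (by positivity),
      closedBall_add_closedBall hr (by positivity), zero_add,
      Measure.addHaar_closedBall' _ _ (by positivity), finrank_euclideanSpace_fin,
      ENNReal.toReal_mul, ENNReal.toReal_ofReal (by positivity), add_comm r, add_pow,
      ← Fin.sum_univ_eq_sum_range (fun k => (((i : ℕ) : ℝ) + 1) ^ k * r ^ (n - k) * (n.choose k : ℝ)),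
      Finset.sum_mul]
    apply Finset.sum_congr rfl
    intro k _
    have : (volume (closedBall (0 : En n) 1)).toReal = ballVol n := rfl
    rw [this]; ring
  exact congrFun key k

theorem mu_indep {n : ℕ} {μ : Fin (n+1) → ConvexBody (En n) → ℝ} (hμ : SteinerFamily n μ)
    {c : Fin (n+1) → ℝ} (h : ∀ K, ∑ k, c k * μ k K = 0) : c = 0 := by
  have key : (fun k : Fin (n+1) => c k * ((n.choose (k.rev : ℕ) : ℝ) * ballVol n / ballVol (k.rev : ℕ)))
      = fun _ => 0 := by
    apply VM_inj
    intro i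
    have h0 := h (mkBody (closedBall 0 (((i : ℕ) : ℝ) + 1)) (CC.ball _)
      (nonempty_closedBall.2 (by positivity)))
    rw [show (∑ k : Fin (n+1), (0 : ℝ) * (((i : ℕ) : ℝ) + 1) ^ (k : ℕ)) = 0 by simp, ← h0]
    apply Finset.sum_congr rfl
    intro k _
    have h1 := mu_ball hμ (r := ((i : ℕ) : ℝ) + 1) (by positivity) k.rev
    rw [Fin.rev_rev] at h1
    have h2 : n - (k.rev : ℕ) = k := by
      rw [Fin.val_rev]; omega
    rw [h2] at h1
    have hp := (ballVol_pos (k.rev : ℕ)).ne'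
    rw [eq_div_of_mul_eq hp h1]
    ring
  ext k
  have h1 := congrFun key k
  have hp : 0 < (n.choose (k.rev : ℕ) : ℝ) := by
    exact_mod_cast Nat.choose_pos (by omega)
  have := ballVol_pos n
  have := ballVol_pos (k.rev : ℕ)
  rcases mul_eq_zero.1 h1 with h2 | h2
  · exact h2
  · exact absurd h2 (by positivity)

/-- evaluation on cubes -/
def evalCubes (n : ℕ) : (Fin (n+1) → ℝ) →ₗ[ℝ] (Fin (n+1) → ℝ) where
  toFun c := fun j => ∑ k, c k * nuV n k (cube n j)
  map_add' a b := by
    ext j; simp only [Pi.add_apply, add_mul, Finset.sum_add_distrib]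
  map_smul' a b := by
    ext j; simp only [Pi.smul_apply, smul_eq_mul, mul_assoc, Finset.mul_sum, RingHom.id_apply]

theorem comb_isVal {n : ℕ} {μ : Fin (n+1) → ConvexBody (En n) → ℝ} (hμ : SteinerFamily n μ)
    (c : Fin (n+1) → ℝ) : IsVal (fun K => ∑ k, c k * nuV n k K) :=
  IsVal.sum _ (fun k _ => (nuV_isVal hμ k).const_mul _)

theorem comb_isRot {n : ℕ} (c : Fin (n+1) → ℝ) : IsRot (fun K => ∑ k, c k * nuV n k K) := by
  intro g hg K hK
  simp only [nuV_isRot n _ g hg K hK]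

theorem evalCubes_inj {n : ℕ} {μ : Fin (n+1) → ConvexBody (En n) → ℝ} (hμ : SteinerFamily n μ) :
    Function.Injective (evalCubes n) := by
  rw [← LinearMap.ker_eq_bot, LinearMap.ker_eq_bot']
  intro c hc
  apply mu_indep hμ
  intro K
  have := (UV_all n).1 _ (comb_isVal hμ c) (comb_isRot c) (fun j hj => by
    have := congrFun hc ⟨j, by omega⟩
    simpa [evalCubes] using this) K (body_cc K)
  simpa only [nuV_eq hμ] using this

theorem hadwiger_main (n : ℕ)
    (μ : Fin (n+1) → ConvexBody (En n) → ℝ) (hμ : SteinerFamily n μ)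
    (φ : ConvexBody (En n) → ℝ) (hval : IsValuation φ) (hcont : Continuous φ)
    (htrans : IsTranslationInvariant φ) (hso : IsSOInvariant n φ) :
    ∃! c : Fin (n+1) → ℝ, ∀ K : ConvexBody (En n),
      φ K = ∑ k : Fin (n+1), c k * μ k K := by
  obtain ⟨c, hc⟩ := LinearMap.injective_iff_surjective.1 (evalCubes_inj hμ)
    (fun j => extV φ (cube n j))
  refine ⟨c, fun K => ?_, fun c' hc' => ?_⟩
  · have h := (UV_all n).1 _ ((extV_isVal hval hcont htrans).sub (comb_isVal hμ c))
      (fun g hg K hK => by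
        simp only [extV_isRot hso g hg K hK, nuV_isRot n _ g hg K hK])
      (fun j hj => by
        have := congrFun hc ⟨j, by omega⟩
        simp only [evalCubes, LinearMap.coe_mk, AddHom.coe_mk] at this
        simp only [this, sub_self]) K (body_cc K)
    simp only [extV_coe, nuV_eq hμ] at h
    linarith
  · have hK : ∀ K : ConvexBody (En n), φ K = ∑ k : Fin (n+1), c k * μ k K := fun K => by
      have h := (UV_all n).1 _ ((extV_isVal hval hcont htrans).sub (comb_isVal hμ c))
        (fun g hg K hK => by
          simp only [extV_isRot hso g hg K hK, nuV_isRot n _ g hg K hK])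
        (fun j hj => by
          have := congrFun hc ⟨j, by omega⟩
          simp only [evalCubes, LinearMap.coe_mk, AddHom.coe_mk] at this
          simp only [this, sub_self]) K (body_cc K)
      simp only [extV_coe, nuV_eq hμ] at h
      linarith
    have h0 := mu_indep hμ (c := c' - c) (fun K => by
      simp only [Pi.sub_apply, sub_mul, Finset.sum_sub_distrib]
      rw [← hc' K, ← hK K, sub_self])
    exact sub_eq_zero.1 h0

/-- Hadwiger's theorem. Every continuous, translation invariant,
`SO(n)`-invariant valuation is a unique linear combination of the intrinsic volumes. -/
theorem statement3 (n : ℕ) (hn : 1 ≤ n)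
    (μ : Fin (n+1) → ConvexBody (En n) → ℝ) (hμ : SteinerFamily n μ)
    (φ : ConvexBody (En n) → ℝ) (hval : IsValuation φ) (hcont : Continuous φ)
    (htrans : IsTranslationInvariant φ) (hso : IsSOInvariant n φ) :
    ∃! c : Fin (n+1) → ℝ, ∀ K : ConvexBody (En n),
      φ K = ∑ k : Fin (n+1), c k * μ k K := by
  exact hadwiger_main n μ hμ φ hval hcont htrans hso

end
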